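/- arXiv:1107.4791 — 3 statements merged into one kernel-verified Lean document; each statement's English description precedes it below -/
import Mathlib

section
/- Let Λ : ℕ → ℝ be the increasing enumeration of the eigenvalues of the problem (α,β) with α = 12/b² and β = 6/b, and let M : ℕ → ℝ be the increasing enumeration of the eigenvalues of the problem (α,β) with α = 12a²/b² and β = 6a/b. Then for every n ∈ ℕ one has Λ(κ·(n+1) − 1) = (κ/a³)·M(n). -/
open Set Filter

/-- First derivative on `[0,1]` (one-sided at the endpoints). -/
noncomputable def Y1 (y : ℝ → ℝ) : ℝ → ℝ := derivWithin y (Set.Icc 0 1)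
/-- Second derivative on `[0,1]`. -/
noncomputable def Y2 (y : ℝ → ℝ) : ℝ → ℝ := iteratedDerivWithin 2 y (Set.Icc 0 1)
/-- Third derivative on `[0,1]`. -/
noncomputable def Y3 (y : ℝ → ℝ) : ℝ → ℝ := iteratedDerivWithin 3 y (Set.Icc 0 1)

/-- `y` is a solution on `[0,1]` of `[y''' - λ P y]' + λ P y' = 0`:
`y ∈ C³[0,1]` and `y''' - λ P y` is (continuously) differentiable on `[0,1]`
with derivative `-λ P y'`. -/
def SolutionOn (P : ℝ → ℝ) (lam : ℝ) (y : ℝ → ℝ) : Prop :=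
  ContDiffOn ℝ 3 y (Set.Icc 0 1) ∧
  ∀ x ∈ Set.Icc (0:ℝ) 1,
    HasDerivWithinAt (fun t => Y3 y t - lam * P t * y t)
      (-(lam * P x * Y1 y x)) (Set.Icc 0 1) x

/-- `y` is not identically zero on `[0,1]`. -/
def Nontrivial01 (y : ℝ → ℝ) : Prop := ∃ x ∈ Set.Icc (0:ℝ) 1, y x ≠ 0

/-- The boundary conditions of the problem `(α, β)`. -/
def BC (α β : ℝ) (y : ℝ → ℝ) : Prop :=
  Y2 y 0 + α * y 0 - β * Y1 y 0 = 0 ∧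
  -β * Y3 y 0 + α * Y2 y 0 = 0 ∧
  Y2 y 1 + α * y 1 + β * Y1 y 1 = 0 ∧
  -β * Y3 y 1 - α * Y2 y 1 = 0

/-- `y` is an eigenfunction of the problem `(α, β)` with eigenvalue `lam`. -/
def Eigenfunction (P : ℝ → ℝ) (α β lam : ℝ) (y : ℝ → ℝ) : Prop :=
  Nontrivial01 y ∧ SolutionOn P lam y ∧ BC α β y

/-- `lam` is an eigenvalue of the problem `(α, β)`. -/
def IsEigenvalue (P : ℝ → ℝ) (α β lam : ℝ) : Prop :=
  ∃ y : ℝ → ℝ, Eigenfunction P α β lam y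

/-- The number `b = (1 - κ a)/(κ - 1)`. -/
noncomputable def bb (κ : ℕ) (a : ℝ) : ℝ := (1 - κ * a) / (κ - 1)

/-- `P` is a nondecreasing continuous function on `[0,1]` with `P 0 = 0`, `P 1 = 1`,
self-similar of Cantor type with parameters `κ ≥ 2` and `0 < a < 1/κ`. -/
def CantorSelfSimilar (P : ℝ → ℝ) (κ : ℕ) (a : ℝ) : Prop :=
  ContinuousOn P (Set.Icc 0 1) ∧ MonotoneOn P (Set.Icc 0 1) ∧
  P 0 = 0 ∧ P 1 = 1 ∧ 2 ≤ κ ∧ 0 < a ∧ a < 1 / κ ∧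
  (∀ k : ℕ, k < κ → ∃ c : ℝ, ∀ x ∈ Set.Icc (0:ℝ) 1,
      (κ : ℝ) * P (k * (a + bb κ a) + a * x) = P x + c) ∧
  (∀ k : ℕ, 1 ≤ k → k < κ →
      ∀ x ∈ Set.Ioo ((k:ℝ) * (a + bb κ a) - bb κ a) ((k:ℝ) * (a + bb κ a)),
      ∀ x' ∈ Set.Ioo ((k:ℝ) * (a + bb κ a) - bb κ a) ((k:ℝ) * (a + bb κ a)),
      P x = P x')

/-- `f` has at least `n` points of alternating sign in `(a, b)`, the first of the sign of `σ`. -/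
def Alt (f : ℝ → ℝ) (b : ℝ) : ℕ → ℝ → ℝ → Prop
  | 0, _, _ => True
  | n + 1, a, σ => ∃ x, a < x ∧ x < b ∧ 0 < σ * f x ∧ Alt f b n x (-σ)

/-- Increments of `f` over subintervals of `[a, b]` have the sign of some value of `g` inside. -/
def RollePair (f g : ℝ → ℝ) (a b : ℝ) : Prop :=
  ∀ s t σ : ℝ, a ≤ s → s < t → t ≤ b → 0 < σ * (f t - f s) → ∃ z, s < z ∧ z < t ∧ 0 < σ * g z

theorem RollePair.mono {f g : ℝ → ℝ} {a b a' b' : ℝ} (h : RollePair f g a b) (ha : a ≤ a')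
    (hb : b' ≤ b) : RollePair f g a' b' :=
  fun s t σ h1 h2 h3 h4 => h s t σ (ha.trans h1) h2 (h3.trans hb) h4

theorem Alt.start_mono {f : ℝ → ℝ} {b a a' σ : ℝ} {n : ℕ} (h : Alt f b n a σ) (ha : a' ≤ a) :
    Alt f b n a' σ := by
  cases n with
  | zero => trivial
  | succ n =>
    obtain ⟨x, h1, h2⟩ := h
    exact ⟨x, by linarith, h2⟩

theorem Alt.of_le {f : ℝ → ℝ} {b : ℝ} {m : ℕ} : ∀ {n : ℕ} {a σ : ℝ},
    Alt f b n a σ → m ≤ n → Alt f b m a σ := by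
  induction m with
  | zero => intros; trivial
  | succ m ih =>
    intro n a σ h hmn
    obtain ⟨n, rfl⟩ := Nat.exists_eq_add_of_le' (Nat.one_le_of_lt hmn)
    obtain ⟨x, h1, h2, h3, h4⟩ := h
    exact ⟨x, h1, h2, h3, ih h4 (by omega)⟩

theorem Alt.congr_on {f g : ℝ → ℝ} {b c : ℝ} (hc : 0 < c) {n : ℕ} : ∀ {a σ : ℝ},
    (∀ x, a < x → x < b → g x = c * f x) → Alt f b n a σ → Alt g b n a σ := by
  induction n with
  | zero => intros; trivial
  | succ n ih =>
    rintro a σ hfg ⟨x, h1, h2, h3, h4⟩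
    refine ⟨x, h1, h2, ?_, ih (fun y hy => hfg y (h1.trans hy)) h4⟩
    rw [hfg x h1 h2]
    have := mul_pos hc h3
    linarith

theorem Alt.sign {f : ℝ → ℝ} {b c : ℝ} (hc : 0 < c) {n : ℕ} : ∀ {a σ : ℝ},
    Alt f b n a σ → Alt f b n a (c * σ) := by
  induction n with
  | zero => intros; trivial
  | succ n ih =>
    rintro a σ ⟨x, h1, h2, h3, h4⟩
    refine ⟨x, h1, h2, ?_, ?_⟩
    · have := mul_pos hc h3
      linarith
    · have := ih h4
      rwa [mul_neg] at this

theorem Alt.sign' {f : ℝ → ℝ} {b σ τ a : ℝ} {n : ℕ} (h : Alt f b n a σ) (hst : 0 < σ * τ) :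
    Alt f b n a τ := by
  have hσ : σ ≠ 0 := by rintro rfl; simp at hst
  have hs : 0 < σ ^ 2 := by positivity
  have := h.sign (c := τ * σ / σ ^ 2) (by apply div_pos <;> linarith)
  have e : τ * σ / σ ^ 2 * σ = τ := by field_simp
  rwa [e] at this

theorem Alt.smul {f g : ℝ → ℝ} {b c : ℝ} {n : ℕ} {a σ : ℝ} (hc : c ≠ 0)
    (hfg : ∀ x, a < x → x < b → g x = c * f x) (h : Alt f b n a σ) : Alt g b n a (c * σ) := by
  rcases lt_or_gt_of_ne hc with hc | hc
  · have h1 : Alt (fun x => -f x) b n a (-σ) := by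
      clear hfg
      induction n generalizing a σ with
      | zero => trivial
      | succ n ih =>
        obtain ⟨x, h1, h2, h3, h4⟩ := h
        exact ⟨x, h1, h2, by linarith, ih h4⟩
    have h2 : Alt g b n a (-σ) :=
      h1.congr_on (c := -c) (by linarith) (fun x hx hx' => by rw [hfg x hx hx']; ring)
    have := h2.sign (c := -c) (by linarith)
    rwa [neg_mul_neg] at this
  · exact (h.congr_on hc hfg).sign hc

theorem Alt.tail {f : ℝ → ℝ} {b a σ : ℝ} {n : ℕ} (h : Alt f b (n + 1) a σ) : Alt f b n a (-σ) := by
  obtain ⟨x, h1, -, -, h4⟩ := h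
  exact h4.start_mono h1.le

theorem Alt.concat {f : ℝ → ℝ} {z b : ℝ} (hzb : z ≤ b) {k l : ℕ} : ∀ {a σ : ℝ}, a ≤ z →
    Alt f z k a σ → Alt f b l z ((-1) ^ k * σ) → Alt f b (k + l) a σ := by
  induction k with
  | zero =>
    intro a σ haz _ h
    simpa using h.start_mono haz
  | succ k ih =>
    rintro a σ haz ⟨x, h1, h2, h3, h4⟩ h
    rw [Nat.succ_add]
    refine ⟨x, h1, by linarith, h3, ih h2.le h4 ?_⟩
    convert h using 1
    ring

theorem Alt.concat_loose {f : ℝ → ℝ} {z b : ℝ} (hzb : z ≤ b) {k l : ℕ} {a σ τ : ℝ} (haz : a ≤ z)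
    (hσ : σ ≠ 0) (hτ : τ ≠ 0) (h1 : Alt f z k a σ) (h2 : Alt f b (l + 1) z τ) :
    Alt f b (k + l) a σ := by
  have hk : ((-1 : ℝ) ^ k) ≠ 0 := by positivity
  rcases lt_or_gt_of_ne (mul_ne_zero hτ (mul_ne_zero hk hσ)) with h | h
  · exact h1.concat hzb haz (h2.tail.sign' (by linarith))
  · exact h1.concat hzb haz ((h2.of_le (Nat.le_succ l)).sign' h)

theorem Alt.split {f : ℝ → ℝ} {z b : ℝ} (hz : f z = 0) {n : ℕ} : ∀ {a σ : ℝ}, a ≤ z →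
    Alt f b n a σ → ∃ k l, k + l = n ∧ Alt f z k a σ ∧ Alt f b l z ((-1) ^ k * σ) := by
  induction n with
  | zero => exact fun _ _ => ⟨0, 0, rfl, trivial, trivial⟩
  | succ n ih =>
    rintro a σ haz ⟨x, h1, h2, h3, h4⟩
    rcases lt_trichotomy x z with h | h | h
    · obtain ⟨k, l, hkl, hk, hl⟩ := ih h.le h4
      refine ⟨k + 1, l, by omega, ⟨x, h1, h, h3, hk⟩, ?_⟩
      convert hl using 1
      ring
    · rw [h, hz] at h3
      simp at h3
    · refine ⟨0, n + 1, by omega, trivial, x, h, h2, by simpa using h3, by simpa using h4⟩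

theorem Alt.ne_zero {f : ℝ → ℝ} {b a σ : ℝ} {n : ℕ} (h : Alt f b (n + 1) a σ) : σ ≠ 0 := by
  obtain ⟨x, -, -, h3, -⟩ := h
  rintro rfl
  simp at h3

theorem Alt.lt {f : ℝ → ℝ} {b a σ : ℝ} {n : ℕ} (h : Alt f b (n + 1) a σ) : a < b := by
  obtain ⟨x, h1, h2, -⟩ := h
  exact h1.trans h2

/-- Appending a point before the right end. -/
theorem Alt.append {f : ℝ → ℝ} {b : ℝ} {n : ℕ} : ∀ {a σ : ℝ}, a < b → Alt f b n a σ →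
    (∀ a' < b, ∃ x, a' < x ∧ x < b ∧ 0 < (-1) ^ n * σ * f x) → Alt f b (n + 1) a σ := by
  induction n with
  | zero =>
    intro a σ hab _ h
    obtain ⟨x, h1, h2, h3⟩ := h a hab
    exact ⟨x, h1, h2, by simpa using h3, trivial⟩
  | succ n ih =>
    rintro a σ hab ⟨x, h1, h2, h3, h4⟩ h
    refine ⟨x, h1, h2, h3, ih h2 h4 fun a' ha' => ?_⟩
    obtain ⟨y, h1, h2, h3⟩ := h a' ha'
    refine ⟨y, h1, h2, ?_⟩
    convert h3 using 2
    ring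

section Rolle
variable {f g : ℝ → ℝ}

theorem Alt.rolle {b : ℝ} {n : ℕ} : ∀ {a σ : ℝ}, RollePair f g a b → Alt f b n a σ →
    σ * f a ≤ 0 → Alt g b n a σ := by
  induction n with
  | zero => intros; trivial
  | succ n ih =>
    rintro a σ hR ⟨x, h1, h2, h3, h4⟩ ha
    obtain ⟨z, hz1, hz2, hz3⟩ := hR a x σ le_rfl h1 h2.le (by linarith)
    exact ⟨z, hz1, by linarith, hz3,
      (ih (hR.mono h1.le le_rfl) h4 (by linarith)).start_mono hz2.le⟩

theorem Alt.rolle_right {b : ℝ} (hb : f b = 0) {n : ℕ} : ∀ {a σ : ℝ}, RollePair f g a b →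
    Alt f b n a σ → a < b → σ * f a < 0 → Alt g b (n + 1) a σ := by
  induction n with
  | zero =>
    intro a σ hR _ hab ha
    obtain ⟨z, hz1, hz2, hz3⟩ := hR a b σ le_rfl hab le_rfl (by rw [hb]; linarith)
    exact ⟨z, hz1, hz2, hz3, trivial⟩
  | succ n ih =>
    rintro a σ hR ⟨x, h1, h2, h3, h4⟩ - ha
    obtain ⟨z, hz1, hz2, hz3⟩ := hR a x σ le_rfl h1 h2.le (by linarith)
    exact ⟨z, hz1, by linarith, hz3,
      (ih (hR.mono h1.le le_rfl) h4 h2 (by linarith)).start_mono hz2.le⟩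

theorem Alt.rolle_both {a b σ : ℝ} {n : ℕ} (hR : RollePair f g a b) (ha : f a = 0) (hb : f b = 0)
    (h : Alt f b (n + 1) a σ) : Alt g b (n + 2) a σ := by
  obtain ⟨x, h1, h2, h3, h4⟩ := h
  obtain ⟨z, hz1, hz2, hz3⟩ := hR a x σ le_rfl h1 h2.le (by rw [ha]; linarith)
  exact ⟨z, hz1, by linarith, hz3,
    (h4.rolle_right hb (hR.mono h1.le le_rfl) h2 (by linarith)).start_mono hz2.le⟩

theorem Alt.rolle_free {a b σ : ℝ} {n : ℕ} (hR : RollePair f g a b)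
    (h : Alt f b (n + 1) a σ) : Alt g b n a (-σ) := by
  obtain ⟨x, h1, h2, h3, h4⟩ := h
  exact (h4.rolle (hR.mono h1.le le_rfl) (by linarith)).start_mono h1.le

theorem Alt.rolle_right_end {a b σ : ℝ} {n : ℕ} (hR : RollePair f g a b) (hb : f b = 0)
    (h : Alt f b (n + 1) a σ) : Alt g b (n + 1) a (-σ) := by
  obtain ⟨x, h1, h2, h3, h4⟩ := h
  exact (h4.rolle_right hb (hR.mono h1.le le_rfl) h2 (by linarith)).start_mono h1.le

theorem rollePair_of_hasDerivAt {a b : ℝ} (h : ∀ x, HasDerivAt f (g x) x) : RollePair f g a b := by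
  intro s t σ _ hst _ hpos
  obtain ⟨z, hz, e⟩ := exists_hasDerivAt_eq_slope f g hst
    (fun x _ => (h x).continuousAt.continuousWithinAt) (fun x _ => h x)
  refine ⟨z, hz.1, hz.2, ?_⟩
  rw [e, ← mul_div_assoc]
  exact div_pos hpos (by linarith)

end Rolle

theorem Alt.exists_zeros {f : ℝ → ℝ} (hf : Continuous f) {b : ℝ} {n : ℕ} : ∀ {a σ : ℝ},
    Alt f b (n + 1) a σ → ∃ s : Finset ℝ, s.card = n ∧ ∀ x ∈ s, a < x ∧ x < b ∧ f x = 0 := by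
  induction n with
  | zero => exact fun _ => ⟨∅, rfl, by simp⟩
  | succ n ih =>
    rintro a σ ⟨x, h1, h2, h3, y, hy1, hy2, hy3, hy4⟩
    obtain ⟨z, hz, hz0⟩ : ∃ z ∈ Icc x y, σ * f z = 0 := by
      have := intermediate_value_Icc' hy1.le (f := fun t => σ * f t) (by fun_prop)
      exact this ⟨by linarith, h3.le⟩
    have hσ : σ ≠ 0 := by rintro rfl; simp at h3
    have hfz : f z = 0 := (mul_eq_zero.1 hz0).resolve_left hσ
    have hzy : z < y := lt_of_le_of_ne hz.2 (by rintro rfl; rw [hfz] at hy3; simp at hy3)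
    obtain ⟨s, hs, hs'⟩ := ih (a := z) (σ := -σ) ⟨y, hzy, hy2, hy3, hy4⟩
    refine ⟨insert z s, ?_, ?_⟩
    · rw [Finset.card_insert_of_notMem, hs]
      intro hmem
      exact lt_irrefl _ (hs' z hmem).1
    · intro w hw
      rcases Finset.mem_insert.1 hw with rfl | hw
      · exact ⟨by linarith [hz.1], by linarith, hfz⟩
      · obtain ⟨h5, h6, h7⟩ := hs' w hw
        exact ⟨by linarith [hz.1], h6, h7⟩

theorem Alt.eventually {f : ℝ → ℝ} {v : ℕ → ℝ → ℝ} {l : Filter ℕ} {b : ℝ} {n : ℕ} : ∀ {a σ : ℝ},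
    (∀ x, a < x → x < b → Tendsto (fun k => v k x) l (nhds (f x))) → Alt f b n a σ →
    ∀ᶠ k in l, Alt (v k) b n a σ := by
  induction n with
  | zero => intros; exact Eventually.of_forall fun _ => trivial
  | succ n ih =>
    rintro a σ hv ⟨x, h1, h2, h3, h4⟩
    have e1 := ((hv x h1 h2).const_mul σ).eventually_const_lt h3
    filter_upwards [e1, ih (fun y hy => hv y (h1.trans hy)) h4] with k hk hk'
    exact ⟨x, h1, h2, hk, hk'⟩

/-- A function together with (candidates for) its first three derivatives. -/
abbrev Jet := Fin 4 → ℝ → ℝ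

/-- The first entries of `g` form a `C¹` function with its derivative. -/
structure IsC1 (g : Jet) : Prop where
  deriv : ∀ x, HasDerivAt (g 0) (g 1 x) x
  cont : Continuous (g 1)

/-- `C²` functions vanishing at `p` and `q`: the energy space. -/
structure Adm (p q : ℝ) (v : Jet) : Prop where
  d0 : ∀ x, HasDerivAt (v 0) (v 1 x) x
  d1 : ∀ x, HasDerivAt (v 1) (v 2 x) x
  c2 : Continuous (v 2)
  left : v 0 p = 0
  right : v 0 q = 0

/-- `u` solves `u'''' = Q' g` with hinged ends `p`, `q`. -/
structure Pre (Q : ℝ → ℝ) (p q : ℝ) (g u : Jet) : Prop where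
  d0 : ∀ x, HasDerivAt (u 0) (u 1 x) x
  d1 : ∀ x, HasDerivAt (u 1) (u 2 x) x
  d2 : ∀ x, HasDerivAt (u 2) (u 3 x) x
  d3 : ∀ x, HasDerivAt (fun t => u 3 t - Q t * g 0 t) (-(Q x * g 1 x)) x
  left : u 0 p = 0
  right : u 0 q = 0
  left2 : u 2 p = 0
  right2 : u 2 q = 0

theorem HasDerivAt.congr_fun_deriv {f g : ℝ → ℝ} {f' g' x : ℝ} (h : HasDerivAt f f' x)
    (hfg : ∀ t, g t = f t) (h' : g' = f') : HasDerivAt g g' x := by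
  rwa [h', funext hfg]

theorem continuous_of_hasDerivAt {f f' : ℝ → ℝ} (h : ∀ x, HasDerivAt f (f' x) x) : Continuous f :=
  continuous_iff_continuousAt.2 fun x => (h x).continuousAt

theorem IsC1.cont0 {g : Jet} (h : IsC1 g) : Continuous (g 0) := continuous_of_hasDerivAt h.deriv

theorem Adm.isC1 {p q : ℝ} {v : Jet} (h : Adm p q v) : IsC1 v :=
  ⟨h.d0, continuous_of_hasDerivAt h.d1⟩

theorem Pre.adm {Q : ℝ → ℝ} {p q : ℝ} {g u : Jet} (h : Pre Q p q g u) : Adm p q u :=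
  ⟨h.d0, h.d1, continuous_of_hasDerivAt h.d2, h.left, h.right⟩

theorem Pre.isC1 {Q : ℝ → ℝ} {p q : ℝ} {g u : Jet} (h : Pre Q p q g u) : IsC1 u := h.adm.isC1

theorem IsC1.smul_add {g g' : Jet} (h : IsC1 g) (h' : IsC1 g') (s t : ℝ) :
    IsC1 (s • g + t • g') :=
  ⟨fun x => ((h.deriv x).const_mul s).add ((h'.deriv x).const_mul t),
    (h.cont.const_smul s).add (h'.cont.const_smul t)⟩

theorem Adm.smul_add {p q : ℝ} {g g' : Jet} (h : Adm p q g) (h' : Adm p q g') (s t : ℝ) :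
    Adm p q (s • g + t • g') :=
  ⟨fun x => ((h.d0 x).const_mul s).add ((h'.d0 x).const_mul t),
    fun x => ((h.d1 x).const_mul s).add ((h'.d1 x).const_mul t),
    (h.c2.const_smul s).add (h'.c2.const_smul t),
    by simp [h.left, h'.left], by simp [h.right, h'.right]⟩

theorem Pre.smul_add {Q : ℝ → ℝ} {p q : ℝ} {g u g' u' : Jet} (h : Pre Q p q g u)
    (h' : Pre Q p q g' u') (s t : ℝ) : Pre Q p q (s • g + t • g') (s • u + t • u') where
  d0 x := ((h.d0 x).const_mul s).add ((h'.d0 x).const_mul t)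
  d1 x := ((h.d1 x).const_mul s).add ((h'.d1 x).const_mul t)
  d2 x := ((h.d2 x).const_mul s).add ((h'.d2 x).const_mul t)
  d3 x := (((h.d3 x).const_mul s).add ((h'.d3 x).const_mul t)).congr_fun_deriv
    (fun y => by simp; ring) (by simp; ring)
  left := by simp [h.left, h'.left]
  right := by simp [h.right, h'.right]
  left2 := by simp [h.left2, h'.left2]
  right2 := by simp [h.right2, h'.right2]

theorem Pre.smul {Q : ℝ → ℝ} {p q : ℝ} {g u : Jet} (h : Pre Q p q g u) (s : ℝ) :
    Pre Q p q (s • g) (s • u) := by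
  simpa using h.smul_add h s 0

theorem Pre.cont3 {Q : ℝ → ℝ} (hQ : Continuous Q) {p q : ℝ} {g u : Jet} (hg : IsC1 g)
    (h : Pre Q p q g u) : Continuous (u 3) := by
  have h1 := continuous_of_hasDerivAt h.d3
  have h2 := h1.add (hQ.mul hg.cont0)
  exact h2.congr fun x => by simp

/-- Monotonicity of `W = ∫ g dQ` where `g ≤ 0`. -/
theorem stieltjes_nonpos {Q : ℝ → ℝ} (hQc : Continuous Q) (hQ : Monotone Q) {g : Jet} (hg : IsC1 g)
    {W : ℝ → ℝ} (hW : ∀ x, HasDerivAt (fun t => W t - Q t * g 0 t) (-(Q x * g 1 x)) x)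
    {s t : ℝ} (hst : s ≤ t) (hneg : ∀ x, s < x → x < t → g 0 x ≤ 0) : W t ≤ W s := by
  have hWc : Continuous W := by
    have h1 := continuous_of_hasDerivAt hW
    have h2 := h1.add (hQc.mul hg.cont0)
    exact h2.congr fun x => by simp
  refine image_le_of_liminf_slope_right_le_deriv_boundary (f := W) (a := s) (b := t)
    (B := fun _ => W s) (B' := fun _ => 0) hWc.continuousOn le_rfl continuousOn_const
    (fun x _ => hasDerivWithinAt_const _ _ _) ?_ ⟨hst, le_rfl⟩
  intro x hx r hr
  apply Eventually.frequently
  have h1 : Tendsto (slope (fun t => W t - Q t * g 0 t + Q x * g 0 t) x) (nhdsWithin x (Ioi x))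
      (nhds 0) := by
    have := ((hW x).add ((hg.deriv x).const_mul (Q x))).congr_fun_deriv
      (g := fun t => W t - Q t * g 0 t + Q x * g 0 t) (g' := 0) (fun y => by simp) (by simp)
    rw [hasDerivAt_iff_tendsto_slope] at this
    exact this.mono_left (nhdsWithin_mono x (s := Ioi x) fun y hy => ne_of_gt hy)
  have h2 : Ioo x t ∈ nhdsWithin x (Ioi x) := Ioo_mem_nhdsGT hx.2
  filter_upwards [h1.eventually_lt_const hr, h2] with z hz hzt
  refine lt_of_le_of_lt ?_ hz
  simp only [slope_def_field]
  have h3 : 0 < z - x := sub_pos.2 hzt.1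
  have h4 := hneg z (by linarith [hx.1, hzt.1]) hzt.2
  exact div_le_div_of_nonneg_right (by nlinarith [hQ hzt.1.le]) h3.le

theorem Pre.rollePair3 {Q : ℝ → ℝ} (hQc : Continuous Q) (hQ : Monotone Q) {p q : ℝ} {g u : Jet}
    (hg : IsC1 g) (h : Pre Q p q g u) (a b : ℝ) : RollePair (u 3) (g 0) a b := by
  intro s t σ _ hst _ hpos
  by_contra! hcon
  have h1 : IsC1 (σ • g) := by simpa using hg.smul_add hg σ 0
  have h2 := stieltjes_nonpos hQc hQ h1 (W := fun x => σ * u 3 x) (by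
    simpa using (h.smul σ).d3) hst.le (by simpa using hcon)
  linarith

/-- The energy form. -/
noncomputable def energy (p q : ℝ) (u v : Jet) : ℝ := ∫ x in p..q, u 2 x * v 2 x

/-- The form `∫ g v dQ` on functions vanishing at the ends. -/
noncomputable def mass (Q : ℝ → ℝ) (p q : ℝ) (g v : Jet) : ℝ :=
  -∫ x in p..q, Q x * (g 1 x * v 0 x + g 0 x * v 1 x)

theorem energy_comm (p q : ℝ) (u v : Jet) : energy p q u v = energy p q v u := by
  simp only [energy, mul_comm]

theorem mass_comm (Q : ℝ → ℝ) (p q : ℝ) (u v : Jet) : mass Q p q u v = mass Q p q v u := by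
  simp only [mass]
  congr 2
  ext x
  ring

theorem energy_smul_add {p q : ℝ} {u v w : Jet} (hu : Continuous (u 2)) (hv : Continuous (v 2))
    (hw : Continuous (w 2)) (s t : ℝ) :
    energy p q (s • u + t • v) w = s * energy p q u w + t * energy p q v w := by
  simp only [energy, ← intervalIntegral.integral_const_mul]
  rw [← intervalIntegral.integral_add]
  · congr 1
    ext x
    simp
    ring
  · exact Continuous.intervalIntegrable (by fun_prop) _ _
  · exact Continuous.intervalIntegrable (by fun_prop) _ _

theorem mass_smul_add {Q : ℝ → ℝ} (hQ : Continuous Q) {p q : ℝ} {u v w : Jet} (hu : IsC1 u)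
    (hv : IsC1 v) (hw : IsC1 w) (s t : ℝ) :
    mass Q p q (s • u + t • v) w = s * mass Q p q u w + t * mass Q p q v w := by
  have h1 := hu.cont0
  have h2 := hv.cont0
  have h3 := hw.cont0
  have h4 := hu.cont
  have h5 := hv.cont
  have h6 := hw.cont
  simp only [mass, mul_neg, ← intervalIntegral.integral_const_mul, ← neg_add]
  rw [← intervalIntegral.integral_add]
  · congr 2
    ext x
    simp
    ring
  · exact Continuous.intervalIntegrable (by fun_prop) _ _
  · exact Continuous.intervalIntegrable (by fun_prop) _ _

theorem energy_quadratic {p q : ℝ} {u v : Jet} (hu : Continuous (u 2)) (hv : Continuous (v 2))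
    (s t : ℝ) : energy p q (s • u + t • v) (s • u + t • v) =
      s ^ 2 * energy p q u u + 2 * s * t * energy p q u v + t ^ 2 * energy p q v v := by
  have h2 : Continuous ((s • u + t • v) 2) := (hu.const_smul s).add (hv.const_smul t)
  rw [energy_smul_add hu hv h2, energy_comm p q u, energy_comm p q v,
    energy_smul_add hu hv hu, energy_smul_add hu hv hv, energy_comm p q v u]
  ring

theorem mass_quadratic {Q : ℝ → ℝ} (hQ : Continuous Q) {p q : ℝ} {u v : Jet} (hu : IsC1 u)
    (hv : IsC1 v) (s t : ℝ) : mass Q p q (s • u + t • v) (s • u + t • v) =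
      s ^ 2 * mass Q p q u u + 2 * s * t * mass Q p q u v + t ^ 2 * mass Q p q v v := by
  have h2 := hu.smul_add hv s t
  rw [mass_smul_add hQ hu hv h2, mass_comm Q p q u, mass_comm Q p q v,
    mass_smul_add hQ hu hv hu, mass_smul_add hQ hu hv hv, mass_comm Q p q v u]
  ring

theorem Pre.energy_eq_mass {Q : ℝ → ℝ} (hQ : Continuous Q) {p q : ℝ} {g u v : Jet} (hg : IsC1 g)
    (h : Pre Q p q g u) (hv : Adm p q v) : energy p q u v = mass Q p q g v := by
  have h0 := hg.cont0
  have h1 := hg.cont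
  have h2 := hv.isC1.cont0
  have h3 := hv.isC1.cont
  have h4 := hv.c2
  have h5 := h.adm.c2
  have key : ∫ x in p..q, (u 2 x * v 2 x + Q x * (g 1 x * v 0 x + g 0 x * v 1 x)) = 0 := by
    have := intervalIntegral.integral_eq_sub_of_hasDerivAt (a := p) (b := q)
      (f := fun x => u 2 x * v 1 x - (u 3 x - Q x * g 0 x) * v 0 x)
      (f' := fun x => u 2 x * v 2 x + Q x * (g 1 x * v 0 x + g 0 x * v 1 x))
      (fun x _ => (((h.d2 x).mul (hv.d1 x)).sub ((h.d3 x).mul (hv.d0 x))).congr_fun_deriv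
        (fun _ => rfl) (by ring))
      (Continuous.intervalIntegrable (by fun_prop) _ _)
    rw [this, hv.left, hv.right, h.left2, h.right2]
    ring
  rw [intervalIntegral.integral_add (Continuous.intervalIntegrable (by fun_prop) _ _)
    (Continuous.intervalIntegrable (by fun_prop) _ _)] at key
  simp only [energy, mass]
  linarith

theorem mass_self_nonneg {Q : ℝ → ℝ} (hQc : Continuous Q) (hQ : Monotone Q) {p q : ℝ} (hpq : p ≤ q)
    {g : Jet} (hg : Adm p q g) : 0 ≤ mass Q p q g g := by
  have c0 := hg.isC1.cont0
  have c1 := hg.isC1.cont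
  let G : Jet := ![fun x => -(g 0 x) ^ 2, fun x => -(2 * g 0 x * g 1 x), 0, 0]
  have hG : IsC1 G := by
    refine ⟨fun x => ?_, ?_⟩
    · exact ((hg.d0 x).pow 2).neg.congr_fun_deriv (fun _ => rfl) (by simp [G])
    · change Continuous fun x => -(2 * g 0 x * g 1 x)
      fun_prop
  have hI : ∀ x, HasDerivAt (fun t => ∫ y in p..t, Q y * G 1 y) (Q x * G 1 x) x := fun x =>
    (hQc.mul hG.cont).integral_hasStrictDerivAt p x |>.hasDerivAt
  have := stieltjes_nonpos hQc hQ hG (W := fun x => Q x * G 0 x - ∫ y in p..x, Q y * G 1 y)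
    (fun x => (hI x).neg.congr_fun_deriv (fun t => by simp) rfl) hpq
    (fun x _ _ => neg_nonpos.2 (sq_nonneg _))
  have e : mass Q p q g g = ∫ y in p..q, Q y * G 1 y := by
    rw [mass, ← intervalIntegral.integral_neg]
    congr 1
    ext x
    change _ = Q x * -(2 * g 0 x * g 1 x)
    ring
  rw [e]
  simpa [G, hg.left, hg.right] using this

theorem energy_self_nonneg {p q : ℝ} (hpq : p ≤ q) (v : Jet) : 0 ≤ energy p q v v :=
  intervalIntegral.integral_nonneg hpq fun _ _ => mul_self_nonneg _

theorem sq_le_of_quadratic_nonneg {a b c : ℝ}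
    (h : ∀ s t : ℝ, 0 ≤ s ^ 2 * a + 2 * s * t * b + t ^ 2 * c) :
    b ^ 2 ≤ a * c := by
  have ha : 0 ≤ a := by simpa using h 1 0
  rcases ha.eq_or_lt with rfl | ha
  · have h1 := h (-(c + 1)) b
    have h2 := h (c + 1) b
    have hc : 0 ≤ c := by simpa using h 0 1
    nlinarith [sq_nonneg b]
  · have := h (-b) a
    by_contra! hcon
    nlinarith

theorem energy_sq_le {p q : ℝ} (hpq : p ≤ q) {u v : Jet} (hu : Continuous (u 2))
    (hv : Continuous (v 2)) : energy p q u v ^ 2 ≤ energy p q u u * energy p q v v :=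
  sq_le_of_quadratic_nonneg fun s t => by
    rw [← energy_quadratic hu hv]
    exact energy_self_nonneg hpq _

theorem mass_sq_le {Q : ℝ → ℝ} (hQc : Continuous Q) (hQ : Monotone Q) {p q : ℝ} (hpq : p ≤ q)
    {u v : Jet} (hu : Adm p q u) (hv : Adm p q v) :
    mass Q p q u v ^ 2 ≤ mass Q p q u u * mass Q p q v v :=
  sq_le_of_quadratic_nonneg fun s t => by
    rw [← mass_quadratic hQc hu.isC1 hv.isC1]
    exact mass_self_nonneg hQc hQ hpq (hu.smul_add hv s t)

theorem Adm.sq_sub_le {p q : ℝ} {v : Jet} (h : Adm p q v) {x y : ℝ} (hx : p ≤ x)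
    (hxy : x ≤ y) (hy : y ≤ q) : (v 1 y - v 1 x) ^ 2 ≤ (y - x) * energy p q v v := by
  have h2 := h.c2
  have e : v 1 y - v 1 x = ∫ t in x..y, v 2 t :=
    (intervalIntegral.integral_eq_sub_of_hasDerivAt (fun t _ => h.d1 t)
      (Continuous.intervalIntegrable (by fun_prop) _ _)).symm
  have hle : ∫ t in x..y, v 2 t * v 2 t ≤ energy p q v v := by
    refine intervalIntegral.integral_mono_interval hx hxy hy
      (Eventually.of_forall fun t => mul_self_nonneg _)
      (Continuous.intervalIntegrable (by fun_prop) _ _)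
  have h3 : (v 1 y - v 1 x) ^ 2 ≤ (y - x) * ∫ t in x..y, v 2 t * v 2 t := by
    refine sq_le_of_quadratic_nonneg fun s r => ?_
    have : s ^ 2 * (y - x) + 2 * s * r * (v 1 y - v 1 x) + r ^ 2 * ∫ t in x..y, v 2 t * v 2 t
        = ∫ t in x..y, (s + r * v 2 t) ^ 2 := by
      have e2 : ∀ t, (s + r * v 2 t) ^ 2 =
          (s ^ 2 + 2 * s * r * v 2 t) + r ^ 2 * (v 2 t * v 2 t) := fun t => by ring
      simp only [e2]
      rw [intervalIntegral.integral_add (Continuous.intervalIntegrable (by fun_prop) _ _)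
        (Continuous.intervalIntegrable (by fun_prop) _ _),
        intervalIntegral.integral_add (Continuous.intervalIntegrable (by fun_prop) _ _)
        (Continuous.intervalIntegrable (by fun_prop) _ _),
        intervalIntegral.integral_const_mul, intervalIntegral.integral_const_mul, ← e]
      simp
      ring
    rw [this]
    exact intervalIntegral.integral_nonneg hxy fun t _ => sq_nonneg _
  exact h3.trans (mul_le_mul_of_nonneg_left hle (by linarith))

theorem Adm.sq_one_le {p q : ℝ} (hpq : p < q) {v : Jet} (h : Adm p q v) {x : ℝ} (hx : x ∈ Icc p q) :
    v 1 x ^ 2 ≤ (q - p) * energy p q v v := by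
  obtain ⟨ξ, hξ, e⟩ := exists_hasDerivAt_eq_zero hpq h.isC1.cont0.continuousOn
    (h.left.trans h.right.symm) (fun x _ => h.d0 x)
  have hE := energy_self_nonneg hpq.le v
  rcases le_total ξ x with hx' | hx'
  · have := h.sq_sub_le hξ.1.le hx' hx.2
    rw [e, sub_zero] at this
    exact this.trans (mul_le_mul_of_nonneg_right (by linarith [hx.2, hξ.1]) hE)
  · have := h.sq_sub_le hx.1 hx' hξ.2.le
    rw [e, zero_sub, neg_sq] at this
    exact this.trans (mul_le_mul_of_nonneg_right (by linarith [hx.1, hξ.2]) hE)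

theorem Adm.sq_zero_le {p q : ℝ} (hpq : p < q) {v : Jet} (h : Adm p q v) {x : ℝ}
    (hx : x ∈ Icc p q) : v 0 x ^ 2 ≤ (q - p) ^ 3 * energy p q v v := by
  have hE := energy_self_nonneg hpq.le v
  rcases hx.1.eq_or_lt with rfl | hlt
  · rw [h.left]
    have : 0 < (q - p) ^ 3 := pow_pos (by linarith) 3
    simp
    positivity
  · obtain ⟨ξ, hξ, e⟩ := exists_hasDerivAt_eq_slope (v 0) (v 1) hlt h.isC1.cont0.continuousOn
      (fun x _ => h.d0 x)
    rw [h.left, sub_zero, eq_div_iff (by linarith)] at e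
    rw [← e, mul_pow]
    have h1 := h.sq_one_le hpq (x := ξ) ⟨hξ.1.le, hξ.2.le.trans hx.2⟩
    calc v 1 ξ ^ 2 * (x - p) ^ 2 ≤ ((q - p) * energy p q v v) * (q - p) ^ 2 := by
          refine mul_le_mul h1 (pow_le_pow_left₀ (by linarith) (by linarith [hx.2]) 2)
            (sq_nonneg _) (by nlinarith)
      _ = _ := by ring

theorem Adm.eq_zero_of_energy {p q : ℝ} (hpq : p < q) {v : Jet} (h : Adm p q v)
    (hE : energy p q v v = 0) {x : ℝ} (hx : x ∈ Icc p q) : v 0 x = 0 := by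
  have := h.sq_zero_le hpq hx
  rw [hE, mul_zero] at this
  exact pow_eq_zero_iff two_ne_zero |>.1 (le_antisymm this (sq_nonneg _))

/-- Derivatives of a function vanishing on an interval vanish there. -/
theorem deriv_eq_zero_on {f f' : ℝ → ℝ} {p q : ℝ} (hpq : p < q) (h : ∀ x, HasDerivAt f (f' x) x)
    (hz : ∀ x ∈ Icc p q, f x = 0) : ∀ x ∈ Icc p q, f' x = 0 := by
  intro x hx
  have h1 := (h x).hasDerivWithinAt (s := Icc p q)
  have h2 : HasDerivWithinAt f 0 (Icc p q) x :=
    (hasDerivWithinAt_const x (Icc p q) (0 : ℝ)).congr hz (hz x hx)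
  exact (uniqueDiffOn_Icc hpq x hx).eq_deriv _ h1 h2

/-- A crude bound of the solution operator in the energy norm. -/
theorem Pre.energy_le {Q : ℝ → ℝ} (hQ : Continuous Q) {K : ℝ} (hK : ∀ x, |Q x| ≤ K) {p q : ℝ}
    (hpq : p < q) : ∃ C, 0 ≤ C ∧ ∀ (g u : Jet) (m : ℝ), IsC1 g → Pre Q p q g u →
      (∀ x ∈ Icc p q, |g 0 x| ≤ m ∧ |g 1 x| ≤ m) → energy p q u u ≤ C * m ^ 2 := by
  have hK0 : 0 ≤ K := (abs_nonneg _).trans (hK 0)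
  have hL : 0 < q - p := by linarith
  refine ⟨2 * (K * (q - p)) ^ 2 * ((q - p) + (q - p) ^ 3), by positivity, ?_⟩
  intro g u m hg h hm
  have hm0 : 0 ≤ m := (abs_nonneg _).trans (hm p ⟨le_rfl, hpq.le⟩).1
  set e := energy p q u u with he
  have he0 : 0 ≤ e := energy_self_nonneg hpq.le u
  have hb : ∀ x ∈ Icc p q, |u 1 x| ≤ √((q - p) * e) ∧ |u 0 x| ≤ √((q - p) ^ 3 * e) := fun x hx =>
    ⟨Real.abs_le_sqrt (h.adm.sq_one_le hpq hx), Real.abs_le_sqrt (h.adm.sq_zero_le hpq hx)⟩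
  have h1 : e ≤ K * m * (√((q - p) * e) + √((q - p) ^ 3 * e)) * (q - p) := by
    have hem : e = _ := h.energy_eq_mass hQ hg h.adm
    rw [mass] at hem
    refine hem.le.trans ?_
    clear_value e
    refine (le_abs_self _).trans ?_
    rw [abs_neg, ← Real.norm_eq_abs, ← abs_of_pos hL]
    apply intervalIntegral.norm_integral_le_of_norm_le_const
    intro x hx
    rw [uIoc_of_le hpq.le] at hx
    have hx' : x ∈ Icc p q := ⟨hx.1.le, hx.2⟩
    rw [abs_of_pos hL]
    rw [Real.norm_eq_abs, abs_mul, mul_assoc]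
    refine mul_le_mul (hK x) ?_ (abs_nonneg _) hK0
    refine (abs_add_le _ _).trans ?_
    rw [abs_mul, abs_mul, mul_add, add_comm]
    exact add_le_add
      (mul_le_mul (hm x hx').1 (hb x hx').1 (abs_nonneg _) hm0)
      (mul_le_mul (hm x hx').2 (hb x hx').2 (abs_nonneg _) hm0)
  have h2 : (√((q - p) * e) + √((q - p) ^ 3 * e)) ^ 2 ≤ 2 * ((q - p) + (q - p) ^ 3) * e := by
    have e1 := Real.sq_sqrt (show 0 ≤ (q - p) * e by positivity)
    have e2 := Real.sq_sqrt (show 0 ≤ (q - p) ^ 3 * e by positivity)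
    nlinarith [sq_nonneg (√((q - p) * e) - √((q - p) ^ 3 * e))]
  rcases he0.eq_or_lt with h0 | h0
  · rw [← h0]; positivity
  · have h3 : e ^ 2 ≤ (K * m * (q - p)) ^ 2 * (2 * ((q - p) + (q - p) ^ 3) * e) := by
      calc e ^ 2 ≤ (K * m * (√((q - p) * e) + √((q - p) ^ 3 * e)) * (q - p)) ^ 2 := by gcongr
        _ = (K * m * (q - p)) ^ 2 * (√((q - p) * e) + √((q - p) ^ 3 * e)) ^ 2 := by ring
        _ ≤ _ := by gcongr
    have h4 : e * e ≤ (2 * (K * (q - p)) ^ 2 * ((q - p) + (q - p) ^ 3) * m ^ 2) * e := by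
      linarith
    exact le_of_mul_le_mul_right h4 h0

theorem exists_pre {Q : ℝ → ℝ} (hQ : Continuous Q) {p q : ℝ} (hpq : p < q) {g : Jet} (hg : IsC1 g) :
    ∃ u, Pre Q p q g u := by
  have h0 := hg.cont0
  have h1 := hg.cont
  have hL : q - p ≠ 0 := by linarith
  have prim : ∀ f : ℝ → ℝ, Continuous f → ∀ x, HasDerivAt (fun t => ∫ y in p..t, f y) (f x) x :=
    fun f hf x => (hf.integral_hasStrictDerivAt p x).hasDerivAt
  let R : ℝ → ℝ := fun x => Q x * g 0 x - ∫ y in p..x, Q y * g 1 y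
  have hR' : ∀ x, HasDerivAt (fun t => R t - Q t * g 0 t) (-(Q x * g 1 x)) x := fun x => by
    exact (prim _ (hQ.mul h1) x).neg.congr_fun_deriv (fun t => by simp [R]) rfl
  have hR : Continuous R := by
    have := (continuous_of_hasDerivAt hR').add (hQ.mul h0)
    exact this.congr fun x => by simp
  let w : ℝ → ℝ := fun x => ∫ y in p..x, R y
  have hw := prim R hR
  let u2 : ℝ → ℝ := fun x => w x - (x - p) / (q - p) * w q
  have hlin : ∀ x c : ℝ, HasDerivAt (fun t => (t - p) / (q - p) * c) (c / (q - p)) x := fun x c =>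
    (((hasDerivAt_id x).sub_const p).div_const (q - p)).mul_const c |>.congr_fun_deriv
      (fun _ => rfl) (by ring)
  have hu2 : ∀ x, HasDerivAt u2 (R x - w q / (q - p)) x := fun x => (hw x).sub (hlin x (w q))
  have cu2 := continuous_of_hasDerivAt hu2
  let U1 : ℝ → ℝ := fun x => ∫ y in p..x, u2 y
  have hU1 := prim u2 cu2
  have cU1 : Continuous U1 := continuous_of_hasDerivAt hU1
  let U0 : ℝ → ℝ := fun x => ∫ y in p..x, U1 y
  have hU0 := prim U1 cU1
  refine ⟨![fun x => U0 x - (x - p) / (q - p) * U0 q, fun x => U1 x - U0 q / (q - p), u2,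
    fun x => R x - w q / (q - p)], ?_, ?_, ?_, ?_, ?_, ?_, ?_, ?_⟩
  · exact fun x => (hU0 x).sub (hlin x _)
  · exact fun x => (hU1 x).sub_const _
  · exact hu2
  · exact fun x => ((hR' x).sub_const (w q / (q - p))).congr_fun_deriv
      (fun t => by simp; ring) rfl
  · simp [U0]
  · simp [hL]
  · simp [u2, w]
  · simp [u2, hL]

/-- `Pre` depends on the values of the load in `[p, q]` only. -/
theorem Pre.congr_load {Q : ℝ → ℝ} {p q : ℝ} (hpq : p < q) (hQl : ∀ x ≤ p, Q x = Q p)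
    (hQr : ∀ x, q ≤ x → Q x = Q q) {g g' u : Jet} (hg : IsC1 g) (hg' : IsC1 g')
    (h : Pre Q p q g u) (hgg : ∀ x ∈ Icc p q, g 0 x = g' 0 x) : Pre Q p q g' u where
  __ := h
  d3 x := by
    have hgg1 : ∀ x ∈ Icc p q, g 1 x - g' 1 x = 0 := deriv_eq_zero_on hpq
      (f := fun t => g 0 t - g' 0 t)
      (fun x => (hg.deriv x).sub (hg'.deriv x)) (fun x hx => by simp [hgg x hx])
    have key : HasDerivAt (fun t => Q t * (g 0 t - g' 0 t)) (Q x * (g 1 x - g' 1 x)) x := by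
      have hd := (hg.deriv x).sub (hg'.deriv x)
      rcases lt_or_ge x q with hx | hx
      · have e : Q x * (g 1 x - g' 1 x) = Q p * (g 1 x - g' 1 x) := by
          rcases le_total x p with hxp | hxp
          · rw [hQl x hxp]
          · rw [hgg1 x ⟨hxp, hx.le⟩]; simp
        rw [e]
        refine (hd.const_mul (Q p)).congr_of_eventuallyEq ?_
        filter_upwards [Iio_mem_nhds hx] with t ht
        rcases le_total t p with htp | htp
        · rw [hQl t htp]; rfl
        · simp [hgg t ⟨htp, le_of_lt ht⟩]
      · have e : Q x * (g 1 x - g' 1 x) = Q q * (g 1 x - g' 1 x) := by rw [hQr x hx]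
        rw [e]
        refine (hd.const_mul (Q q)).congr_of_eventuallyEq ?_
        filter_upwards [Ioi_mem_nhds (hpq.trans_le hx)] with t ht
        rcases le_total t q with htp | htp
        · simp [hgg t ⟨le_of_lt ht, htp⟩]
        · rw [hQr t htp]; rfl
    exact ((h.d3 x).add key).congr_fun_deriv (fun t => by simp; ring) (by ring)

section

/-- A continuous nondecreasing function, constant outside `[p, q]` and nonconstant. -/
structure Weight (Q : ℝ → ℝ) (p q : ℝ) : Prop where
  lt : p < q
  cont : Continuous Q
  mono : Monotone Q
  left : ∀ x ≤ p, Q x = Q p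
  right : ∀ x, q ≤ x → Q x = Q q
  jump : Q p < Q q

/-- `φ` is an eigenfunction (with derivatives) of the hinged problem on `[p, q]`. -/
def Eig (Q : ℝ → ℝ) (p q lam : ℝ) (φ : Jet) : Prop :=
  Pre Q p q (lam • φ) φ ∧ ∃ x ∈ Icc p q, φ 0 x ≠ 0

variable {Q : ℝ → ℝ} {p q : ℝ}

theorem Weight.bound (hQ : Weight Q p q) : ∃ K, ∀ x, |Q x| ≤ K := by
  refine ⟨max |Q p| |Q q|, fun x => ?_⟩
  have h1 : Q p ≤ Q x := by
    rcases le_total x p with h | h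
    · rw [hQ.left x h]
    · exact hQ.mono h
  have h2 : Q x ≤ Q q := by
    rcases le_total x q with h | h
    · exact hQ.mono h
    · rw [hQ.right x h]
  exact abs_le_max_abs_abs h1 h2

theorem IsC1.smul {g : Jet} (h : IsC1 g) (s : ℝ) : IsC1 (s • g) := by
  simpa using h.smul_add h s 0

theorem IsC1.rollePair {g : Jet} (h : IsC1 g) (a b : ℝ) : RollePair (g 0) (g 1) a b :=
  rollePair_of_hasDerivAt h.deriv

theorem Pre.alt (hQ : Weight Q p q) {g u : Jet} (hg : IsC1 g) (h : Pre Q p q g u) {n : ℕ} {σ : ℝ}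
    (hA : Alt (u 0) q n p σ) : Alt (g 0) q n p σ := by
  cases n with
  | zero => trivial
  | succ n =>
    have h1 := hA.rolle_both (rollePair_of_hasDerivAt h.d0) h.left h.right
    have h2 := h1.rolle_free (rollePair_of_hasDerivAt h.d1)
    have h3 := h2.rolle_both (rollePair_of_hasDerivAt h.d2) h.left2 h.right2
    simpa using h3.rolle_free (h.rollePair3 hQ.cont hQ.mono hg p q)

theorem Pre.alt_left (hQ : Weight Q p q) {g u : Jet} (hg : IsC1 g) (h : Pre Q p q g u) {n : ℕ}
    {σ : ℝ} (hp : u 1 p = 0) (hA : Alt (u 0) q (n + 1) p σ) : Alt (g 0) q (n + 2) p (-σ) := by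
  have h1 := hA.rolle_both (rollePair_of_hasDerivAt h.d0) h.left h.right
  have h2 := h1.rolle (rollePair_of_hasDerivAt h.d1) (by simp [hp])
  have h3 := h2.rolle_both (rollePair_of_hasDerivAt h.d2) h.left2 h.right2
  exact h3.rolle_free (h.rollePair3 hQ.cont hQ.mono hg p q)

theorem Pre.alt_right (hQ : Weight Q p q) {g u : Jet} (hg : IsC1 g) (h : Pre Q p q g u) {n : ℕ}
    {σ : ℝ} (hq : u 1 q = 0) (hA : Alt (u 0) q (n + 1) p σ) : Alt (g 0) q (n + 2) p σ := by
  have h1 := hA.rolle_both (rollePair_of_hasDerivAt h.d0) h.left h.right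
  have h2 := h1.rolle_right_end (rollePair_of_hasDerivAt h.d1) hq
  have h3 := h2.rolle_both (rollePair_of_hasDerivAt h.d2) h.left2 h.right2
  simpa using h3.rolle_free (h.rollePair3 hQ.cont hQ.mono hg p q)

theorem Pre.eq_zero_of_initial (hQ : Weight Q p q) {lam : ℝ} {u : Jet}
    (h : Pre Q p q (lam • u) u) (h1 : u 1 p = 0) (h3 : u 3 p = 0) : ∀ x ∈ Icc p q, u 0 x = 0 := by
  obtain ⟨K, hK⟩ := hQ.bound
  have hK0 : 0 ≤ K := (abs_nonneg _).trans (hK 0)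
  let w : ℝ → ℝ := fun t => u 3 t - Q t * (lam • u) 0 t
  let f : ℝ → Fin 4 → ℝ := fun x => ![u 0 x, u 1 x, u 2 x, w x]
  let f' : ℝ → Fin 4 → ℝ := fun x => ![u 1 x, u 2 x, u 3 x, -(Q x * (lam • u) 1 x)]
  have hf : ∀ x, HasDerivAt f (f' x) x := fun x => by
    rw [hasDerivAt_pi]
    intro i
    fin_cases i
    · exact h.d0 x
    · exact h.d1 x
    · exact h.d2 x
    · exact h.d3 x
  have hC : 0 ≤ 1 + K * |lam| := by positivity
  have hb : ∀ x ∈ Ico p q, ‖f' x‖ ≤ (1 + K * |lam|) * ‖f x‖ + 0 := by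
    intro x _
    have hn : ∀ i, |f x i| ≤ ‖f x‖ := fun i => by simpa using norm_le_pi_norm (f x) i
    have n0 : |u 0 x| ≤ ‖f x‖ := hn 0
    have n1 : |u 1 x| ≤ ‖f x‖ := hn 1
    have n2 : |u 2 x| ≤ ‖f x‖ := hn 2
    have n3 : |w x| ≤ ‖f x‖ := hn 3
    have hpos : 0 ≤ ‖f x‖ := norm_nonneg _
    have hq : ∀ i, |u i x| ≤ ‖f x‖ → |Q x * (lam * u i x)| ≤ K * |lam| * ‖f x‖ := fun i hi => by
      rw [abs_mul, abs_mul, mul_assoc]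
      exact mul_le_mul (hK x) (mul_le_mul_of_nonneg_left hi (abs_nonneg _)) (by positivity) hK0
    have q0 := hq 0 n0
    have q1 := hq 1 n1
    have hkl : 0 ≤ K * |lam| * ‖f x‖ := by positivity
    rw [add_zero, pi_norm_le_iff_of_nonneg (by positivity)]
    intro i
    have e3 : u 3 x = w x + Q x * (lam * u 0 x) := by simp [w]
    fin_cases i
    · change |u 1 x| ≤ _
      nlinarith
    · change |u 2 x| ≤ _
      nlinarith
    · change |u 3 x| ≤ _
      rw [e3]
      refine (abs_add_le _ _).trans ?_
      nlinarith
    · change |-(Q x * (lam * u 1 x))| ≤ _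
      rw [abs_neg]
      nlinarith
  have hp : ‖f p‖ ≤ 0 := by
    rw [norm_le_zero_iff]
    ext i
    fin_cases i
    · exact h.left
    · exact h1
    · exact h.left2
    · change u 3 p - Q p * (lam * u 0 p) = 0
      rw [h3, h.left]
      ring
  intro x hx
  have := norm_le_gronwallBound_of_norm_deriv_right_le
    (fun y _ => (hf y).continuousAt.continuousWithinAt) (fun y _ => (hf y).hasDerivWithinAt)
    hp hb x hx
  rw [gronwallBound_ε0_δ0, norm_le_zero_iff] at this
  exact congrFun this 0

theorem Pre.eq_pos_mul {g u : Jet} (h : Pre Q p q g u) (h1 : u 1 p = 0) {x : ℝ} (hx : p < x) :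
    ∃ ξ C, p < ξ ∧ ξ < x ∧ 0 < C ∧ u 0 x = C * u 3 ξ := by
  have step : ∀ (f f' : ℝ → ℝ), (∀ x, HasDerivAt f (f' x) x) → f p = 0 → ∀ x, p < x →
      ∃ ξ C, p < ξ ∧ ξ < x ∧ 0 < C ∧ f x = C * f' ξ := by
    intro f f' hf hf0 x hx
    obtain ⟨ξ, hξ, e⟩ := exists_hasDerivAt_eq_slope f f' hx
      (continuous_of_hasDerivAt hf).continuousOn (fun x _ => hf x)
    refine ⟨ξ, x - p, hξ.1, hξ.2, by linarith, ?_⟩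
    rw [e, hf0, sub_zero, mul_div_cancel₀ _ (by linarith)]
  obtain ⟨ξ, C, a1, a2, a3, a4⟩ := step _ _ h.d0 h.left x hx
  obtain ⟨ξ', C', b1, b2, b3, b4⟩ := step _ _ h.d1 h1 ξ a1
  obtain ⟨ξ'', C'', c1, c2, c3, c4⟩ := step _ _ h.d2 h.left2 ξ' b1
  exact ⟨ξ'', C * C' * C'', c1, c2.trans (b2.trans a2), by positivity, by rw [a4, b4, c4]; ring⟩

theorem Pre.eq_zero_of_left (hQ : Weight Q p q) {lam : ℝ} (hlam : 0 < lam) {u : Jet}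
    (h : Pre Q p q (lam • u) u) (h1 : u 1 p = 0) : ∀ x ∈ Icc p q, u 0 x = 0 := by
  have main : ∀ u : Jet, Pre Q p q (lam • u) u → u 1 p = 0 → ¬ 0 < u 3 p := by
    intro u h h1 h3
    have c3 : Continuous (u 3) := h.cont3 hQ.cont (h.isC1.smul lam)
    obtain ⟨ξ, C, a1, a2, a3, a4⟩ := h.eq_pos_mul h1 hQ.lt
    have hξ : u 3 ξ = 0 := by
      rw [h.right, eq_comm, mul_eq_zero] at a4
      exact a4.resolve_left a3.ne'
    obtain ⟨z, ⟨hz1, hz2⟩, hz3⟩ := (isCompact_Icc.inter_right (isClosed_le c3 continuous_const) :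
      IsCompact (Icc p q ∩ {x | u 3 x ≤ 0})).exists_isLeast ⟨ξ, ⟨a1.le, a2.le⟩, hξ.le⟩
    change u 3 z ≤ 0 at hz2
    have hpz : p < z := by
      refine lt_of_le_of_ne hz1.1 ?_
      rintro rfl
      linarith
    obtain ⟨y, y1, y2, y3⟩ := h.rollePair3 hQ.cont hQ.mono (h.isC1.smul lam) p z p z (-1) le_rfl hpz
      le_rfl (by linarith)
    obtain ⟨η, D, b1, b2, b3, b4⟩ := h.eq_pos_mul h1 y1
    have : 0 < u 3 η := by
      by_contra! hcon
      have := hz3 ⟨⟨b1.le, by linarith [hz1.2]⟩, hcon⟩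
      linarith
    have e : (lam • u) 0 y = lam * (D * u 3 η) := by rw [← b4]; rfl
    rw [e] at y3
    have : 0 < lam * (D * u 3 η) := by positivity
    linarith
  refine h.eq_zero_of_initial hQ h1 ?_
  rcases lt_trichotomy (u 3 p) 0 with h3 | h3 | h3
  · have h' := h.smul (-1)
    rw [smul_comm] at h'
    exact absurd (by simpa using h3) (main _ h' (by simp [h1]))
  · exact h3
  · exact absurd h3 (main u h h1)

theorem Eig.pre {lam : ℝ} {φ : Jet} (h : Eig Q p q lam φ) : Pre Q p q (lam • φ) φ := h.1

theorem Eig.energy_pos (hQ : Weight Q p q) {lam : ℝ} {φ : Jet} (h : Eig Q p q lam φ) :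
    0 < energy p q φ φ := by
  refine lt_of_le_of_ne (energy_self_nonneg hQ.lt.le φ) fun h0 => ?_
  obtain ⟨x, hx, hne⟩ := h.2
  exact hne (h.pre.adm.eq_zero_of_energy hQ.lt h0.symm hx)

theorem Eig.energy_eq (hQ : Weight Q p q) {lam : ℝ} {φ v : Jet} (h : Eig Q p q lam φ)
    (hv : Adm p q v) : energy p q φ v = lam * mass Q p q φ v := by
  rw [h.pre.energy_eq_mass hQ.cont (h.pre.isC1.smul lam) hv]
  simpa using mass_smul_add hQ.cont h.pre.isC1 h.pre.isC1 hv.isC1 lam 0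

theorem Eig.pos (hQ : Weight Q p q) {lam : ℝ} {φ : Jet} (h : Eig Q p q lam φ) : 0 < lam := by
  have h1 := h.energy_pos hQ
  rw [h.energy_eq hQ h.pre.adm] at h1
  exact pos_of_mul_pos_left h1 (mass_self_nonneg hQ.cont hQ.mono hQ.lt.le h.pre.adm)

theorem Eig.deriv_left_ne (hQ : Weight Q p q) {lam : ℝ} {φ : Jet} (h : Eig Q p q lam φ) :
    φ 1 p ≠ 0 := fun h1 => by
  obtain ⟨x, hx, hne⟩ := h.2
  exact hne (h.pre.eq_zero_of_left hQ (h.pos hQ) h1 x hx)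

/-- Eigenvalues are simple. -/
theorem Eig.proportional (hQ : Weight Q p q) {lam : ℝ} {φ X : Jet} (h : Eig Q p q lam φ)
    (hX : Eig Q p q lam X) : ∃ c, c ≠ 0 ∧ ∀ x ∈ Icc p q, X 0 x = c * φ 0 x := by
  have h1 := h.deriv_left_ne hQ
  have h2 := hX.deriv_left_ne hQ
  have hc := hX.pre.smul_add h.pre (φ 1 p) (-X 1 p)
  rw [smul_comm _ lam, smul_comm _ lam, ← smul_add] at hc
  refine ⟨X 1 p / φ 1 p, div_ne_zero h2 h1, fun x hx => ?_⟩
  have := hc.eq_zero_of_left hQ (h.pos hQ) (by simp; ring) x hx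
  simp at this
  field_simp
  linarith

end

section

variable {Q : ℝ → ℝ} {p q : ℝ}

theorem exists_alt_one {f : ℝ → ℝ} {a b : ℝ} (h : ∃ x, a < x ∧ x < b ∧ f x ≠ 0) :
    ∃ σ, Alt f b 1 a σ := by
  obtain ⟨x, h1, h2, h3⟩ := h
  exact ⟨f x, x, h1, h2, mul_self_pos.2 h3, trivial⟩

theorem Eig.of_alt_load {lam : ℝ} (hlam : 0 < lam) {φ : Jet} {n : ℕ} {σ : ℝ}
    (h : Alt ((lam • φ) 0) q n p σ) : Alt (φ 0) q n p σ :=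
  h.congr_on (inv_pos.2 hlam) fun x _ _ => by simp [hlam.ne']

theorem Eig.alt_of_second (hQ : Weight Q p q) {lam : ℝ} {φ : Jet} (h : Eig Q p q lam φ) {n : ℕ}
    {σ : ℝ} (hA : Alt (φ 2) q (n + 1) p σ) : Alt (φ 0) q (n + 1) p (-σ) := by
  have h3 := hA.rolle_both (rollePair_of_hasDerivAt h.pre.d2) h.pre.left2 h.pre.right2
  exact Eig.of_alt_load (h.pos hQ)
    (h3.rolle_free (h.pre.rollePair3 hQ.cont hQ.mono (h.pre.isC1.smul lam) p q))

theorem Eig.alt_of_double_interior (hQ : Weight Q p q) {lam : ℝ} {φ : Jet} (h : Eig Q p q lam φ)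
    {z σ τ : ℝ} {k l : ℕ} (h0 : φ 0 z = 0) (h1 : φ 1 z = 0) (hl : Alt (φ 0) z (k + 1) p σ)
    (hr : Alt (φ 0) q (l + 1) z τ) : ∃ σ', Alt (φ 0) q (k + l + 3) p σ' := by
  have a1 := (hl.rolle_both (rollePair_of_hasDerivAt h.pre.d0) h.pre.left h0).rolle_right_end
    (rollePair_of_hasDerivAt h.pre.d1) h1
  have a2 := (hr.rolle_both (rollePair_of_hasDerivAt h.pre.d0) h0 h.pre.right).rolle
    (rollePair_of_hasDerivAt h.pre.d1) (by simp [h1])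
  have a3 := a1.concat_loose hr.lt.le hl.lt.le a1.ne_zero a2.ne_zero a2
  rw [show k + 2 + (l + 1) = k + l + 2 + 1 by ring] at a3
  exact ⟨_, h.alt_of_second hQ a3⟩

theorem Eig.alt_succ_of_double (hQ : Weight Q p q) {lam : ℝ} {φ : Jet} (h : Eig Q p q lam φ)
    {z σ : ℝ} (hz : z ∈ Icc p q) (h0 : φ 0 z = 0) (h1 : φ 1 z = 0) {n : ℕ}
    (hA : Alt (φ 0) q (n + 1) p σ) : ∃ σ', Alt (φ 0) q (n + 2) p σ' := by
  have right : φ 1 q = 0 → ∃ σ', Alt (φ 0) q (n + 2) p σ' := fun hq =>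
    ⟨σ, Eig.of_alt_load (h.pos hQ) (h.pre.alt_right hQ (h.pre.isC1.smul lam) hq hA)⟩
  rcases hz.1.eq_or_lt with rfl | hpz
  · exact absurd h1 (h.deriv_left_ne hQ)
  rcases hz.2.eq_or_lt with rfl | hzq
  · exact right h1
  obtain ⟨k, l, hkl, hl, hr⟩ := hA.split h0 hpz.le
  have left_pt : ∃ x, p < x ∧ x < z ∧ φ 0 x ≠ 0 := by
    by_contra! hcon
    refine h.deriv_left_ne hQ (deriv_eq_zero_on hpz h.pre.d0 (fun x hx => ?_) p ⟨le_rfl, hpz.le⟩)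
    rcases hx.1.eq_or_lt with rfl | h2
    · exact h.pre.left
    · rcases hx.2.eq_or_lt with rfl | h3
      · exact h0
      · exact hcon x h2 h3
  by_cases right_pt : ∃ x, z < x ∧ x < q ∧ φ 0 x ≠ 0
  · cases k with
    | zero =>
      obtain ⟨σ', hl'⟩ := exists_alt_one left_pt
      rw [zero_add] at hkl
      subst hkl
      obtain ⟨τ, hτ⟩ := h.alt_of_double_interior hQ h0 h1 hl' hr
      exact ⟨τ, hτ.of_le (by omega)⟩
    | succ k =>
      cases l with
      | zero =>
        obtain ⟨σ', hr'⟩ := exists_alt_one right_pt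
        obtain ⟨τ, hτ⟩ := h.alt_of_double_interior hQ h0 h1 hl hr'
        exact ⟨τ, hτ.of_le (by omega)⟩
      | succ l =>
        obtain ⟨τ, hτ⟩ := h.alt_of_double_interior hQ h0 h1 hl hr
        exact ⟨τ, hτ.of_le (by omega)⟩
  · push Not at right_pt
    refine right (deriv_eq_zero_on hzq h.pre.d0 (fun x hx => ?_) q ⟨hzq.le, le_rfl⟩)
    rcases hx.1.eq_or_lt with rfl | h2
    · exact h0
    · rcases hx.2.eq_or_lt with rfl | h3
      · exact h.pre.right
      · exact right_pt x h2 h3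

theorem Eig.exists_alt (hQ : Weight Q p q) {lam : ℝ} {φ : Jet} (h : Eig Q p q lam φ) :
    ∃ σ, Alt (φ 0) q 1 p σ := by
  obtain ⟨x, hx, hne⟩ := h.2
  refine exists_alt_one ⟨x, lt_of_le_of_ne hx.1 ?_, lt_of_le_of_ne hx.2 ?_, hne⟩
  · rintro rfl
    exact hne h.pre.left
  · rintro rfl
    exact hne h.pre.right

theorem Eig.no_double (hQ : Weight Q p q) {lam : ℝ} {φ : Jet} (h : Eig Q p q lam φ) {N : ℕ}
    (hN : ¬ ∃ σ, Alt (φ 0) q N p σ) {z : ℝ} (hz : z ∈ Icc p q) (h0 : φ 0 z = 0) : φ 1 z ≠ 0 := by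
  intro h1
  have key : ∀ n, ∃ σ, Alt (φ 0) q (n + 1) p σ := by
    intro n
    induction n with
    | zero => exact h.exists_alt hQ
    | succ n ih =>
      obtain ⟨σ, hσ⟩ := ih
      exact h.alt_succ_of_double hQ hz h0 h1 hσ
  obtain ⟨σ, hσ⟩ := key N
  exact hN ⟨σ, hσ.of_le (Nat.le_succ N)⟩

theorem tendsto_perturbation {l : Filter ℕ} {f g : ℝ → ℝ} (hf : Continuous f) (hg : Continuous g)
    {ε a : ℕ → ℝ} {A : ℝ} (hε : Tendsto ε l (nhds 0)) (ha : Tendsto a l (nhds A)) :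
    Tendsto (fun k => f (a k) + ε k * g (a k)) l (nhds (f A)) := by
  have h1 := (hf.tendsto A).comp ha
  have h2 := hε.mul ((hg.tendsto A).comp ha)
  simpa using h1.add h2

theorem alt_deriv_of_perturbation {f g : Jet} (hf : IsC1 f) (hg : IsC1 g) (hfq : f 0 q = 0)
    (hgq : g 0 q = 0) (hd : ∀ z ∈ Icc p q, f 0 z = 0 → f 1 z ≠ 0) {l : Ultrafilter ℕ} {ε : ℕ → ℝ}
    (hε : Tendsto ε l (nhds 0)) {n : ℕ} : ∀ {a : ℕ → ℝ} {A : ℝ}, Tendsto a l (nhds A) →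
      (∀ᶠ k in (l : Filter ℕ), a k ∈ Icc p q ∧ f 0 (a k) + ε k * g 0 (a k) = 0 ∧
        ∃ σ, Alt (fun x => f 0 x + ε k * g 0 x) q (n + 1) (a k) σ) →
      (∀ τ, τ ≠ 0 → Alt (f 1) q (n + 1) A τ) ∧ ∃ τ, Alt (f 1) q (n + 2) A τ := by
  have lim0 : ∀ {a : ℕ → ℝ} {A : ℝ}, Tendsto a l (nhds A) →
      (∀ᶠ k in (l : Filter ℕ), a k ∈ Icc p q ∧ f 0 (a k) + ε k * g 0 (a k) = 0) →
      A ∈ Icc p q ∧ f 0 A = 0 := by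
    intro a A ha h
    refine ⟨isClosed_Icc.mem_of_tendsto ha (h.mono fun k hk => hk.1), ?_⟩
    refine tendsto_nhds_unique (tendsto_perturbation hf.cont0 hg.cont0 hε ha) ?_
    exact tendsto_const_nhds.congr' (h.mono fun k hk => hk.2.symm)
  have distinct : ∀ {a c : ℕ → ℝ} {A C : ℝ}, Tendsto a l (nhds A) → Tendsto c l (nhds C) →
      (∀ᶠ k in (l : Filter ℕ), (a k ∈ Icc p q ∧ f 0 (a k) + ε k * g 0 (a k) = 0) ∧
        (c k ∈ Icc p q ∧ f 0 (c k) + ε k * g 0 (c k) = 0) ∧ a k < c k) →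
      A < C ∧ ∃ σ, Alt (f 1) C 2 A σ := by
    intro a c A C ha hc h
    obtain ⟨hA, fA⟩ := lim0 ha (h.mono fun k hk => hk.1)
    obtain ⟨hC, fC⟩ := lim0 hc (h.mono fun k hk => hk.2.1)
    have hle : A ≤ C := le_of_tendsto_of_tendsto ha hc (h.mono fun k hk => hk.2.2.le)
    have hlt : A < C := by
      refine lt_of_le_of_ne hle ?_
      rintro rfl
      have : ∀ᶠ k in (l : Filter ℕ), ∃ ξ, (a k ≤ ξ ∧ ξ ≤ c k) ∧ f 1 ξ + ε k * g 1 ξ = 0 := by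
        filter_upwards [h] with k hk
        obtain ⟨ξ, hξ, e⟩ := exists_hasDerivAt_eq_zero hk.2.2
          (f := fun x => f 0 x + ε k * g 0 x) (f' := fun x => f 1 x + ε k * g 1 x)
          (by have := hf.cont0; have := hg.cont0; fun_prop)
          (hk.1.2.trans hk.2.1.2.symm) (fun x _ => (hf.deriv x).add ((hg.deriv x).const_mul _))
        exact ⟨ξ, ⟨hξ.1.le, hξ.2.le⟩, e⟩
      obtain ⟨ξ, hξ⟩ := this.choice
      have hξt : Tendsto ξ l (nhds A) := tendsto_of_tendsto_of_tendsto_of_le_of_le' ha hc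
        (hξ.mono fun k hk => hk.1.1) (hξ.mono fun k hk => hk.1.2)
      refine hd A hA fA (tendsto_nhds_unique (tendsto_perturbation hf.cont hg.cont hε hξt) ?_)
      exact tendsto_const_nhds.congr' (hξ.mono fun k hk => hk.2.symm)
    refine ⟨hlt, ?_⟩
    obtain ⟨σ, hσ⟩ : ∃ σ, Alt (f 0) C 1 A σ := by
      apply exists_alt_one
      by_contra! hcon
      refine hd A hA fA (deriv_eq_zero_on hlt hf.deriv (fun x hx => ?_) A ⟨le_rfl, hlt.le⟩)
      rcases hx.1.eq_or_lt with rfl | h2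
      · exact fA
      · rcases hx.2.eq_or_lt with rfl | h3
        · exact fC
        · exact hcon x h2 h3
    exact ⟨σ, hσ.rolle_both (hf.rollePair A C) fA fC⟩
  have both : ∀ {A C σ : ℝ}, Alt (f 1) C 2 A σ → ∀ τ, τ ≠ 0 → Alt (f 1) C 1 A τ := by
    intro A C σ h τ hτ
    rcases lt_or_gt_of_ne (mul_ne_zero h.ne_zero hτ) with h1 | h1
    · exact h.tail.sign' (by linarith)
    · exact (h.of_le (by norm_num)).sign' h1
  induction n with
  | zero =>
    intro a A ha h
    obtain ⟨hlt, σ, hσ⟩ := distinct ha (tendsto_const_nhds (x := q)) (h.mono fun k hk =>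
      ⟨⟨hk.1, hk.2.1⟩, ⟨⟨hk.1.1.trans hk.1.2, le_rfl⟩, by simp [hfq, hgq]⟩, hk.2.2.choose_spec.lt⟩)
    exact ⟨both hσ, σ, hσ⟩
  | succ n ih =>
    intro a A ha h
    have h' : ∀ᶠ k in (l : Filter ℕ), ∃ c, (a k ∈ Icc p q ∧ f 0 (a k) + ε k * g 0 (a k) = 0) ∧
        (c ∈ Icc p q ∧ f 0 c + ε k * g 0 c = 0) ∧ a k < c ∧
        ∃ σ, Alt (fun x => f 0 x + ε k * g 0 x) q (n + 1) c σ := by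
      filter_upwards [h] with k hk
      obtain ⟨hk1, hk2, σ, x, x1, x2, x3, y, y1, y2, y3, y4⟩ := hk
      have hcont : ContinuousOn (fun x => σ * (f 0 x + ε k * g 0 x)) (Icc x y) := by
        have := hf.cont0
        have := hg.cont0
        fun_prop
      obtain ⟨c, hc, hc0⟩ := intermediate_value_Icc' y1.le hcont
        (show (0 : ℝ) ∈ _ from ⟨by linarith, x3.le⟩)
      have hσ : σ ≠ 0 := by
        rintro rfl
        simp at x3
      have hcy : c < y := by
        refine lt_of_le_of_ne hc.2 ?_
        rintro rfl
        simp only at hc0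
        linarith
      refine ⟨c, ⟨hk1, hk2⟩, ⟨⟨?_, ?_⟩, (mul_eq_zero.1 hc0).resolve_left hσ⟩, ?_, -σ, y, hcy, y2,
        y3, y4⟩
      · linarith [hk1.1, hc.1]
      · linarith
      · linarith [hc.1]
    obtain ⟨c, hc⟩ := h'.choice
    obtain ⟨C, -, hC⟩ := isCompact_Icc.ultrafilter_le_nhds (l.map c) (by
      rw [le_principal_iff]
      exact hc.mono fun k hk => hk.2.1.1)
    have hC' : Tendsto c l (nhds C) := hC
    obtain ⟨hlt, σ, hσ⟩ := distinct ha hC' (hc.mono fun k hk => ⟨hk.1, hk.2.1, hk.2.2.1⟩)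
    obtain ⟨h1, τ, h2⟩ := ih hC' (hc.mono fun k hk => ⟨hk.2.1.1, hk.2.1.2, hk.2.2.2⟩)
    refine ⟨fun ρ hρ => ?_, σ, ?_⟩
    · have := (both hσ ρ hρ).concat h2.lt.le hlt.le (h1 ((-1) ^ 1 * ρ) (by simpa using hρ))
      rwa [add_comm 1] at this
    · have := hσ.concat_loose h2.lt.le hlt.le hσ.ne_zero h2.ne_zero h2
      rwa [add_comm 2, add_right_comm] at this

theorem Eig.alt_of_perturbation (hQ : Weight Q p q) {lam : ℝ} {φ : Jet} (h : Eig Q p q lam φ)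
    {w : Jet} (hw : Adm p q w) {ε : ℕ → ℝ} (hε : Tendsto ε atTop (nhds 0)) {n : ℕ}
    (hA : ∀ k, ∃ σ, Alt (fun x => φ 0 x + ε k * w 0 x) q n p σ) : ∃ σ, Alt (φ 0) q n p σ := by
  cases n with
  | zero => exact ⟨0, trivial⟩
  | succ n =>
    by_contra hcon
    have hε' : Tendsto ε (hyperfilter ℕ) (nhds 0) :=
      hε.mono_left (Nat.cofinite_eq_atTop ▸ hyperfilter_le_cofinite)
    obtain ⟨-, τ, hτ⟩ := alt_deriv_of_perturbation h.pre.isC1 hw.isC1 h.pre.right hw.right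
      (fun z hz => h.no_double hQ hcon hz) hε' (tendsto_const_nhds (x := p))
      (Eventually.of_forall fun k => ⟨⟨le_rfl, hQ.lt.le⟩, by simp [h.pre.left, hw.left], hA k⟩)
    exact hcon ⟨_, h.alt_of_second hQ (hτ.rolle_free (rollePair_of_hasDerivAt h.pre.d1))⟩

end

section

variable {Q : ℝ → ℝ} {p q : ℝ}

section TwoEigenfunctions

variable {lam mu : ℝ} {φ ψ : Jet}

theorem Eig.pre_comb (h : Eig Q p q lam φ) (h' : Eig Q p q mu ψ) (s t : ℝ) :
    Pre Q p q ((s * lam) • φ + (t * mu) • ψ) (s • φ + t • ψ) := by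
  have := h.pre.smul_add h'.pre s t
  rwa [smul_smul, smul_smul] at this

theorem Eig.alt_comb (hQ : Weight Q p q) (h : Eig Q p q lam φ) (h' : Eig Q p q mu ψ) {s t : ℝ}
    {n : ℕ} {σ : ℝ} (hA : Alt ((s • φ + t • ψ) 0) q n p σ) :
    Alt (((s * lam) • φ + (t * mu) • ψ) 0) q n p σ :=
  (h.pre_comb h' s t).alt hQ (h.pre.isC1.smul_add h'.pre.isC1 _ _) hA

theorem Eig.alt_low (hQ : Weight Q p q) (h : Eig Q p q lam φ) (h' : Eig Q p q mu ψ)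
    (hlt : lam < mu) {n : ℕ} {σ : ℝ} (hA : Alt (φ 0) q n p σ) (D : ℝ) :
    Alt (((1 : ℝ) • φ + D • ψ) 0) q n p σ := by
  have hl := h.pos hQ
  have hm := h'.pos hQ
  have iter : ∀ (k : ℕ) (D : ℝ), Alt (((1 : ℝ) • φ + ((lam / mu) ^ k * D) • ψ) 0) q n p σ →
      Alt (((1 : ℝ) • φ + D • ψ) 0) q n p σ := by
    intro k
    induction k with
    | zero => intro D h; simpa using h
    | succ k ih =>
      intro D hk
      have h1 := ih (lam / mu * D) (by rwa [← mul_assoc, ← pow_succ])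
      refine (h.alt_comb hQ h' h1).congr_on (inv_pos.2 hl) fun x _ _ => ?_
      simp
      field_simp
  have hlim : Tendsto (fun k : ℕ => (lam / mu) ^ k * D) atTop (nhds 0) := by
    have := (tendsto_pow_atTop_nhds_zero_of_lt_one (div_nonneg hl.le hm.le)
      ((div_lt_one hm).2 hlt)).mul_const D
    simpa using this
  have hev := Alt.eventually (l := atTop)
    (v := fun k : ℕ => ((1 : ℝ) • φ + ((lam / mu) ^ k * D) • ψ) 0) (fun x _ _ => by
      simpa using tendsto_const_nhds.add (hlim.mul_const (ψ 0 x))) hA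
  obtain ⟨k, hk⟩ := hev.exists
  exact iter k D hk

theorem Eig.alt_high (hQ : Weight Q p q) (h : Eig Q p q lam φ) (h' : Eig Q p q mu ψ)
    (hlt : lam < mu) {n : ℕ} {σ D : ℝ} (hD : D ≠ 0)
    (hA : Alt (((1 : ℝ) • φ + D • ψ) 0) q n p σ) : ∃ τ, Alt (ψ 0) q n p τ := by
  have hl := h.pos hQ
  have hm := h'.pos hQ
  have iter : ∀ k : ℕ, Alt ((((lam / mu) ^ k) • φ + D • ψ) 0) q n p σ := by
    intro k
    induction k with
    | zero => simpa using hA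
    | succ k ih =>
      refine (h.alt_comb hQ h' ih).congr_on (inv_pos.2 hm) fun x _ _ => ?_
      simp [pow_succ]
      field_simp
  have hlim : Tendsto (fun k : ℕ => (lam / mu) ^ k / D) atTop (nhds 0) := by
    have := (tendsto_pow_atTop_nhds_zero_of_lt_one (div_nonneg hl.le hm.le)
      ((div_lt_one hm).2 hlt)).div_const D
    simpa using this
  refine h'.alt_of_perturbation hQ h.pre.adm hlim fun k =>
    ⟨D⁻¹ * σ, (iter k).smul (inv_ne_zero hD) fun x _ _ => ?_⟩
  simp
  field_simp
  ring

/-- Higher eigenfunctions alternate strictly more often. -/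
theorem Eig.alt_succ_of_lt (hQ : Weight Q p q) (h : Eig Q p q lam φ) (h' : Eig Q p q mu ψ)
    (hlt : lam < mu) {n : ℕ} {σ : ℝ} (hA : Alt (φ 0) q (n + 1) p σ) :
    ∃ τ, Alt (ψ 0) q (n + 2) p τ := by
  have hl := h.pos hQ
  have hm := h'.pos hQ
  have h1 := h.deriv_left_ne hQ
  have h2 := h'.deriv_left_ne hQ
  have hD : -(φ 1 p / ψ 1 p) ≠ 0 := neg_ne_zero.2 (div_ne_zero h1 h2)
  have a1 := h.alt_low hQ h' hlt hA (-(φ 1 p / ψ 1 p))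
  have a2 := (h.pre_comb h' 1 (-(φ 1 p / ψ 1 p))).alt_left hQ (h.pre.isC1.smul_add h'.pre.isC1 _ _)
    (by simp; field_simp; ring) a1
  refine h.alt_high hQ h' hlt (mul_ne_zero hD (div_ne_zero hm.ne' hl.ne'))
    (a2.congr_on (inv_pos.2 hl) fun x _ _ => ?_)
  simp
  field_simp

end TwoEigenfunctions

end

section

variable {Q : ℝ → ℝ} {p q : ℝ}

/-- The jet of a polynomial. -/
noncomputable def polyJet (R : Polynomial ℝ) : Jet :=
  fun i x => (Polynomial.derivative^[i] R).eval x

theorem polyJet_hasDerivAt (R : Polynomial ℝ) (i : ℕ) (x : ℝ) :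
    HasDerivAt (fun t => (Polynomial.derivative^[i] R).eval t)
      ((Polynomial.derivative^[i + 1] R).eval x) x := by
  rw [Function.iterate_succ_apply']
  exact Polynomial.hasDerivAt _ _

theorem polyJet_adm {R : Polynomial ℝ} (hp : R.eval p = 0) (hq : R.eval q = 0) :
    Adm p q (polyJet R) :=
  ⟨polyJet_hasDerivAt R 0, polyJet_hasDerivAt R 1, Polynomial.continuous _, hp, hq⟩

theorem polyJet_energy_linear {φ : Jet} (hφ : Continuous (φ 2)) (R S : Polynomial ℝ) (s t : ℝ) :
    energy p q (polyJet (s • R + t • S)) φ =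
      s * energy p q (polyJet R) φ + t * energy p q (polyJet S) φ := by
  rw [← energy_smul_add (u := polyJet R) (v := polyJet S) (Polynomial.continuous _)
    (Polynomial.continuous _) hφ]
  congr 1
  ext i x
  simp [polyJet, Polynomial.smul_eq_C_mul]

theorem exists_test_function (hpq : p < q) {m : ℕ} {φ : Fin m → Jet}
    (hφ : ∀ i, Continuous (φ i 2)) : ∃ g : Jet, Adm p q g ∧ (∀ i, energy p q g (φ i) = 0) ∧
      (∀ n σ, Alt (g 0) q n p σ → n ≤ m + 1) ∧ {x | g 0 x = 0}.Finite := by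
  let W : Polynomial ℝ := (Polynomial.X - Polynomial.C p) * (Polynomial.C q - Polynomial.X)
  let L : (Fin (m + 1) → ℝ) →ₗ[ℝ] (Fin m → ℝ) := IsLinearMap.mk'
    (fun c i => energy p q (polyJet (W * ((Polynomial.degreeLTEquiv ℝ (m + 1)).symm c).1)) (φ i))
    ⟨fun c d => by
      ext i
      have := polyJet_energy_linear (p := p) (q := q) (hφ i)
        (W * ((Polynomial.degreeLTEquiv ℝ (m + 1)).symm c).1)
        (W * ((Polynomial.degreeLTEquiv ℝ (m + 1)).symm d).1) 1 1
      simpa [mul_add] using this, fun s c => by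
      ext i
      have := polyJet_energy_linear (p := p) (q := q) (hφ i)
        (W * ((Polynomial.degreeLTEquiv ℝ (m + 1)).symm c).1)
        (W * ((Polynomial.degreeLTEquiv ℝ (m + 1)).symm c).1) s 0
      simpa using this⟩
  have hker : LinearMap.ker L ≠ ⊥ := LinearMap.ker_ne_bot_of_finrank_lt (by simp)
  obtain ⟨c, hc, hc0⟩ := Submodule.exists_mem_ne_zero_of_ne_bot hker
  set r : Polynomial ℝ := ((Polynomial.degreeLTEquiv ℝ (m + 1)).symm c).1 with hr
  have hr0 : r ≠ 0 := by
    intro h0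
    apply hc0
    have : (Polynomial.degreeLTEquiv ℝ (m + 1)).symm c = 0 := Subtype.ext h0
    simpa using this
  have hdeg : r.natDegree ≤ m := by
    have := ((Polynomial.degreeLTEquiv ℝ (m + 1)).symm c).2
    rw [Polynomial.mem_degreeLT, ← hr, Polynomial.degree_lt_iff_coeff_zero] at this
    rw [Polynomial.natDegree_le_iff_coeff_eq_zero]
    exact fun N hN => this N hN
  have hW : W ≠ 0 := by
    intro h0
    have := congrArg (Polynomial.eval ((p + q) / 2)) h0
    simp [W] at this
    rcases this with h | h <;> linarith
  have hadm : Adm p q (polyJet (W * r)) := polyJet_adm (by simp [W]) (by simp [W])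
  refine ⟨polyJet (W * r), hadm, fun i => congrFun hc i, ?_, ?_⟩
  · intro n σ hA
    cases n with
    | zero => omega
    | succ n =>
      obtain ⟨s, hs, hz⟩ := hA.exists_zeros hadm.isC1.cont0
      have hsub : s ⊆ r.roots.toFinset := by
        intro x hx
        obtain ⟨h1, h2, h3⟩ := hz x hx
        rw [Multiset.mem_toFinset, Polynomial.mem_roots hr0, Polynomial.IsRoot]
        simp [polyJet, W] at h3
        rcases h3 with (h3 | h3) | h3
        · linarith
        · linarith
        · exact h3
      have := (Finset.card_le_card hsub).trans
        ((Multiset.toFinset_card_le _).trans (Polynomial.card_roots' r))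
      omega
  · have : {x | polyJet (W * r) 0 x = 0} = (W * r).rootSet ℝ := by
      ext x
      simp [Polynomial.mem_rootSet, polyJet, mul_ne_zero hW hr0]
    rw [this]
    exact Polynomial.rootSet_finite _ _

theorem Pre.exists_ne_zero (hQ : Weight Q p q) {g u : Jet} (hg : IsC1 g) (h : Pre Q p q g u)
    (hfin : {x | g 0 x = 0}.Countable) : ∃ x ∈ Icc p q, u 0 x ≠ 0 := by
  by_contra! hcon
  have h3 := deriv_eq_zero_on hQ.lt h.d2 (deriv_eq_zero_on hQ.lt h.d1
    (deriv_eq_zero_on hQ.lt h.d0 hcon))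
  have key : ∀ x ∈ Ioo p q \ {x | g 0 x = 0}, HasDerivAt Q 0 x := by
    rintro x ⟨hx, hgx⟩
    have hgx : g 0 x ≠ 0 := hgx
    have h4 : HasDerivAt (fun t => Q t * g 0 t) (Q x * g 1 x) x := by
      refine ((h.d3 x).neg.congr_of_eventuallyEq ?_).congr_deriv (by ring)
      filter_upwards [Ioo_mem_nhds hx.1 hx.2] with t ht
      simp [h3 t ⟨ht.1.le, ht.2.le⟩]
    refine ((h4.div (hg.deriv x) hgx).congr_of_eventuallyEq ?_).congr_deriv ?_
    · filter_upwards [hg.cont0.continuousAt.eventually_ne hgx] with t ht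
      simp [ht]
    · field_simp
      ring
  have := MeasureTheory.integral_eq_of_hasDerivAt_off_countable_of_le Q (fun _ => 0) hQ.lt.le hfin
    hQ.cont.continuousOn key (by simp)
  have hj := hQ.jump
  simp at this
  linarith

theorem Adm.exists_uniform_limit (hpq : p < q) {h : ℕ → Jet} (hh : ∀ k, Adm p q (h k))
    (hE : ∀ k, energy p q (h k) (h k) = 1) : ∃ (H : Jet) (θ : ℕ → ℕ) (M : ℕ → ℝ), IsC1 H ∧
      StrictMono θ ∧ Tendsto M atTop (nhds 0) ∧ ∀ k, ∀ x ∈ Icc p q,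
        |h (θ k) 0 x - H 0 x| ≤ M k ∧ |h (θ k) 1 x - H 1 x| ≤ M k := by
  let f : ℕ → BoundedContinuousFunction (Icc p q) ℝ := fun k =>
    BoundedContinuousFunction.mkOfCompact ⟨fun x => h k 1 x,
      (hh k).isC1.cont.comp continuous_subtype_val⟩
  have hcomp : IsCompact (closure (range f)) := by
    refine BoundedContinuousFunction.arzela_ascoli (Icc (-√(q - p)) (√(q - p))) isCompact_Icc
      (range f) ?_ ?_
    · rintro _ x ⟨k, rfl⟩
      have := (hh k).sq_one_le hpq x.2
      rw [hE, mul_one] at this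
      exact abs_le.1 (Real.abs_le_sqrt this)
    · have hs : Tendsto Real.sqrt (nhds 0) (nhds 0) := by
        simpa using Real.continuous_sqrt.tendsto 0
      refine Metric.equicontinuous_of_continuity_modulus _ hs _ ?_
      have holder : ∀ k, ∀ x y : Icc p q, x ≤ y → dist (h k 1 x) (h k 1 y) ≤ √(dist x y) := by
        intro k x y hxy
        have hxy' : (x : ℝ) ≤ y := hxy
        have := (hh k).sq_sub_le x.2.1 hxy' y.2.2
        rw [hE, mul_one] at this
        rw [dist_comm, dist_comm x, Subtype.dist_eq, Real.dist_eq, Real.dist_eq,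
          abs_of_nonneg (sub_nonneg.2 hxy')]
        exact Real.abs_le_sqrt this
      rintro x y ⟨_, k, rfl⟩
      rcases le_total x y with hxy | hxy
      · exact holder k x y hxy
      · rw [dist_comm x, dist_comm]
        exact holder k y x hxy
  obtain ⟨H1, -, θ, hθ, hlim⟩ := hcomp.tendsto_subseq (fun k => subset_closure (mem_range_self k))
  let E1 : ℝ → ℝ := IccExtend hpq.le H1
  have hE1 : Continuous E1 := H1.continuous.Icc_extend'
  let H : Jet := ![fun x => ∫ y in p..x, E1 y, E1, 0, 0]
  have hH : IsC1 H := ⟨fun x => (hE1.integral_hasStrictDerivAt p x).hasDerivAt, hE1⟩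
  have hd : ∀ k, ∀ x ∈ Icc p q, |h (θ k) 1 x - H 1 x| ≤ dist (f (θ k)) H1 := fun k x hx => by
    have := BoundedContinuousFunction.dist_coe_le_dist (f := f (θ k)) (g := H1) ⟨x, hx⟩
    rw [Real.dist_eq] at this
    change |h (θ k) 1 x - IccExtend hpq.le H1 x| ≤ _
    rwa [IccExtend_of_mem hpq.le H1 hx]
  refine ⟨H, θ, fun k => (1 + (q - p)) * dist (f (θ k)) H1, hH, hθ, ?_, ?_⟩
  · simpa using (tendsto_iff_dist_tendsto_zero.1 hlim).const_mul (1 + (q - p))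
  · intro k x hx
    have hd0 : 0 ≤ dist (f (θ k)) H1 := dist_nonneg
    have hL : 0 < q - p := by linarith
    constructor
    · rcases hx.1.eq_or_lt with rfl | hlt
      · rw [(hh _).left]
        simp [H]
        positivity
      obtain ⟨ξ, hξ, e⟩ := exists_hasDerivAt_eq_slope (fun t => h (θ k) 0 t - H 0 t)
        (fun t => h (θ k) 1 t - H 1 t) hlt
        (((hh _).isC1.cont0.sub hH.cont0).continuousOn)
        (fun x _ => ((hh _).d0 x).sub (hH.deriv x))
      have e0 : h (θ k) 0 p - H 0 p = 0 := by
        rw [(hh _).left]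
        simp [H]
      rw [e0, sub_zero, eq_div_iff (by linarith)] at e
      rw [← e, abs_mul, abs_of_pos (show 0 < x - p by linarith)]
      have := hd k ξ ⟨hξ.1.le, hξ.2.le.trans hx.2⟩
      have hxq := hx.2
      have := mul_le_mul this (show x - p ≤ q - p by linarith) (by linarith) hd0
      linarith
    · have := hd k x hx
      nlinarith

end

section

variable {Q : ℝ → ℝ} {p q : ℝ}

/-- Ratios of a log-convex sequence of positive numbers with bounded growth converge. -/
theorem tendsto_ratio_of_log_convex {e : ℕ → ℝ} {C : ℝ} (h0 : ∀ n, 0 ≤ e n)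
    (hconv : ∀ n, e (n + 1) ^ 2 ≤ e n * e (n + 2)) (h2 : 0 < e 2)
    (hC : ∀ k, e (2 * k + 2) ≤ C * e (2 * k)) :
    (∀ n, 0 < e n) ∧ ∃ r, 0 < r ∧ Tendsto (fun n => e (n + 1) / e n) atTop (nhds r) := by
  have h1 : 0 < e 1 := by
    have : 0 < e 1 * e 3 := (pow_pos h2 2).trans_le (hconv 1)
    exact (h0 1).lt_of_ne fun h => by rw [← h] at this; simp at this
  have hz : 0 < e 0 := by
    have : 0 < e 0 * e 2 := (pow_pos h1 2).trans_le (hconv 0)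
    exact (h0 0).lt_of_ne fun h => by rw [← h] at this; simp at this
  have hpos : ∀ n, 0 < e n ∧ 0 < e (n + 1) := by
    intro n
    induction n with
    | zero => exact ⟨hz, h1⟩
    | succ n ih =>
      refine ⟨ih.2, ?_⟩
      have : 0 < e n * e (n + 2) := (pow_pos ih.2 2).trans_le (hconv n)
      exact pos_of_mul_pos_right this ih.1.le
  have hp : ∀ n, 0 < e n := fun n => (hpos n).1
  refine ⟨hp, ?_⟩
  have hmono : Monotone fun n => e (n + 1) / e n := monotone_nat_of_le_succ fun n => by
    rw [div_le_div_iff₀ (hp n) (hp (n + 1))]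
    have := hconv n
    rw [show n + 1 + 1 = n + 2 from rfl]
    nlinarith
  have hC0 : 0 ≤ C := by
    have := hC 0
    have h2 := hp (2 * 0 + 2)
    exact (pos_of_mul_pos_left (h2.trans_le this) (hp _).le).le
  have hbdd : ∀ n, e (n + 1) / e n ≤ √C := by
    intro n
    apply Real.le_sqrt_of_sq_le
    have m1 : e (n + 1) / e n ≤ e (2 * n + 1) / e (2 * n) := hmono (by omega)
    have m2 : e (n + 1) / e n ≤ e (2 * n + 2) / e (2 * n + 1) := hmono (by omega)
    have hn0 : 0 ≤ e (n + 1) / e n := (div_pos (hp _) (hp _)).le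
    calc (e (n + 1) / e n) ^ 2 = (e (n + 1) / e n) * (e (n + 1) / e n) := sq _
      _ ≤ (e (2 * n + 1) / e (2 * n)) * (e (2 * n + 2) / e (2 * n + 1)) :=
        mul_le_mul m1 m2 hn0 (hn0.trans m1)
      _ = e (2 * n + 2) / e (2 * n) := by
        have := (hp (2 * n + 1)).ne'
        have := (hp (2 * n)).ne'
        field_simp
      _ ≤ C := (div_le_iff₀ (hp _)).2 (hC n)
  have hlim := tendsto_atTop_ciSup hmono ⟨√C, by rintro _ ⟨n, rfl⟩; exact hbdd n⟩
  refine ⟨_, ?_, hlim⟩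
  exact (div_pos (hp 1) (hp 0)).trans_le (hmono.ge_of_tendsto hlim 0)

section Iteration

variable {G : ℕ → Jet}

theorem iterate_adm (h0 : Adm p q (G 0)) (hG : ∀ k, Pre Q p q (G k) (G (k + 1))) (k : ℕ) :
    Adm p q (G k) := by
  cases k with
  | zero => exact h0
  | succ k => exact (hG k).adm

theorem iterate_energy (hQ : Weight Q p q) (h0 : Adm p q (G 0))
    (hG : ∀ k, Pre Q p q (G k) (G (k + 1))) (k l : ℕ) :
    energy p q (G k) (G l) = energy p q (G (k + l)) (G 0) := by
  have hA := iterate_adm h0 hG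
  have e1 : ∀ k l, energy p q (G (k + 1)) (G l) = mass Q p q (G k) (G l) := fun k l =>
    (hG k).energy_eq_mass hQ.cont (hA k).isC1 (hA l)
  induction l generalizing k with
  | zero => rfl
  | succ l ih =>
    rw [energy_comm, e1, mass_comm, ← e1, ih]
    congr 2
    omega

theorem iterate_mass (hQ : Weight Q p q) (h0 : Adm p q (G 0))
    (hG : ∀ k, Pre Q p q (G k) (G (k + 1))) (k l : ℕ) :
    mass Q p q (G k) (G l) = energy p q (G (k + l + 1)) (G 0) := by
  have hA := iterate_adm h0 hG
  rw [← (hG k).energy_eq_mass hQ.cont (hA k).isC1 (hA l), iterate_energy hQ h0 hG]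
  congr 2
  omega

theorem iterate_tendsto (hQ : Weight Q p q) (h0 : Adm p q (G 0))
    (hG : ∀ k, Pre Q p q (G k) (G (k + 1))) (h1 : ∃ x ∈ Icc p q, G 1 0 x ≠ 0) :
    (∀ n, 0 < energy p q (G n) (G 0)) ∧ ∃ r, 0 < r ∧
      Tendsto (fun n => energy p q (G (n + 1)) (G 0) / energy p q (G n) (G 0)) atTop (nhds r) := by
  have hA := iterate_adm h0 hG
  obtain ⟨K, hK⟩ := hQ.bound
  obtain ⟨C, hC0, hC⟩ := Pre.energy_le hQ.cont hK hQ.lt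
  have hL : 0 < q - p := sub_pos.2 hQ.lt
  have even : ∀ k, energy p q (G (2 * k)) (G 0) = energy p q (G k) (G k) := fun k => by
    rw [iterate_energy hQ h0 hG k k, two_mul]
  have odd : ∀ k, energy p q (G (2 * k + 1)) (G 0) = mass Q p q (G k) (G k) := fun k => by
    rw [iterate_mass hQ h0 hG, two_mul]
  refine tendsto_ratio_of_log_convex (e := fun n => energy p q (G n) (G 0))
    (C := C * ((q - p) + (q - p) ^ 3)) ?_ ?_ ?_ ?_
  · intro n
    obtain ⟨k, rfl | rfl⟩ := n.even_or_odd'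
    · simp only [even]
      exact energy_self_nonneg hQ.lt.le _
    · simp only [odd]
      exact mass_self_nonneg hQ.cont hQ.mono hQ.lt.le (hA k)
  · intro n
    obtain ⟨k, rfl | rfl⟩ := n.even_or_odd'
    · have := energy_sq_le hQ.lt.le (hA k).c2 (hA (k + 1)).c2
      simp only [iterate_energy hQ h0 hG k, iterate_energy hQ h0 hG (k + 1)] at this
      rwa [show k + (k + 1) = 2 * k + 1 by ring, show k + k = 2 * k by ring,
        show k + 1 + (k + 1) = 2 * k + 2 by ring] at this
    · have := mass_sq_le hQ.cont hQ.mono hQ.lt.le (hA k) (hA (k + 1))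
      simp only [iterate_mass hQ h0 hG] at this
      rwa [show k + (k + 1) + 1 = 2 * k + 1 + 1 by ring, show k + k = 2 * k by ring,
        show k + 1 + (k + 1) + 1 = 2 * k + 1 + 2 by ring] at this
  · have := even 1
    simp only [mul_one] at this
    simp only [this]
    refine (energy_self_nonneg hQ.lt.le _).lt_of_ne fun hz => ?_
    obtain ⟨x, hx, hne⟩ := h1
    exact hne ((hA 1).eq_zero_of_energy hQ.lt hz.symm hx)
  · intro k
    have h2 := even (k + 1)
    rw [show 2 * (k + 1) = 2 * k + 2 by ring] at h2
    simp only [h2, even]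
    have hE := energy_self_nonneg hQ.lt.le (G k)
    have hp3 : 0 ≤ (q - p) ^ 3 * energy p q (G k) (G k) := by positivity
    have hp1 : 0 ≤ (q - p) * energy p q (G k) (G k) := by positivity
    have := hC (G k) (G (k + 1)) (√(((q - p) + (q - p) ^ 3) * energy p q (G k) (G k)))
      (hA k).isC1 (hG k) (fun x hx => ⟨Real.abs_le_sqrt (by
        have := (hA k).sq_zero_le hQ.lt hx
        linarith), Real.abs_le_sqrt (by
        have := (hA k).sq_one_le hQ.lt hx
        linarith)⟩)
    rw [Real.sq_sqrt (by positivity)] at this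
    linarith

theorem iterate_alt (hQ : Weight Q p q) (h0 : Adm p q (G 0))
    (hG : ∀ k, Pre Q p q (G k) (G (k + 1))) {n : ℕ} {σ : ℝ} (k : ℕ) (h : Alt (G k 0) q n p σ) :
    Alt (G 0 0) q n p σ := by
  induction k with
  | zero => exact h
  | succ k ih => exact ih ((hG k).alt hQ (iterate_adm h0 hG k).isC1 h)

theorem iterate_orthogonal (hQ : Weight Q p q) (h0 : Adm p q (G 0))
    (hG : ∀ k, Pre Q p q (G k) (G (k + 1))) {lam : ℝ} {φ : Jet} (hφ : Eig Q p q lam φ)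
    (h : energy p q (G 0) φ = 0) (k : ℕ) : energy p q (G k) φ = 0 := by
  induction k with
  | zero => exact h
  | succ k ih =>
    have hk := iterate_adm h0 hG k
    rw [(hG k).energy_eq_mass hQ.cont hk.isC1 hφ.pre.adm, mass_comm]
    rw [energy_comm, hφ.energy_eq hQ hk] at ih
    exact (mul_eq_zero.1 ih).resolve_left (hφ.pos hQ).ne'

end Iteration

end

section

variable {Q : ℝ → ℝ} {p q : ℝ}

theorem energy_smul_smul {u v : Jet} (hu : Continuous (u 2)) (hv : Continuous (v 2)) (s : ℝ) :
    energy p q (s • u) (s • v) = s ^ 2 * energy p q u v := by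
  have h1 := energy_smul_add (p := p) (q := q) hu hu (w := s • v) (hv.const_smul s) s 0
  have h2 := energy_smul_add (p := p) (q := q) hv hv hu s 0
  simp only [zero_smul, add_zero, zero_mul] at h1 h2
  rw [h1, energy_comm, h2, energy_comm]
  ring

theorem tendsto_zero_of_energy (hpq : p < q) {v : ℕ → Jet} (hv : ∀ k, Adm p q (v k))
    (h : Tendsto (fun k => energy p q (v k) (v k)) atTop (nhds 0)) {x : ℝ} (hx : x ∈ Icc p q) :
    Tendsto (fun k => v k 0 x) atTop (nhds 0) := by
  have h1 : Tendsto (fun k => √((q - p) ^ 3 * energy p q (v k) (v k))) atTop (nhds 0) := by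
    have := (Real.continuous_sqrt.tendsto _).comp (h.const_mul ((q - p) ^ 3))
    simpa [Function.comp_def] using this
  exact squeeze_zero_norm (fun k => Real.abs_le_sqrt ((hv k).sq_zero_le hpq hx)) h1

theorem exists_iterates (hQ : Weight Q p q) {g : Jet} (hg : IsC1 g) :
    ∃ G : ℕ → Jet, G 0 = g ∧ ∀ k, Pre Q p q (G k) (G (k + 1)) := by
  have hsucc : ∀ v : Jet, ∃ u, IsC1 v → Pre Q p q v u := fun v => by
    by_cases h : IsC1 v
    · obtain ⟨u, hu⟩ := exists_pre hQ.cont hQ.lt h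
      exact ⟨u, fun _ => hu⟩
    · exact ⟨0, fun h' => absurd h' h⟩
  choose T hT using hsucc
  have hC1 : ∀ n, IsC1 (T^[n] g) := by
    intro n
    induction n with
    | zero => exact hg
    | succ n ih =>
      rw [Function.iterate_succ_apply' T n g]
      exact (hT _ ih).isC1
  refine ⟨fun n => T^[n] g, rfl, fun k => ?_⟩
  simp only [Function.iterate_succ_apply' T k g]
  exact hT _ (hC1 k)

/-- Approximate eigenfunctions of the solution operator accumulate at an eigenfunction. -/
theorem exists_eig_of_approx (hQ : Weight Q p q) {h u : ℕ → Jet} {r : ℝ} (hr : 0 < r)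
    (hhu : ∀ k, Pre Q p q (h k) (u k)) (hh : ∀ k, Adm p q (h k))
    (Ehh : ∀ k, energy p q (h k) (h k) = 1)
    (Euh : Tendsto (fun k => energy p q (u k) (h k)) atTop (nhds r))
    (Euu : Tendsto (fun k => energy p q (u k) (u k)) atTop (nhds (r * r))) :
    ∃ F, ∃ θ : ℕ → ℕ, Eig Q p q r⁻¹ F ∧
      Tendsto (fun k => energy p q ((1 : ℝ) • u (θ k) + (-1 : ℝ) • F)
        ((1 : ℝ) • u (θ k) + (-1 : ℝ) • F)) atTop (nhds 0) := by
  have hu : ∀ k, Adm p q (u k) := fun k => (hhu k).adm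
  have hdiff : Tendsto (fun k => energy p q ((1 : ℝ) • u k + (-r) • h k)
      ((1 : ℝ) • u k + (-r) • h k)) atTop (nhds 0) := by
    have : Tendsto (fun k => energy p q (u k) (u k) - 2 * r * energy p q (u k) (h k) + r ^ 2)
        atTop (nhds 0) := by
      convert (Euu.sub (Euh.const_mul (2 * r))).add_const (r ^ 2) using 2
      ring
    refine this.congr fun k => ?_
    rw [energy_quadratic (hu k).c2 (hh k).c2, Ehh]
    ring
  obtain ⟨H, θ, M, hH, hθ, hM, hHlim⟩ := Adm.exists_uniform_limit hQ.lt hh Ehh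
  obtain ⟨F, hF⟩ := exists_pre hQ.cont hQ.lt hH
  obtain ⟨K, hK⟩ := hQ.bound
  obtain ⟨C, -, hC⟩ := Pre.energy_le hQ.cont hK hQ.lt
  have hdF : ∀ k, Adm p q ((1 : ℝ) • u k + (-1 : ℝ) • F) := fun k => (hu k).smul_add hF.adm _ _
  have hEF : Tendsto (fun k => energy p q ((1 : ℝ) • u (θ k) + (-1 : ℝ) • F)
      ((1 : ℝ) • u (θ k) + (-1 : ℝ) • F)) atTop (nhds 0) := by
    refine squeeze_zero (g := fun k => C * M k ^ 2) (fun k => energy_self_nonneg hQ.lt.le _)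
      (fun k => ?_) ?_
    · refine hC _ _ (M k) ((hh (θ k)).isC1.smul_add hH 1 (-1))
        ((hhu (θ k)).smul_add hF 1 (-1)) fun x hx => ?_
      simpa [← sub_eq_add_neg] using hHlim k x hx
    · simpa using (hM.pow 2).const_mul C
  have huF : ∀ x ∈ Icc p q, Tendsto (fun k => u (θ k) 0 x) atTop (nhds (F 0 x)) := fun x hx => by
    have := (tendsto_zero_of_energy hQ.lt (fun k => hdF (θ k)) hEF hx).add_const (F 0 x)
    simpa using this
  have hFH : ∀ x ∈ Icc p q, H 0 x = (r⁻¹ • F) 0 x := fun x hx => by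
    have t1 : Tendsto (fun k => h (θ k) 0 x) atTop (nhds (H 0 x)) := by
      rw [tendsto_iff_norm_sub_tendsto_zero]
      exact squeeze_zero (fun k => norm_nonneg _) (fun k => (hHlim k x hx).1) hM
    have t2 := (tendsto_zero_of_energy hQ.lt (fun k => (hu k).smul_add (hh k) 1 (-r)) hdiff
      hx).comp hθ.tendsto_atTop
    have t3 := (huF x hx).sub (t1.const_mul r)
    have := tendsto_nhds_unique t3 (t2.congr fun k => by simp; ring)
    simp
    field_simp
    linarith
  have hEig : Pre Q p q (r⁻¹ • F) F := hF.congr_load hQ.lt hQ.left hQ.right hH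
    (hF.isC1.smul _) hFH
  refine ⟨F, θ, ⟨hEig, ?_⟩, hEF⟩
  by_contra! hcon
  have hF2 := deriv_eq_zero_on hQ.lt hF.d1 (deriv_eq_zero_on hQ.lt hF.d0 hcon)
  have heq : ∀ k, energy p q ((1 : ℝ) • u k + (-1 : ℝ) • F) ((1 : ℝ) • u k + (-1 : ℝ) • F) =
      energy p q (u k) (u k) := fun k => by
    refine intervalIntegral.integral_congr fun x hx => ?_
    rw [uIcc_of_le hQ.lt.le] at hx
    simp [hF2 x hx]
  simp only [heq] at hEF
  have := tendsto_nhds_unique hEF (Euu.comp hθ.tendsto_atTop)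
  nlinarith

theorem exists_eig_of_iterates (hQ : Weight Q p q) {G : ℕ → Jet} (hG0 : Adm p q (G 0))
    (hG : ∀ k, Pre Q p q (G k) (G (k + 1))) (h1 : ∃ x ∈ Icc p q, G 1 0 x ≠ 0) :
    ∃ mu F, ∃ c : ℕ → ℝ, ∃ θ : ℕ → ℕ, Eig Q p q mu F ∧ (∀ k, 0 < c k) ∧
      Tendsto (fun k => energy p q ((1 : ℝ) • (c k • G (θ k)) + (-1 : ℝ) • F)
        ((1 : ℝ) • (c k • G (θ k)) + (-1 : ℝ) • F)) atTop (nhds 0) := by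
  have hA := iterate_adm hG0 hG
  obtain ⟨hpos, r, hr, hlim⟩ := iterate_tendsto hQ hG0 hG h1
  obtain ⟨e, he⟩ : ∃ e : ℕ → ℝ, ∀ n, energy p q (G n) (G 0) = e n := ⟨_, fun n => rfl⟩
  have he' : ∀ k l, energy p q (G k) (G l) = e (k + l) := fun k l => by
    rw [iterate_energy hQ hG0 hG, he]
  simp only [he] at hpos hlim
  have hlim0 : Tendsto (fun k => e (2 * k + 1) / e (2 * k)) atTop (nhds r) :=
    hlim.comp (strictMono_mul_left_of_pos two_pos).tendsto_atTop
  have h2 : StrictMono fun k => 2 * k + 1 := fun k l h => by simpa using h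
  have hlim1 : Tendsto (fun k => e (2 * k + 2) / e (2 * k + 1)) atTop (nhds r) :=
    hlim.comp h2.tendsto_atTop
  have hlim2 : Tendsto (fun k => e (2 * k + 2) / e (2 * k)) atTop (nhds (r * r)) := by
    refine (hlim1.mul hlim0).congr fun k => ?_
    exact div_mul_div_cancel₀ (hpos _).ne'
  obtain ⟨c, hcpos, hc⟩ : ∃ c : ℕ → ℝ, (∀ k, 0 < c k) ∧ ∀ k, c k ^ 2 = (e (2 * k))⁻¹ :=
    ⟨fun k => (√(e (2 * k)))⁻¹, fun k => inv_pos.2 (Real.sqrt_pos.2 (hpos _)),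
      fun k => by rw [inv_pow, Real.sq_sqrt (hpos _).le]⟩
  have E1 : ∀ k, energy p q (c k • G k) (c k • G k) = 1 := fun k => by
    rw [energy_smul_smul (hA k).c2 (hA k).c2, hc, he', ← two_mul]
    exact inv_mul_cancel₀ (hpos _).ne'
  have E2 : ∀ k, energy p q (c k • G (k + 1)) (c k • G k) = e (2 * k + 1) / e (2 * k) := fun k => by
    rw [energy_smul_smul (hA _).c2 (hA k).c2, hc, he',
      show k + 1 + k = 2 * k + 1 by ring, inv_mul_eq_div]
  have E3 : ∀ k, energy p q (c k • G (k + 1)) (c k • G (k + 1)) = e (2 * k + 2) / e (2 * k) :=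
    fun k => by
      rw [energy_smul_smul (hA _).c2 (hA _).c2, hc, he',
        show k + 1 + (k + 1) = 2 * k + 2 by ring, inv_mul_eq_div]
  have hcA : ∀ k, Adm p q (c k • G k) := fun k => by
    simpa using (hA k).smul_add (hA k) (c k) 0
  obtain ⟨F, θ, hF, hlimF⟩ := exists_eig_of_approx hQ (h := fun k => c k • G k)
    (u := fun k => c k • G (k + 1)) hr (fun k => (hG k).smul (c k)) hcA E1
    (by simpa only [E2] using hlim0) (by simpa only [E3] using hlim2)
  exact ⟨r⁻¹, F, fun k => c (θ k), fun k => θ k + 1, hF, fun k => hcpos _, hlimF⟩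

/-- An eigenfunction orthogonal to `m` given ones and alternating at most `m + 1` times. -/
theorem exists_eig_orthogonal (hQ : Weight Q p q) {m : ℕ} {lam : Fin m → ℝ} {φ : Fin m → Jet}
    (hφ : ∀ i, Eig Q p q (lam i) (φ i)) : ∃ mu X, Eig Q p q mu X ∧
      (∀ i, energy p q X (φ i) = 0) ∧ ∀ n σ, Alt (X 0) q n p σ → n ≤ m + 1 := by
  obtain ⟨g, hg, horth, hcount, hfin⟩ := exists_test_function hQ.lt fun i => (hφ i).pre.adm.c2
  obtain ⟨G, rfl, hG⟩ := exists_iterates hQ hg.isC1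
  have hA := iterate_adm hg hG
  obtain ⟨mu, F, c, θ, hF, hc, hlim⟩ := exists_eig_of_iterates hQ hg hG
    ((hG 0).exists_ne_zero hQ hg.isC1 hfin.countable)
  have hcA : ∀ k, Adm p q (c k • G (θ k)) := fun k => by
    simpa using (hA (θ k)).smul_add (hA (θ k)) (c k) 0
  have hd : ∀ k, Adm p q ((1 : ℝ) • (c k • G (θ k)) + (-1 : ℝ) • F) := fun k =>
    (hcA k).smul_add hF.pre.adm _ _
  refine ⟨mu, F, hF, fun i => ?_, fun n σ hAlt => ?_⟩
  · have hGφ := iterate_orthogonal hQ hg hG (hφ i) (horth i)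
    have hφ2 := (hφ i).pre.adm.c2
    have hcs : ∀ k, energy p q F (φ i) ^ 2 ≤
        energy p q ((1 : ℝ) • (c k • G (θ k)) + (-1 : ℝ) • F)
          ((1 : ℝ) • (c k • G (θ k)) + (-1 : ℝ) • F) * energy p q (φ i) (φ i) := fun k => by
      have h1 := energy_sq_le hQ.lt.le (hd k).c2 hφ2
      have h2 := energy_smul_add (p := p) (q := q) (hA (θ k)).c2 (hA (θ k)).c2 hφ2 (c k) 0
      rw [hGφ] at h2
      simp only [zero_smul, add_zero, mul_zero] at h2
      rw [energy_smul_add (hcA k).c2 hF.pre.adm.c2 hφ2, h2] at h1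
      simpa using h1
    have := ge_of_tendsto' (hlim.mul_const (energy p q (φ i) (φ i))) hcs
    rw [zero_mul] at this
    exact pow_eq_zero_iff two_ne_zero |>.1 (le_antisymm this (sq_nonneg _))
  · obtain ⟨k, hk⟩ := (Alt.eventually (l := atTop) (v := fun k => (c k • G (θ k)) 0)
      (fun x h1 h2 => by
        simpa using (tendsto_zero_of_energy hQ.lt hd hlim ⟨h1.le, h2.le⟩).add_const (F 0 x))
      hAlt).exists
    refine hcount n σ (iterate_alt hQ hg hG (θ k) (hk.congr_on (inv_pos.2 (hc k))
      fun x _ _ => ?_))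
    exact (inv_mul_cancel_left₀ (hc k).ne' _).symm

end

section

variable {Q : ℝ → ℝ} {p q : ℝ}

theorem Eig.exists_alt_of_strictMono (hQ : Weight Q p q) {Λ : ℕ → ℝ} (hmono : StrictMono Λ)
    (hex : ∀ m, ∃ φ, Eig Q p q (Λ m) φ) (m : ℕ) : ∀ φ, Eig Q p q (Λ m) φ →
    ∃ σ, Alt (φ 0) q (m + 1) p σ := by
  induction m with
  | zero => exact fun φ h => h.exists_alt hQ
  | succ m ih =>
    intro φ h
    obtain ⟨ψ, hψ⟩ := hex m
    obtain ⟨σ, hσ⟩ := ih ψ hψ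
    exact hψ.alt_succ_of_lt hQ h (hmono m.lt_succ_self) hσ

theorem Eig.energy_proportional (hQ : Weight Q p q) {lam : ℝ} {φ X : Jet} (h : Eig Q p q lam φ)
    (hX : Eig Q p q lam X) : energy p q X φ ≠ 0 := by
  obtain ⟨c, hc, heq⟩ := h.proportional hQ hX
  have e0 := (hX.pre.adm.smul_add h.pre.adm 1 (-c))
  have e2 := deriv_eq_zero_on hQ.lt e0.d1 (deriv_eq_zero_on hQ.lt e0.d0 fun x hx => by
    simp [heq x hx])
  have : energy p q X φ = c * energy p q φ φ := by
    rw [energy, energy, ← intervalIntegral.integral_const_mul]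
    refine intervalIntegral.integral_congr fun x hx => ?_
    rw [uIcc_of_le hQ.lt.le] at hx
    have := e2 x hx
    simp at this
    rw [← mul_assoc]
    congr 1
    linarith
  rw [this]
  exact mul_ne_zero hc (h.energy_pos hQ).ne'

/-- The `m`-th eigenfunction alternates exactly `m + 1` times. -/
theorem Eig.exists_alt_iff (hQ : Weight Q p q) {Λ : ℕ → ℝ} (hmono : StrictMono Λ)
    (hrange : range Λ = {lam | ∃ φ, Eig Q p q lam φ}) {m : ℕ} {φ : Jet}
    (hφ : Eig Q p q (Λ m) φ) {n : ℕ} : (∃ σ, Alt (φ 0) q n p σ) ↔ n ≤ m + 1 := by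
  have hex : ∀ m, ∃ φ, Eig Q p q (Λ m) φ := fun m => hrange.subset ⟨m, rfl⟩
  have hlow := Eig.exists_alt_of_strictMono hQ hmono hex
  refine ⟨?_, fun hn => (hlow m φ hφ).imp fun σ h => h.of_le hn⟩
  rintro ⟨σ, hσ⟩
  choose ψ hψ using hex
  obtain ⟨mu, X, hX, horth, hcount⟩ := exists_eig_orthogonal hQ
    (fun i : Fin m => hψ i)
  obtain ⟨l, rfl⟩ : mu ∈ range Λ := hrange ▸ ⟨X, hX⟩
  rcases lt_trichotomy l m with h | rfl | h
  · exact absurd (horth ⟨l, h⟩) ((hψ l).energy_proportional hQ hX)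
  · obtain ⟨c, hc, heq⟩ := hφ.proportional hQ hX
    exact hcount n _ (hσ.smul hc fun x h1 h2 => heq x ⟨h1.le, h2.le⟩)
  · obtain ⟨τ, hτ⟩ := hlow l X hX
    have := hcount _ _ hτ
    omega

end

/-- Extension of a function on `[0,1]` by constants. -/
noncomputable def clampExt (P : ℝ → ℝ) (x : ℝ) : ℝ := P (max 0 (min 1 x))

theorem clampExt_of_mem {P : ℝ → ℝ} {x : ℝ} (hx : x ∈ Icc (0 : ℝ) 1) : clampExt P x = P x := by
  rw [clampExt, min_eq_right hx.2, max_eq_right hx.1]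

theorem clampExt_of_nonpos {P : ℝ → ℝ} {x : ℝ} (hx : x ≤ 0) : clampExt P x = P 0 := by
  rw [clampExt, max_eq_left ((min_le_right 1 x).trans hx)]

theorem clampExt_of_one_le {P : ℝ → ℝ} {x : ℝ} (hx : 1 ≤ x) : clampExt P x = P 1 := by
  rw [clampExt, min_eq_left hx, max_eq_right zero_le_one]

theorem continuous_clampExt {P : ℝ → ℝ} (hc : ContinuousOn P (Icc 0 1)) :
    Continuous (clampExt P) :=
  hc.comp_continuous (by fun_prop) fun x =>
    ⟨le_max_left _ _, max_le zero_le_one (min_le_left _ _)⟩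

theorem monotone_clampExt {P : ℝ → ℝ} (hm : MonotoneOn P (Icc 0 1)) : Monotone (clampExt P) :=
  fun x y hxy => hm ⟨le_max_left _ _, max_le zero_le_one (min_le_left _ _)⟩
    ⟨le_max_left _ _, max_le zero_le_one (min_le_left _ _)⟩ (by gcongr)

theorem weight_clampExt {P : ℝ → ℝ} (hc : ContinuousOn P (Icc 0 1)) (hm : MonotoneOn P (Icc 0 1))
    (h01 : P 0 < P 1) {h : ℝ} (hh : 0 ≤ h) : Weight (clampExt P) (-h) (1 + h) where
  lt := by linarith
  cont := continuous_clampExt hc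
  mono := monotone_clampExt hm
  left x hx := by rw [clampExt_of_nonpos (by linarith), clampExt_of_nonpos (by linarith)]
  right x hx := by rw [clampExt_of_one_le (by linarith), clampExt_of_one_le (by linarith)]
  jump := by rwa [clampExt_of_nonpos (by linarith), clampExt_of_one_le (by linarith)]

theorem eqOn_of_hasDerivWithinAt {f g f' : ℝ → ℝ} {a b c : ℝ} (hc : c ∈ Icc a b)
    (hf : ∀ x ∈ Icc a b, HasDerivWithinAt f (f' x) (Icc a b) x)
    (hg : ∀ x ∈ Icc a b, HasDerivWithinAt g (f' x) (Icc a b) x) (h : f c = g c) :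
    ∀ x ∈ Icc a b, f x = g x := by
  intro x hx
  have := (convex_Icc a b).norm_image_sub_le_of_norm_hasDerivWithin_le (f := fun t => f t - g t)
    (f' := fun _ => 0) (C := 0) (fun y hy => by
      have := (hf y hy).sub (hg y hy)
      rwa [sub_self] at this) (by simp) hc hx
  rw [zero_mul, norm_le_zero_iff, h, sub_self, sub_zero, sub_eq_zero] at this
  exact this

theorem cubic_of_const {φ : Jet} (d0 : ∀ x, HasDerivAt (φ 0) (φ 1 x) x)
    (d1 : ∀ x, HasDerivAt (φ 1) (φ 2 x) x) (d2 : ∀ x, HasDerivAt (φ 2) (φ 3 x) x) {a b c : ℝ}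
    (hc : c ∈ Icc a b) (h3 : ∀ x ∈ Icc a b, φ 3 x = φ 3 c) : ∀ x ∈ Icc a b,
      φ 2 x = φ 2 c + φ 3 c * (x - c) ∧
      φ 0 x = φ 0 c + φ 1 c * (x - c) + φ 2 c * (x - c) ^ 2 / 2 + φ 3 c * (x - c) ^ 3 / 6 := by
  have hX : ∀ x, HasDerivAt (fun t => t - c) 1 x := fun x => (hasDerivAt_id x).sub_const c
  have e2 := eqOn_of_hasDerivWithinAt (f := φ 2) (g := fun x => φ 2 c + φ 3 c * (x - c)) hc
    (fun x _ => (d2 x).hasDerivWithinAt)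
    (fun x hx => by
      rw [h3 x hx]
      simpa using (((hX x).const_mul (φ 3 c)).const_add (φ 2 c)).hasDerivWithinAt) (by simp)
  have e1 := eqOn_of_hasDerivWithinAt (f := φ 1)
    (g := fun x => φ 1 c + φ 2 c * (x - c) + φ 3 c * (x - c) ^ 2 / 2) hc
    (fun x _ => (d1 x).hasDerivWithinAt)
    (fun x hx => by
      rw [e2 x hx]
      refine HasDerivAt.hasDerivWithinAt (((((hX x).const_mul (φ 2 c)).const_add (φ 1 c)).add
        ((((hX x).pow 2).const_mul (φ 3 c)).div_const 2)).congr_fun_deriv (fun t => by simp) ?_)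
      simp
      ring) (by simp)
  have e0 := eqOn_of_hasDerivWithinAt (f := φ 0)
    (g := fun x => φ 0 c + φ 1 c * (x - c) + φ 2 c * (x - c) ^ 2 / 2 + φ 3 c * (x - c) ^ 3 / 6) hc
    (fun x _ => (d0 x).hasDerivWithinAt)
    (fun x hx => by
      rw [e1 x hx]
      refine HasDerivAt.hasDerivWithinAt ((((((hX x).const_mul (φ 1 c)).const_add (φ 0 c)).add
        ((((hX x).pow 2).const_mul (φ 2 c)).div_const 2)).add
        ((((hX x).pow 3).const_mul (φ 3 c)).div_const 6)).congr_fun_deriv (fun t => by simp) ?_)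
      simp
      ring) (by simp)
  exact fun x hx => ⟨e2 x hx, e0 x hx⟩

theorem bc_left_iff {d y0 y1 y2 y3 : ℝ} (hd : 0 < d) :
    (y2 + 12 / d ^ 2 * y0 - 6 / d * y1 = 0 ∧ -(6 / d) * y3 + 12 / d ^ 2 * y2 = 0) ↔
    (y0 + y1 * (-(d / 2)) + y2 * (-(d / 2)) ^ 2 / 2 + y3 * (-(d / 2)) ^ 3 / 6 = 0 ∧
      y2 + y3 * (-(d / 2)) = 0) := by
  have hd0 := hd.ne'
  have e2 : -(6 / d) * y3 + 12 / d ^ 2 * y2 = 12 / d ^ 2 * (y2 + y3 * (-(d / 2))) := by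
    field_simp
    ring
  have e1 : y0 + y1 * (-(d / 2)) + y2 * (-(d / 2)) ^ 2 / 2 + y3 * (-(d / 2)) ^ 3 / 6 =
      d ^ 2 / 12 * (y2 + 12 / d ^ 2 * y0 - 6 / d * y1) + d ^ 2 / 24 * (y2 + y3 * (-(d / 2))) := by
    field_simp
    ring
  rw [e2, e1]
  have h1 : (12 : ℝ) / d ^ 2 ≠ 0 := by positivity
  have h2 : d ^ 2 / 12 ≠ 0 := by positivity
  constructor
  · rintro ⟨h, h'⟩
    have := (mul_eq_zero.1 h').resolve_left h1
    rw [h, this]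
    simp
  · rintro ⟨h, h'⟩
    rw [h'] at h ⊢
    simp only [mul_zero, add_zero] at h ⊢
    exact ⟨(mul_eq_zero.1 h).resolve_left h2, trivial⟩

theorem hasDerivAt_of_pieces {f f' : ℝ → ℝ} {a b : ℝ} (hab : a < b)
    (h1 : ∀ x ≤ a, HasDerivWithinAt f (f' x) (Iic a) x)
    (h2 : ∀ x ∈ Icc a b, HasDerivWithinAt f (f' x) (Icc a b) x)
    (h3 : ∀ x, b ≤ x → HasDerivWithinAt f (f' x) (Ici b) x) (x : ℝ) : HasDerivAt f (f' x) x := by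
  rcases lt_trichotomy x a with h | rfl | h
  · exact (h1 x h.le).hasDerivAt (Iic_mem_nhds h)
  · refine ((h1 x le_rfl).union (h2 x ⟨le_rfl, hab.le⟩)).hasDerivAt ?_
    rw [Iic_union_Icc_eq_Iic hab.le]
    exact Iic_mem_nhds hab
  · rcases lt_trichotomy x b with h' | rfl | h'
    · exact (h2 x ⟨h.le, h'.le⟩).hasDerivAt (Icc_mem_nhds h h')
    · refine ((h2 x ⟨hab.le, le_rfl⟩).union (h3 x le_rfl)).hasDerivAt ?_
      rw [Icc_union_Ici_eq_Ici hab.le]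
      exact Ici_mem_nhds hab
    · exact (h3 x h'.le).hasDerivAt (Ici_mem_nhds h')

theorem Y2_eq (y : ℝ → ℝ) : Y2 y = derivWithin (Y1 y) (Icc 0 1) := by
  rw [Y2, Y1, iteratedDerivWithin_succ, iteratedDerivWithin_one]

theorem Y3_eq (y : ℝ → ℝ) : Y3 y = derivWithin (Y2 y) (Icc 0 1) := by
  rw [Y3, Y2, iteratedDerivWithin_succ]

theorem Y_eq_of_hasDerivAt {φ : Jet} (d0 : ∀ x, HasDerivAt (φ 0) (φ 1 x) x)
    (d1 : ∀ x, HasDerivAt (φ 1) (φ 2 x) x) (d2 : ∀ x, HasDerivAt (φ 2) (φ 3 x) x) :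
    (∀ x ∈ Icc (0 : ℝ) 1, Y1 (φ 0) x = φ 1 x) ∧ (∀ x ∈ Icc (0 : ℝ) 1, Y2 (φ 0) x = φ 2 x) ∧
      ∀ x ∈ Icc (0 : ℝ) 1, Y3 (φ 0) x = φ 3 x := by
  have hu := uniqueDiffOn_Icc (zero_lt_one (α := ℝ))
  have e1 : ∀ x ∈ Icc (0 : ℝ) 1, Y1 (φ 0) x = φ 1 x := fun x hx =>
    (d0 x).hasDerivWithinAt.derivWithin (hu x hx)
  have e2 : ∀ x ∈ Icc (0 : ℝ) 1, Y2 (φ 0) x = φ 2 x := fun x hx => by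
    rw [Y2_eq, derivWithin_congr e1 (e1 x hx)]
    exact (d1 x).hasDerivWithinAt.derivWithin (hu x hx)
  refine ⟨e1, e2, fun x hx => ?_⟩
  rw [Y3_eq, derivWithin_congr e2 (e2 x hx)]
  exact (d2 x).hasDerivWithinAt.derivWithin (hu x hx)

theorem contDiff_three {φ : Jet} (d0 : ∀ x, HasDerivAt (φ 0) (φ 1 x) x)
    (d1 : ∀ x, HasDerivAt (φ 1) (φ 2 x) x) (d2 : ∀ x, HasDerivAt (φ 2) (φ 3 x) x)
    (c3 : Continuous (φ 3)) : ContDiff ℝ 3 (φ 0) := by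
  have step : ∀ {f g : ℝ → ℝ} {n : ℕ}, (∀ x, HasDerivAt f (g x) x) → ContDiff ℝ n g →
      ContDiff ℝ (n + 1) f := fun {f g n} h hg => by
    rw [contDiff_succ_iff_deriv]
    refine ⟨fun x => (h x).differentiableAt, by simp, ?_⟩
    rwa [show deriv f = g from funext fun x => (h x).deriv]
  have h3 : ContDiff ℝ ((0 : ℕ) : WithTop ℕ∞) (φ 3) := contDiff_zero.2 c3
  have h2 : ContDiff ℝ ((1 : ℕ) : WithTop ℕ∞) (φ 2) := by simpa using step d2 h3
  have h1 : ContDiff ℝ ((2 : ℕ) : WithTop ℕ∞) (φ 1) := by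
    have := step d1 h2
    norm_cast at this
  have h0 := step d0 h1
  norm_cast at h0

/-- A `C³` function on `[0,1]` extended by its cubic Taylor polynomials at the ends. -/
theorem exists_jet_of_contDiffOn {y : ℝ → ℝ} (h : ContDiffOn ℝ 3 y (Icc 0 1)) : ∃ φ : Jet,
    (∀ x, HasDerivAt (φ 0) (φ 1 x) x) ∧ (∀ x, HasDerivAt (φ 1) (φ 2 x) x) ∧
    (∀ x, HasDerivAt (φ 2) (φ 3 x) x) ∧ (∀ x ∈ Icc (0 : ℝ) 1, φ 0 x = y x) ∧
    (∀ x ≤ 0, φ 3 x = φ 3 0) ∧ (∀ x, 1 ≤ x → φ 3 x = φ 3 1) := by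
  have hu := uniqueDiffOn_Icc (zero_lt_one (α := ℝ))
  have h0 : (0 : ℝ) ∈ Icc (0 : ℝ) 1 := ⟨le_rfl, zero_le_one⟩
  have w0 : ∀ x ∈ Icc (0 : ℝ) 1, HasDerivWithinAt y (Y1 y x) (Icc 0 1) x := fun x hx =>
    ((h.differentiableOn (by norm_num)) x hx).hasDerivWithinAt
  have w1 : ∀ x ∈ Icc (0 : ℝ) 1, HasDerivWithinAt (Y1 y) (Y2 y x) (Icc 0 1) x := fun x hx => by
    rw [Y2_eq]
    have := h.differentiableOn_iteratedDerivWithin (m := 1) (by norm_num) hu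
    rw [iteratedDerivWithin_one] at this
    exact (this x hx).hasDerivWithinAt
  have w2 : ∀ x ∈ Icc (0 : ℝ) 1, HasDerivWithinAt (Y2 y) (Y3 y x) (Icc 0 1) x := fun x hx => by
    rw [Y3_eq]
    have := h.differentiableOn_iteratedDerivWithin (m := 2) (by norm_num) hu
    exact (this x hx).hasDerivWithinAt
  have hc3 : Continuous (clampExt (Y3 y)) :=
    continuous_clampExt (h.continuousOn_iteratedDerivWithin (m := 3) (by norm_num) hu)
  have prim : ∀ (f : ℝ → ℝ) (c : ℝ), Continuous f →
      ∃ F : ℝ → ℝ, F 0 = c ∧ ∀ x, HasDerivAt F (f x) x := fun f c hf =>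
    ⟨fun x => c + ∫ t in (0 : ℝ)..x, f t, by simp, fun x =>
      (hf.integral_hasStrictDerivAt 0 x).hasDerivAt.const_add c⟩
  obtain ⟨f2, i2, d2⟩ := prim _ (Y2 y 0) hc3
  obtain ⟨f1, i1, d1⟩ := prim _ (Y1 y 0) (continuous_of_hasDerivAt d2)
  obtain ⟨f0, i0, d0⟩ := prim _ (y 0) (continuous_of_hasDerivAt d1)
  have e2 := eqOn_of_hasDerivWithinAt h0 (fun x _ => (d2 x).hasDerivWithinAt)
    (fun x hx => by rw [clampExt_of_mem hx]; exact w2 x hx) i2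
  have e1 := eqOn_of_hasDerivWithinAt h0 (fun x _ => (d1 x).hasDerivWithinAt)
    (fun x hx => by rw [e2 x hx]; exact w1 x hx) i1
  have e0 := eqOn_of_hasDerivWithinAt h0 (fun x _ => (d0 x).hasDerivWithinAt)
    (fun x hx => by rw [e1 x hx]; exact w0 x hx) i0
  refine ⟨![f0, f1, f2, clampExt (Y3 y)], d0, d1, d2, e0, fun x hx => ?_, fun x hx => ?_⟩
  · change clampExt (Y3 y) x = clampExt (Y3 y) 0
    rw [clampExt_of_nonpos hx, clampExt_of_nonpos le_rfl]
  · change clampExt (Y3 y) x = clampExt (Y3 y) 1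
    rw [clampExt_of_one_le hx, clampExt_of_one_le le_rfl]

theorem bc_iff_hinged {φ : Jet} (d0 : ∀ x, HasDerivAt (φ 0) (φ 1 x) x)
    (d1 : ∀ x, HasDerivAt (φ 1) (φ 2 x) x) (d2 : ∀ x, HasDerivAt (φ 2) (φ 3 x) x)
    (hl : ∀ x ≤ 0, φ 3 x = φ 3 0) (hr : ∀ x, 1 ≤ x → φ 3 x = φ 3 1) {d : ℝ} (hd : 0 < d) :
    BC (12 / d ^ 2) (6 / d) (φ 0) ↔ (φ 0 (-(d / 2)) = 0 ∧ φ 2 (-(d / 2)) = 0) ∧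
      (φ 0 (1 + d / 2) = 0 ∧ φ 2 (1 + d / 2) = 0) := by
  obtain ⟨e1, e2, e3⟩ := Y_eq_of_hasDerivAt d0 d1 d2
  have h0 : (0 : ℝ) ∈ Icc (0 : ℝ) 1 := ⟨le_rfl, zero_le_one⟩
  have h1 : (1 : ℝ) ∈ Icc (0 : ℝ) 1 := ⟨zero_le_one, le_rfl⟩
  obtain ⟨l2, l0⟩ := cubic_of_const d0 d1 d2 (a := -(d / 2)) (b := 0) (c := 0)
    ⟨by linarith, le_rfl⟩ (fun x hx => hl x hx.2) (-(d / 2)) ⟨le_rfl, by linarith⟩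
  obtain ⟨r2, r0⟩ := cubic_of_const d0 d1 d2 (a := 1) (b := 1 + d / 2) (c := 1)
    ⟨le_rfl, by linarith⟩ (fun x hx => hr x hx.1) (1 + d / 2) ⟨by linarith, le_rfl⟩
  have L := bc_left_iff (y0 := φ 0 0) (y1 := φ 1 0) (y2 := φ 2 0) (y3 := φ 3 0) hd
  have R := bc_left_iff (y0 := φ 0 1) (y1 := -φ 1 1) (y2 := φ 2 1) (y3 := -φ 3 1) hd
  rw [sub_zero] at l2 l0
  rw [add_sub_cancel_left] at r2 r0
  rw [l0, l2, r0, r2, ← L, BC, e1 0 h0, e2 0 h0, e3 0 h0, e1 1 h1, e2 1 h1, e3 1 h1, and_assoc]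
  refine and_congr_right fun _ => and_congr_right fun _ => ?_
  convert R using 2
  · ring_nf
  · rw [← neg_eq_zero]
    ring_nf
  · ring_nf
  · ring_nf

theorem const_third_of_const_weight {Q : ℝ → ℝ} {φ : Jet} {lam a b C : ℝ}
    (d0 : ∀ x, HasDerivAt (φ 0) (φ 1 x) x)
    (d3 : ∀ x, HasDerivAt (fun t => φ 3 t - Q t * (lam * φ 0 t)) (-(Q x * (lam * φ 1 x))) x)
    (hQ : ∀ x ∈ Icc a b, Q x = C) {c : ℝ} (hc : c ∈ Icc a b) : ∀ x ∈ Icc a b, φ 3 x = φ 3 c := by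
  have := eqOn_of_hasDerivWithinAt (f := fun t => φ 3 t - Q t * (lam * φ 0 t))
    (g := fun t => φ 3 c - C * (lam * φ 0 t)) hc (fun x _ => (d3 x).hasDerivWithinAt)
    (fun x hx => by
      rw [hQ x hx]
      exact ((((d0 x).const_mul lam).const_mul C).const_sub (φ 3 c)).hasDerivWithinAt)
    (by simp only [hQ c hc])
  intro x hx
  have h := this x hx
  simp only [hQ x hx] at h
  linarith

/-- The boundary conditions say that the cubic extensions are hinged at distance `d / 2`. -/
theorem isEigenvalue_iff {P : ℝ → ℝ} (hP : ContinuousOn P (Icc 0 1)) {d lam : ℝ} (hd : 0 < d) :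
    IsEigenvalue P (12 / d ^ 2) (6 / d) lam ↔
      ∃ φ, Eig (clampExt P) (-(d / 2)) (1 + d / 2) lam φ := by
  constructor
  · rintro ⟨y, ⟨x, hx, hne⟩, ⟨hy, hsol⟩, hbc⟩
    obtain ⟨φ, d0, d1, d2, e0, hl, hr⟩ := exists_jet_of_contDiffOn hy
    obtain ⟨y1, y2, y3⟩ := Y_eq_of_hasDerivAt d0 d1 d2
    have Y1e : ∀ x ∈ Icc (0 : ℝ) 1, Y1 y x = Y1 (φ 0) x := fun x hx =>
      (derivWithin_congr e0 (e0 x hx)).symm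
    have Y2e : ∀ x ∈ Icc (0 : ℝ) 1, Y2 y x = Y2 (φ 0) x := fun x hx => by
      rw [Y2_eq, Y2_eq, derivWithin_congr Y1e (Y1e x hx)]
    have Y3e : ∀ x ∈ Icc (0 : ℝ) 1, Y3 y x = Y3 (φ 0) x := fun x hx => by
      rw [Y3_eq, Y3_eq, derivWithin_congr Y2e (Y2e x hx)]
    have h0 : (0 : ℝ) ∈ Icc (0 : ℝ) 1 := ⟨le_rfl, zero_le_one⟩
    have h1 : (1 : ℝ) ∈ Icc (0 : ℝ) 1 := ⟨zero_le_one, le_rfl⟩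
    have hbc' : BC (12 / d ^ 2) (6 / d) (φ 0) := by
      simp only [BC, Y1e 0 h0, Y2e 0 h0, Y3e 0 h0, Y1e 1 h1, Y2e 1 h1, Y3e 1 h1, ← e0 0 h0,
        ← e0 1 h1] at hbc
      exact hbc
    obtain ⟨⟨l0, l2⟩, r0, r2⟩ := (bc_iff_hinged d0 d1 d2 hl hr hd).1 hbc'
    refine ⟨φ, ⟨d0, d1, d2, fun x => ?_, l0, r0, l2, r2⟩, x, ⟨by linarith [hx.1], by
      linarith [hx.2]⟩, by rwa [e0 x hx]⟩
    have outer : ∀ (s : Set ℝ) (C D x : ℝ), (∀ t ∈ s, clampExt P t = C) → (∀ t ∈ s, φ 3 t = D) →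
        x ∈ s → HasDerivWithinAt (fun t => φ 3 t - clampExt P t * (lam • φ) 0 t)
          (-(clampExt P x * (lam • φ) 1 x)) s x := fun s C D x hC hD hx => by
      rw [hC x hx]
      refine ((((d0 x).const_mul lam).const_mul C).const_sub D).hasDerivWithinAt.congr
        (fun t ht => ?_) ?_
      · rw [hC t ht, hD t ht]
        rfl
      · rw [hC x hx, hD x hx]
        rfl
    refine hasDerivAt_of_pieces (f' := fun x => -(clampExt P x * (lam • φ) 1 x))
      (zero_lt_one (α := ℝ)) (fun x hx => outer (Iic 0) (P 0) (φ 3 0) x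
      (fun t ht => clampExt_of_nonpos ht) (fun t ht => hl t ht) hx) (fun x hx => ?_)
      (fun x hx => outer (Ici 1) (P 1) (φ 3 1) x
      (fun t ht => clampExt_of_one_le ht) (fun t ht => hr t ht) hx) x
    have e : ∀ t ∈ Icc (0 : ℝ) 1, φ 3 t - clampExt P t * (lam • φ) 0 t = Y3 y t - lam * P t * y t :=
      fun t ht => by
        rw [clampExt_of_mem ht, Y3e t ht, y3 t ht, ← e0 t ht]
        simp
        ring
    have e' : -(clampExt P x * (lam • φ) 1 x) = -(lam * P x * Y1 y x) := by
      rw [clampExt_of_mem hx, Y1e x hx, y1 x hx]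
      simp
      ring
    rw [e']
    exact (hsol x hx).congr e (e x hx)
  · rintro ⟨φ, ⟨d0, d1, d2, d3, l0, r0, l2, r2⟩, hne⟩
    obtain ⟨y1, y2, y3⟩ := Y_eq_of_hasDerivAt d0 d1 d2
    have hl : ∀ x ≤ 0, φ 3 x = φ 3 0 := fun x hx =>
      const_third_of_const_weight d0 d3 (a := x) (b := 0) (fun t ht => clampExt_of_nonpos ht.2)
        ⟨hx, le_rfl⟩ x ⟨le_rfl, hx⟩
    have hr : ∀ x, 1 ≤ x → φ 3 x = φ 3 1 := fun x hx =>
      const_third_of_const_weight d0 d3 (a := 1) (b := x) (fun t ht => clampExt_of_one_le ht.1)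
        ⟨le_rfl, hx⟩ x ⟨hx, le_rfl⟩
    have hC1 : IsC1 (lam • φ) := IsC1.smul ⟨d0, continuous_of_hasDerivAt d1⟩ lam
    refine ⟨φ 0, ?_, ⟨(contDiff_three d0 d1 d2 (Pre.cont3 (continuous_clampExt hP) hC1
      ⟨d0, d1, d2, d3, l0, r0, l2, r2⟩)).contDiffOn, fun x hx => ?_⟩,
      (bc_iff_hinged d0 d1 d2 hl hr hd).2 ⟨⟨l0, l2⟩, r0, r2⟩⟩
    · by_contra hcon
      have z0 : ∀ x ∈ Icc (0 : ℝ) 1, φ 0 x = 0 := fun x hx => by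
        by_contra h
        exact hcon ⟨x, hx, h⟩
      have z1 := deriv_eq_zero_on zero_lt_one d0 z0
      have z2 := deriv_eq_zero_on zero_lt_one d1 z1
      have z3 := deriv_eq_zero_on zero_lt_one d2 z2
      have h0 : (0 : ℝ) ∈ Icc (0 : ℝ) 1 := ⟨le_rfl, zero_le_one⟩
      have h1 : (1 : ℝ) ∈ Icc (0 : ℝ) 1 := ⟨zero_le_one, le_rfl⟩
      obtain ⟨x, hx, hx0⟩ := hne
      apply hx0
      rcases le_total x 0 with h | h
      · rw [(cubic_of_const d0 d1 d2 (a := x) (b := 0) (c := 0) ⟨h, le_rfl⟩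
          (fun t ht => hl t ht.2) x ⟨le_rfl, h⟩).2, z0 0 h0, z1 0 h0, z2 0 h0, z3 0 h0]
        simp
      · rcases le_total x 1 with h' | h'
        · exact z0 x ⟨h, h'⟩
        · rw [(cubic_of_const d0 d1 d2 (a := 1) (b := x) (c := 1) ⟨le_rfl, h'⟩
            (fun t ht => hr t ht.1) x ⟨h', le_rfl⟩).2, z0 1 h1, z1 1 h1, z2 1 h1, z3 1 h1]
          simp
    · have e : ∀ t ∈ Icc (0 : ℝ) 1,
          Y3 (φ 0) t - lam * P t * φ 0 t = φ 3 t - clampExt P t * (lam • φ) 0 t := fun t ht => by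
        rw [clampExt_of_mem ht, y3 t ht]
        simp
        ring
      have e' : -(lam * P x * Y1 (φ 0) x) = -(clampExt P x * (lam • φ) 1 x) := by
        rw [clampExt_of_mem hx, y1 x hx]
        simp
        ring
      rw [e']
      exact (d3 x).hasDerivWithinAt.congr e (e x hx)

/-- A continuous function, equal to `0` left of `0` and to `1` right of `1`, self-similar of
Cantor type with `κ` cells of length `a` separated by gaps of length `b`. -/
structure CantorExt (Q : ℝ → ℝ) (κ : ℕ) (a b : ℝ) : Prop where
  cont : Continuous Q
  two_le : 2 ≤ κ
  ha : 0 < a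
  hb : 0 < b
  sum : (κ : ℝ) * (a + b) = 1 + b
  left : ∀ x ≤ 0, Q x = 0
  right : ∀ x, 1 ≤ x → Q x = 1
  step : ∀ k < κ, ∀ t, -(b / a) ≤ t → t ≤ 1 + b / a → Q (k * (a + b) + a * t) = (k + Q t) / κ

theorem CantorSelfSimilar.sum_eq {P : ℝ → ℝ} {κ : ℕ} {a : ℝ} (h : CantorSelfSimilar P κ a) :
    0 < bb κ a ∧ (κ : ℝ) * (a + bb κ a) = 1 + bb κ a := by
  obtain ⟨-, -, -, -, hκ, ha, ha', -⟩ := h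
  have hκ' : (2 : ℝ) ≤ κ := by exact_mod_cast hκ
  have h1 : 0 < (κ : ℝ) - 1 := by linarith
  rw [lt_div_iff₀ (by linarith)] at ha'
  refine ⟨div_pos (by linarith) h1, ?_⟩
  rw [bb]
  field_simp
  ring

theorem eq_left_of_const_Ioo {P : ℝ → ℝ} {l r : ℝ} (hlr : l < r) (hc : ContinuousOn P (Icc l r))
    (h : ∀ x ∈ Ioo l r, ∀ x' ∈ Ioo l r, P x = P x') : ∀ x ∈ Icc l r, P x = P l := by
  obtain ⟨m, hm⟩ : (Ioo l r).Nonempty := nonempty_Ioo.2 hlr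
  have key : EqOn P (fun _ => P m) (Icc l r) := by
    rw [← closure_Ioo hlr.ne]
    refine EqOn.of_subset_closure (s := Ioo l r) (fun x hx => h x hx m hm) ?_
      continuousOn_const subset_closure subset_rfl
    rwa [closure_Ioo hlr.ne]
  intro x hx
  rw [key hx, key ⟨le_rfl, hlr.le⟩]

theorem CantorSelfSimilar.cantorExt {P : ℝ → ℝ} {κ : ℕ} {a : ℝ} (h : CantorSelfSimilar P κ a) :
    CantorExt (clampExt P) κ a (bb κ a) := by
  obtain ⟨hb, hsum⟩ := h.sum_eq
  obtain ⟨hc, -, h0, h1, hκ, ha, -, hself, hgap⟩ := h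
  generalize bb κ a = b at *
  have hκ0 : (0 : ℝ) < κ := by exact_mod_cast (by omega : 0 < κ)
  have hle : ∀ k : ℕ, k < κ → (k : ℝ) * (a + b) + a ≤ 1 := fun k hk => by
    have : (k : ℝ) + 1 ≤ κ := by exact_mod_cast hk
    nlinarith
  have hgap' : ∀ k : ℕ, k + 1 < κ → ∀ x ∈ Icc ((k : ℝ) * (a + b) + a) ((k + 1 : ℕ) * (a + b)),
      P x = P (k * (a + b) + a) := fun k hk => by
    have e : ((k + 1 : ℕ) : ℝ) * (a + b) - b = k * (a + b) + a := by push_cast; ring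
    have := hgap (k + 1) (by omega) hk
    rw [e] at this
    refine eq_left_of_const_Ioo (by linarith) (hc.mono (Icc_subset_Icc (by positivity) ?_)) this
    linarith [hle _ hk]
  have cell : ∀ k : ℕ, k < κ → ∀ x ∈ Icc (0 : ℝ) 1, P (k * (a + b) + a * x) = (k + P x) / κ := by
    intro k
    induction k with
    | zero =>
      intro hk x hx
      obtain ⟨c, hcc⟩ := hself 0 hk
      have := hcc 0 ⟨le_rfl, zero_le_one⟩
      simp only [Nat.cast_zero, zero_mul, mul_zero, add_zero, h0] at this
      rw [eq_div_iff hκ0.ne', mul_comm, hcc x hx]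
      push_cast
      linarith
    | succ k ih =>
      intro hk x hx
      obtain ⟨c, hcc⟩ := hself (k + 1) hk
      have e0 := hcc 0 ⟨le_rfl, zero_le_one⟩
      have e1 := ih (by omega) 1 ⟨zero_le_one, le_rfl⟩
      have e2 := hgap' k hk ((k + 1 : ℕ) * (a + b)) ⟨by push_cast; linarith, le_rfl⟩
      rw [mul_one, h1] at e1
      rw [mul_zero, add_zero, h0, e2, e1, mul_div_cancel₀ _ hκ0.ne'] at e0
      rw [eq_div_iff hκ0.ne', mul_comm, hcc x hx]
      push_cast
      linarith
  refine ⟨continuous_clampExt hc, hκ, ha, hb, hsum, fun x hx => by rw [clampExt_of_nonpos hx, h0],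
    fun x hx => by rw [clampExt_of_one_le hx, h1], fun k hk t ht1 ht2 => ?_⟩
  have hmul : a * (b / a) = b := by field_simp
  have hl : -b ≤ a * t := by nlinarith
  have hr : a * t ≤ a + b := by nlinarith
  have hkab : 0 ≤ (k : ℝ) * (a + b) := by positivity
  have hle1 := hle k hk
  rcases le_total t 0 with h | h
  · rw [clampExt_of_nonpos h, h0]
    have hat : a * t ≤ 0 := mul_nonpos_of_nonneg_of_nonpos ha.le h
    rcases k with _ | k
    · rw [clampExt_of_nonpos (by simpa using hat), h0]
      simp
    · have e1 := cell k (by omega) 1 ⟨zero_le_one, le_rfl⟩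
      have e2 := hgap' k hk ((k + 1 : ℕ) * (a + b) + a * t) ⟨by push_cast; linarith, by linarith⟩
      rw [mul_one, h1] at e1
      rw [clampExt_of_mem ⟨by push_cast; nlinarith [show 0 ≤ (k : ℝ) * (a + b) by positivity],
        by linarith⟩, e2, e1]
      push_cast
      ring
  · rcases le_total t 1 with h' | h'
    · have hat : a * t ≤ a := by nlinarith
      have hat0 : 0 ≤ a * t := by positivity
      rw [clampExt_of_mem ⟨by positivity, by linarith⟩, clampExt_of_mem ⟨h, h'⟩,
        cell k hk t ⟨h, h'⟩]
    · have hat : a ≤ a * t := by nlinarith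
      rw [clampExt_of_one_le h', h1]
      by_cases hk' : k + 1 < κ
      · have e1 := cell k hk 1 ⟨zero_le_one, le_rfl⟩
        have e2 := hgap' k hk' (k * (a + b) + a * t) ⟨by linarith, by push_cast; linarith⟩
        have hle2 := hle _ hk'
        push_cast at hle2
        rw [mul_one, h1] at e1
        rw [clampExt_of_mem ⟨by positivity, by linarith⟩, e2, e1]
      · have e : (k : ℝ) + 1 = κ := by exact_mod_cast (by omega : k + 1 = κ)
        rw [clampExt_of_one_le (by nlinarith), h1, e, div_self hκ0.ne']

namespace CantorExt

variable {Q : ℝ → ℝ} {κ : ℕ} {a b : ℝ}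

theorem kappa_pos (h : CantorExt Q κ a b) : (0 : ℝ) < κ := by
  have := h.two_le
  exact_mod_cast (by omega : 0 < κ)

theorem exists_cell (h : CantorExt Q κ a b) {x : ℝ} (hx : x ∈ Icc (0 : ℝ) 1) :
    ∃ k < κ, ∃ t, 0 ≤ t ∧ t ≤ 1 + b / a ∧ x = k * (a + b) + a * t := by
  have ha := h.ha
  have hb := h.hb
  have hs : 0 < a + b := by linarith
  have hfl := Nat.floor_le (div_nonneg hx.1 hs.le)
  have hlt := Nat.lt_floor_add_one (x / (a + b))
  rw [le_div_iff₀ hs] at hfl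
  rw [div_lt_iff₀ hs] at hlt
  refine ⟨⌊x / (a + b)⌋₊, ?_, (x - ⌊x / (a + b)⌋₊ * (a + b)) / a, ?_, ?_, ?_⟩
  · rw [Nat.floor_lt (div_nonneg hx.1 hs.le), div_lt_iff₀ hs, h.sum]
    linarith [hx.2]
  · exact div_nonneg (by linarith) ha.le
  · rw [div_le_iff₀ ha, add_mul, div_mul_cancel₀ _ ha.ne']
    linarith
  · field_simp
    ring

/-- The function is symmetric about the point `(1/2, 1/2)`. -/
theorem symm (h : CantorExt Q κ a b) (x : ℝ) : Q (1 - x) = 1 - Q x := by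
  have hcont : Continuous fun x => |Q x + Q (1 - x) - 1| := by
    have := h.cont
    fun_prop
  have hout : ∀ x, x ∉ Icc (0 : ℝ) 1 → Q x + Q (1 - x) - 1 = 0 := fun x hx => by
    rw [mem_Icc, not_and_or, not_le, not_le] at hx
    rcases hx with hx | hx
    · rw [h.left x hx.le, h.right _ (by linarith)]
      ring
    · rw [h.right x hx.le, h.left _ (by linarith)]
      ring
  obtain ⟨x₀, hx₀, hmax⟩ := isCompact_Icc.exists_isMaxOn (nonempty_Icc.2 (zero_le_one (α := ℝ)))
    hcont.continuousOn
  have hall : ∀ y, |Q y + Q (1 - y) - 1| ≤ |Q x₀ + Q (1 - x₀) - 1| := fun y => by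
    by_cases hy : y ∈ Icc (0 : ℝ) 1
    · exact hmax hy
    · rw [hout y hy, abs_zero]
      exact abs_nonneg _
  obtain ⟨k, hk, t, ht0, ht1, e⟩ := h.exists_cell hx₀
  have hba : 0 ≤ b / a := (div_pos h.hb h.ha).le
  have hκ := h.kappa_pos
  have e' : 1 - x₀ = ((κ - 1 - k : ℕ) : ℝ) * (a + b) + a * (1 - t) := by
    rw [Nat.cast_sub (by omega), Nat.cast_sub (by omega), e]
    push_cast
    linarith [h.sum]
  have hD : Q x₀ + Q (1 - x₀) - 1 = (Q t + Q (1 - t) - 1) / κ := by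
    rw [e', e, h.step k hk t (by linarith) ht1, h.step _ (by omega) (1 - t) (by linarith)
      (by linarith), Nat.cast_sub (by omega), Nat.cast_sub (by omega)]
    field_simp
    push_cast
    ring
  have hle := hall t
  have h2 : (2 : ℝ) ≤ κ := by exact_mod_cast h.two_le
  have h3 : |Q t + Q (1 - t) - 1| = κ * |Q x₀ + Q (1 - x₀) - 1| := by
    rw [hD, abs_div, abs_of_pos hκ, mul_div_cancel₀ _ hκ.ne']
  have h4 : |Q x₀ + Q (1 - x₀) - 1| = 0 := by
    have := abs_nonneg (Q x₀ + Q (1 - x₀) - 1)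
    nlinarith
  have h5 := hall x
  rw [h4, abs_nonpos_iff] at h5
  linarith

end CantorExt

section

variable {Q : ℝ → ℝ} {d mu : ℝ} {ψ : Jet}

/-- The reflection of a jet about `1/2`. -/
def reflection (ψ : Jet) : Jet :=
  ![fun t => ψ 0 (1 - t), fun t => -ψ 1 (1 - t), fun t => ψ 2 (1 - t), fun t => -ψ 3 (1 - t)]

theorem HasDerivAt.comp_one_sub {f f' : ℝ → ℝ} (h : ∀ x, HasDerivAt f (f' x) x) (x : ℝ) :
    HasDerivAt (fun t => f (1 - t)) (-f' (1 - x)) x := by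
  have := (h (1 - x)).comp x ((hasDerivAt_id x).const_sub 1)
  simpa [Function.comp_def] using this

theorem Eig.reflect (hs : ∀ x, Q (1 - x) = 1 - Q x) (h : Eig Q (-(d / 2)) (1 + d / 2) mu ψ) :
    Eig Q (-(d / 2)) (1 + d / 2) mu (reflection ψ) := by
  have e1 : 1 - -(d / 2) = 1 + d / 2 := by ring
  have e2 : 1 - (1 + d / 2) = -(d / 2) := by ring
  obtain ⟨hp, x, hx, hne⟩ := h
  refine ⟨⟨?_, ?_, ?_, ?_, ?_, ?_, ?_, ?_⟩, 1 - x, ⟨by linarith [hx.2], by linarith [hx.1]⟩, ?_⟩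
  · exact HasDerivAt.comp_one_sub hp.d0
  · exact fun y => ((HasDerivAt.comp_one_sub hp.d1 y).neg).congr_fun_deriv (fun t => rfl)
      (neg_neg _).symm
  · exact HasDerivAt.comp_one_sub hp.d2
  · intro y
    refine (((HasDerivAt.comp_one_sub hp.d3 y).neg).sub
      ((HasDerivAt.comp_one_sub hp.d0 y).const_mul mu)).congr_fun_deriv (fun t => ?_) ?_
    · simp [reflection, hs]
      ring
    · simp [reflection, hs]
      ring
  · simpa [reflection, e1] using hp.right
  · simpa [reflection, e2] using hp.left
  · simpa [reflection, e1] using hp.right2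
  · simpa [reflection, e2] using hp.left2
  · simpa [reflection] using hne

/-- An eigenfunction takes opposite or equal boundary slopes. -/
theorem Eig.exists_sign (hQ : Weight Q (-(d / 2)) (1 + d / 2)) (hs : ∀ x, Q (1 - x) = 1 - Q x)
    (h : Eig Q (-(d / 2)) (1 + d / 2) mu ψ) : ∃ ε : ℝ, ε ^ 2 = 1 ∧
      ψ 1 (1 + d / 2) = ε * ψ 1 (-(d / 2)) ∧ ψ 3 (1 + d / 2) = ε * ψ 3 (-(d / 2)) := by
  obtain ⟨c, -, hc⟩ := h.proportional hQ (h.reflect hs)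
  have hR := (h.reflect hs).pre
  have e1 : 1 - -(d / 2) = 1 + d / 2 := by ring
  have e2 : 1 - (1 + d / 2) = -(d / 2) := by ring
  have z0 : ∀ x ∈ Icc (-(d / 2)) (1 + d / 2), reflection ψ 0 x - c * ψ 0 x = 0 :=
    fun x hx => by rw [hc x hx, sub_self]
  have z1 := deriv_eq_zero_on hQ.lt (fun x => (hR.d0 x).sub ((h.pre.d0 x).const_mul c)) z0
  have z2 := deriv_eq_zero_on hQ.lt (fun x => (hR.d1 x).sub ((h.pre.d1 x).const_mul c)) z1
  have z3 := deriv_eq_zero_on hQ.lt (fun x => (hR.d2 x).sub ((h.pre.d2 x).const_mul c)) z2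
  have hl : -(d / 2) ∈ Icc (-(d / 2)) (1 + d / 2) := left_mem_Icc.2 hQ.lt.le
  have hr : 1 + d / 2 ∈ Icc (-(d / 2)) (1 + d / 2) := right_mem_Icc.2 hQ.lt.le
  have l1 := z1 _ hl
  have r1 := z1 _ hr
  have l3 := z3 _ hl
  simp only [reflection, Matrix.cons_val, e1, e2] at l1 r1 l3
  refine ⟨-c, ?_, by linarith, by linarith⟩
  have hne := h.deriv_left_ne hQ
  have : (c ^ 2 - 1) * ψ 1 (-(d / 2)) = 0 := by linear_combination r1 - c * l1
  rcases mul_eq_zero.1 this with h0 | h0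
  · linear_combination h0
  · exact absurd h0 hne

theorem HasDerivAt.sub_shift {f f' : ℝ → ℝ} (h : ∀ x, HasDerivAt f (f' x) x) (ε T x : ℝ) :
    HasDerivAt (fun t => f t - ε * f (t - T)) (f' x - ε * f' (x - T)) x := by
  have := (h (x - T)).comp x ((hasDerivAt_id x).sub_const T)
  refine ((h x).sub (this.const_mul ε)).congr_fun_deriv (fun t => rfl) ?_
  simp

/-- An eigenfunction continues itself, up to sign, over the gaps at the two ends. -/
theorem Eig.antiperiodic (hd : 0 < d) (hQ : Weight Q (-(d / 2)) (1 + d / 2))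
    (hs : ∀ x, Q (1 - x) = 1 - Q x) (hl : ∀ x ≤ 0, Q x = 0)
    (h : Eig Q (-(d / 2)) (1 + d / 2) mu ψ) :
    ∃ ε : ℝ, ε ^ 2 = 1 ∧ ∀ i, ∀ t ∈ Icc 1 (1 + d), ψ i t = ε * ψ i (t - (1 + d)) := by
  obtain ⟨ε, hε, s1, s3⟩ := h.exists_sign hQ hs
  refine ⟨ε, hε, ?_⟩
  let δ : Jet := fun i t => ψ i t - ε * ψ i (t - (1 + d))
  have d0 : ∀ x, HasDerivAt (δ 0) (δ 1 x) x := HasDerivAt.sub_shift h.pre.d0 ε _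
  have d1 : ∀ x, HasDerivAt (δ 1) (δ 2 x) x := HasDerivAt.sub_shift h.pre.d1 ε _
  have d2 : ∀ x, HasDerivAt (δ 2) (δ 3 x) x := HasDerivAt.sub_shift h.pre.d2 ε _
  have e2 : 1 + d / 2 - (1 + d) = -(d / 2) := by ring
  have hc : 1 + d / 2 ∈ Icc 1 (1 + d) := ⟨by linarith, by linarith⟩
  have k1 : ∀ x ∈ Icc 1 (1 + d), ψ 3 x = ψ 3 (1 + d / 2) := by
    refine const_third_of_const_weight (C := 1) h.pre.d0 h.pre.d3 (fun x hx => ?_) hc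
    have := hs x
    rw [hl _ (by linarith [hx.1])] at this
    linarith
  have k2 : ∀ x ∈ Icc (-d) 0, ψ 3 x = ψ 3 (-(d / 2)) :=
    const_third_of_const_weight h.pre.d0 h.pre.d3 (fun x hx => hl x hx.2)
      ⟨by linarith, by linarith⟩
  have k3 : ∀ x ∈ Icc 1 (1 + d), δ 3 x = δ 3 (1 + d / 2) := fun x hx => by
    simp only [δ]
    rw [k1 x hx, k2 (x - (1 + d)) ⟨by linarith [hx.1], by linarith [hx.2]⟩, e2]
  have v0 : δ 0 (1 + d / 2) = 0 := by simp [δ, e2, h.pre.left, h.pre.right]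
  have v1 : δ 1 (1 + d / 2) = 0 := by simp only [δ, e2, s1, sub_self]
  have v2 : δ 2 (1 + d / 2) = 0 := by simp [δ, e2, h.pre.left2, h.pre.right2]
  have v3 : δ 3 (1 + d / 2) = 0 := by simp only [δ, e2, s3, sub_self]
  have z0 : ∀ x ∈ Icc 1 (1 + d), δ 0 x = 0 := fun x hx => by
    rw [(cubic_of_const d0 d1 d2 hc k3 x hx).2, v0, v1, v2, v3]
    ring
  have z1 := deriv_eq_zero_on (by linarith) d0 z0
  have z2 := deriv_eq_zero_on (by linarith) d1 z1
  have z3 := deriv_eq_zero_on (by linarith) d2 z2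
  intro i t ht
  refine sub_eq_zero.1 ?_
  fin_cases i
  · exact z0 t ht
  · exact z1 t ht
  · exact z2 t ht
  · exact z3 t ht

end

/-- The points where only the `k`-th of `m` cells of period `s`, with gaps of length `b`,
matters. -/
def cellDomain (s b : ℝ) (m k : ℕ) : Set ℝ :=
  {x | (k = 0 ∨ k * s - b < x) ∧ (k + 1 = m ∨ x < (k + 1) * s)}

theorem isOpen_cellDomain (s b : ℝ) (m k : ℕ) : IsOpen (cellDomain s b m k) :=
  (isOpen_const.union (isOpen_lt continuous_const continuous_id)).inter
    (isOpen_const.union (isOpen_lt continuous_id continuous_const))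

/-- Functions agreeing on consecutive gaps glue together. -/
theorem exists_glue {F : ℕ → Jet} {s b : ℝ} (hb : 0 < b) (hs : b < s)
    (hF : ∀ (k : ℕ) i x, (k + 1) * s - b < x → x < (k + 1) * s → F k i x = F (k + 1) i x) {m : ℕ}
    (hm : 1 ≤ m) : (∃ φ : Jet, ∀ k < m, ∀ x ∈ cellDomain s b m k, ∀ i, φ i x = F k i x) ∧
      ∀ x, ∃ k < m, x ∈ cellDomain s b m k := by
  induction m, hm using Nat.le_induction with
  | base =>
    refine ⟨⟨F 0, fun k hk x _ i => ?_⟩, fun x => ⟨0, one_pos, Or.inl rfl, Or.inl rfl⟩⟩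
    obtain rfl : k = 0 := by omega
    rfl
  | succ m hm ih =>
    obtain ⟨⟨φ, hφ⟩, hcov⟩ := ih
    refine ⟨⟨fun i x => if x < m * s - b / 2 then φ i x else F m i x, fun k hk x hx i => ?_⟩,
      fun x => ?_⟩
    · simp only
      split_ifs with h
      · rcases Nat.lt_succ_iff_lt_or_eq.1 hk with hkm | rfl
        · refine hφ k hkm x ⟨hx.1, ?_⟩ i
          exact Or.inr (hx.2.resolve_left (by omega))
        · obtain ⟨k, rfl⟩ := Nat.exists_eq_add_of_le' hm
          have hx1 := hx.1.resolve_left (by omega)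
          push_cast at hx1 h
          rw [hφ k (by omega) x ⟨Or.inr (by linarith), Or.inl rfl⟩ i]
          exact hF k i x hx1 (by linarith)
      · rcases Nat.lt_succ_iff_lt_or_eq.1 hk with hkm | rfl
        · have hx2 := hx.2.resolve_left (by omega)
          have hmk : m = k + 1 := by
            by_contra hne
            have : (k : ℝ) + 1 + 1 ≤ m := by exact_mod_cast (by omega : k + 1 + 1 ≤ m)
            nlinarith
          subst hmk
          push_cast at h
          exact (hF k i x (by linarith) hx2).symm
        · rfl
    · by_cases h : x < m * s - b / 2
      · obtain ⟨k, hk, h1, h2⟩ := hcov x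
        refine ⟨k, by omega, h1, Or.inr ?_⟩
        rcases h2 with rfl | h2
        · push_cast at h
          linarith
        · exact h2
      · exact ⟨m, by omega, Or.inr (by linarith), Or.inl rfl⟩

/-- The rescaled copy of a jet in the `k`-th cell. -/
noncomputable def cellJet (a s ε : ℝ) (ψ : Jet) (k : ℕ) : Jet :=
  fun i x => ε ^ k * a⁻¹ ^ (i : ℕ) * ψ i ((x - k * s) / a)

theorem HasDerivAt.comp_cell {f : ℝ → ℝ} {f' a c x : ℝ} (h : HasDerivAt f f' ((x - c) / a)) :
    HasDerivAt (fun t => f ((t - c) / a)) (a⁻¹ * f') x := by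
  have := h.comp x (((hasDerivAt_id x).sub_const c).div_const a)
  simpa [Function.comp_def, mul_comm] using this

theorem HasDerivAt.congr_on_open {f g : ℝ → ℝ} {f' x : ℝ} {U : Set ℝ} (hU : IsOpen U) (hx : x ∈ U)
    (h : HasDerivAt f f' x) (hfg : ∀ t ∈ U, g t = f t) : HasDerivAt g f' x :=
  h.congr_of_eventuallyEq (eventually_of_mem (hU.mem_nhds hx) hfg)

section

variable {Q : ℝ → ℝ} {κ : ℕ} {a b mu ε : ℝ} {ψ : Jet}

theorem CantorExt.eq_on_cell (h : CantorExt Q κ a b) {k : ℕ} (hk : k < κ) {x : ℝ}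
    (hx : x ∈ cellDomain (a + b) b κ k) : Q x = (k + Q ((x - k * (a + b)) / a)) / κ := by
  have ha := h.ha
  have hb := h.hb
  have e : x = k * (a + b) + a * ((x - k * (a + b)) / a) := by
    field_simp
    ring
  by_cases h1 : k * (a + b) - b ≤ x
  · by_cases h2 : x ≤ (k + 1) * (a + b)
    · conv_lhs => rw [e]
      refine h.step k hk _ ?_ ?_
      · rw [← neg_div, div_le_div_iff_of_pos_right ha]
        linarith
      · rw [div_le_iff₀ ha, add_mul, div_mul_cancel₀ _ ha.ne']
        linarith
    · have hk' := hx.2.resolve_right (by linarith)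
      have e' : (k : ℝ) + 1 = κ := by exact_mod_cast hk'
      have := h.sum
      rw [e'] at h2
      rw [h.right x (by linarith), h.right, e', div_self h.kappa_pos.ne']
      rw [le_div_iff₀ ha, ← add_sub_cancel_right (k : ℝ) 1, e']
      linarith
  · have hk' := hx.1.resolve_right (by linarith)
    subst hk'
    simp only [Nat.cast_zero, zero_mul, zero_sub, not_le] at h1
    rw [h.left x (by linarith), h.left]
    · simp
    · simpa using div_nonpos_of_nonpos_of_nonneg (by linarith) ha.le

theorem cellJet_zero_three (h : CantorExt Q κ a b) (d0 : ∀ x, HasDerivAt (ψ 0) (ψ 1 x) x)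
    (d3 : ∀ x, HasDerivAt (fun t => ψ 3 t - Q t * (mu * ψ 0 t)) (-(Q x * (mu * ψ 1 x))) x)
    {k : ℕ} (hk : k < κ) {x : ℝ} (hx : x ∈ cellDomain (a + b) b κ k) :
    HasDerivAt (fun t => cellJet a (a + b) ε ψ k 3 t -
      Q t * (κ / a ^ 3 * mu * cellJet a (a + b) ε ψ k 0 t))
      (-(Q x * (κ / a ^ 3 * mu * cellJet a (a + b) ε ψ k 1 x))) x := by
  have ha := h.ha.ne'
  have hκ := h.kappa_pos.ne'
  have h1 := ((HasDerivAt.comp_cell (d3 ((x - k * (a + b)) / a))).sub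
    ((HasDerivAt.comp_cell (d0 ((x - k * (a + b)) / a))).const_mul (k * mu))).const_mul
    (ε ^ k * a⁻¹ ^ 3)
  refine (h1.congr_on_open (isOpen_cellDomain _ _ _ _) hx fun t ht => ?_).congr_fun_deriv
    (fun _ => rfl) ?_
  · simp only [h.eq_on_cell hk ht, cellJet, Pi.sub_apply]
    simp
    field_simp
    ring
  · simp only [h.eq_on_cell hk hx, cellJet]
    simp
    field_simp
    ring

theorem CantorExt.exists_extension (h : CantorExt Q κ a b)
    (hψ : Eig Q (-(b / a / 2)) (1 + b / a / 2) mu ψ)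
    (hanti : ∀ i, ∀ t ∈ Icc 1 (1 + b / a), ψ i t = ε * ψ i (t - (1 + b / a))) :
    ∃ φ : Jet, Eig Q (-(b / 2)) (1 + b / 2) (κ / a ^ 3 * mu) φ ∧ ∀ k < κ,
      ∀ x ∈ cellDomain (a + b) b κ k, φ 0 x = ε ^ k * ψ 0 ((x - k * (a + b)) / a) := by
  have ha := h.ha
  have hb := h.hb
  obtain ⟨hp, x₀, hx₀, hne⟩ := hψ
  have hglue : ∀ (k : ℕ) i x, (k + 1) * (a + b) - b < x → x < (k + 1) * (a + b) →
      cellJet a (a + b) ε ψ k i x = cellJet a (a + b) ε ψ (k + 1) i x := fun k i x h1 h2 => by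
    have e : (x - k * (a + b)) / a - (1 + b / a) = (x - (k + 1 : ℕ) * (a + b)) / a := by
      field_simp
      push_cast
      ring
    simp only [cellJet]
    rw [hanti i ((x - k * (a + b)) / a), e, pow_succ]
    · ring
    · refine ⟨?_, ?_⟩
      · rw [le_div_iff₀ ha]
        linarith
      · rw [div_le_iff₀ ha, add_mul, div_mul_cancel₀ _ ha.ne']
        linarith
  obtain ⟨⟨φ, hφ⟩, hcov⟩ := exists_glue hb (by linarith) hglue
    ((by norm_num : 1 ≤ 2).trans h.two_le)
  have hcell : ∀ k < κ, ∀ x ∈ cellDomain (a + b) b κ k,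
      φ 0 x = ε ^ k * ψ 0 ((x - k * (a + b)) / a) := fun k hk x hx => by
    rw [hφ k hk x hx]
    simp [cellJet]
  have hderiv : ∀ (i j : Fin 4), (j : ℕ) = i + 1 → (∀ x, HasDerivAt (ψ i) (ψ j x) x) →
      ∀ x, HasDerivAt (φ i) (φ j x) x := fun i j hij hd x => by
    obtain ⟨k, hk, hx⟩ := hcov x
    rw [hφ k hk x hx]
    refine (((HasDerivAt.comp_cell (hd ((x - k * (a + b)) / a))).const_mul
      (ε ^ k * a⁻¹ ^ (i : ℕ))).congr_on_open (isOpen_cellDomain _ _ _ _) hx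
      (fun t ht => hφ k hk t ht i)).congr_fun_deriv (fun _ => rfl) ?_
    simp only [cellJet, hij, pow_succ]
    ring
  have h2 := h.two_le
  have hmem0 : -(b / 2) ∈ cellDomain (a + b) b κ 0 := ⟨Or.inl rfl, Or.inr (by push_cast; linarith)⟩
  have e0 : (-(b / 2) - (0 : ℕ) * (a + b)) / a = -(b / a / 2) := by
    push_cast
    ring
  have hκ1 : κ - 1 + 1 = κ := by omega
  have hκ1' : ((κ - 1 : ℕ) : ℝ) = κ - 1 := by rw [Nat.cast_sub (by omega), Nat.cast_one]
  have hsum := h.sum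
  have e1 : (1 + b / 2 - (κ - 1 : ℕ) * (a + b)) / a = 1 + b / a / 2 := by
    rw [hκ1', sub_mul, hsum]
    field_simp
    ring
  have hmem1 : 1 + b / 2 ∈ cellDomain (a + b) b κ (κ - 1) := by
    refine ⟨Or.inr ?_, Or.inl hκ1⟩
    rw [hκ1']
    linarith
  have hb' : b / a / 2 < 1 + b / a := by
    have := div_pos hb ha
    linarith
  refine ⟨φ, ⟨⟨hderiv 0 1 rfl hp.d0, hderiv 1 2 rfl hp.d1, hderiv 2 3 rfl hp.d2, fun x => ?_,
    ?_, ?_, ?_, ?_⟩, a * x₀, ?_, ?_⟩, hcell⟩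
  · obtain ⟨k, hk, hx⟩ := hcov x
    refine ((cellJet_zero_three (ε := ε) h hp.d0 hp.d3 hk hx).congr_on_open
      (isOpen_cellDomain _ _ _ _) hx fun t ht => ?_).congr_fun_deriv (fun _ => rfl) ?_
    · simp [hφ k hk t ht]
    · simp [hφ k hk x hx]
  · rw [hφ 0 (by omega) _ hmem0]
    simp only [cellJet, e0, hp.left, mul_zero]
  · rw [hφ (κ - 1) (by omega) _ hmem1]
    simp only [cellJet, e1, hp.right, mul_zero]
  · rw [hφ 0 (by omega) _ hmem0]
    simp only [cellJet, e0, hp.left2, mul_zero]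
  · rw [hφ (κ - 1) (by omega) _ hmem1]
    simp only [cellJet, e1, hp.right2, mul_zero]
  all_goals
    have l1 : -(b / 2) ≤ a * x₀ := by
      have := mul_le_mul_of_nonneg_left hx₀.1 ha.le
      have e : a * -(b / a / 2) = -(b / 2) := by field_simp
      linarith
    have l2 : a * x₀ ≤ a + b / 2 := by
      have := mul_le_mul_of_nonneg_left hx₀.2 ha.le
      have e : a * (1 + b / a / 2) = a + b / 2 := by field_simp
      linarith
  · have : (2 : ℝ) ≤ κ := by exact_mod_cast h2
    exact ⟨l1, by nlinarith⟩
  · rw [hcell 0 (by omega) _ ⟨Or.inl rfl, Or.inr (by push_cast; linarith)⟩]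
    simpa [ha.ne'] using hne

end

section

theorem Alt.comp_strictMono {f g : ℝ → ℝ} (hg : StrictMono g) {b : ℝ} {n : ℕ} : ∀ {a σ : ℝ},
    Alt (fun t => f (g t)) b n a σ → Alt f (g b) n (g a) σ := by
  induction n with
  | zero => intros; trivial
  | succ n ih =>
    rintro a σ ⟨x, h1, h2, h3, h4⟩
    exact ⟨g x, hg h1, hg h2, h3, ih h4⟩

theorem Alt.concat_cells {f : ℝ → ℝ} {z : ℕ → ℝ} (hz : Monotone z) {N : ℕ} {σ : ℝ} {m : ℕ}
    (h : ∀ k < m, Alt f (z (k + 1)) N (z k) (((-1) ^ N) ^ k * σ)) :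
    Alt f (z m) (m * N) (z 0) σ := by
  induction m with
  | zero => simp [Alt]
  | succ m ih =>
    rw [Nat.succ_mul]
    refine (ih fun k hk => h k (by omega)).concat (hz (Nat.le_succ m)) (hz (Nat.zero_le m)) ?_
    rw [mul_comm m N, pow_mul]
    exact h m (Nat.lt_succ_self m)

theorem Alt.le_of_cells {f : ℝ → ℝ} {z : ℕ → ℝ} (hz : Monotone z) {N m : ℕ}
    (h0 : ∀ k < m, f (z k) = 0)
    (h : ∀ k < m, ∀ n τ, Alt f (z (k + 1)) n (z k) τ → n ≤ N) :
    ∀ {n σ}, Alt f (z m) n (z 0) σ → n ≤ m * N := by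
  induction m with
  | zero =>
    intro n σ hA
    rcases n with _ | n
    · exact Nat.zero_le _
    · exact absurd hA.lt (lt_irrefl _)
  | succ m ih =>
    intro n σ hA
    obtain ⟨k, l, rfl, h1, h2⟩ := hA.split (h0 m (Nat.lt_succ_self m)) (hz (Nat.zero_le m))
    have e1 := ih (fun k hk => h0 k (by omega)) (fun k hk => h k (by omega)) h1
    have e2 := h m (Nat.lt_succ_self m) _ _ h2
    rw [Nat.succ_mul]
    omega

theorem eventually_sign_eq {f : ℝ → ℝ} {f' p σ : ℝ} (h : HasDerivAt f f' p) (h0 : f p = 0)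
    (hσ : 0 < σ * f') : ∀ᶠ x in nhds p, SignType.sign (σ * f x) = SignType.sign (x - p) :=
  eventually_nhdsWithin_sign_eq_of_deriv_pos (by rwa [(h.const_mul σ).deriv]) (by simp [h0])

theorem exists_pos_right {f : ℝ → ℝ} {f' p σ y : ℝ} (h : HasDerivAt f f' p) (h0 : f p = 0)
    (hσ : 0 < σ * f') (hy : p < y) : ∃ x, p < x ∧ x < y ∧ 0 < σ * f x := by
  obtain ⟨x, hs, hx⟩ := (((eventually_sign_eq h h0 hσ).filter_mono nhdsWithin_le_nhds).and
    (Ioo_mem_nhdsGT hy)).exists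
  rw [sign_pos (sub_pos.2 hx.1), sign_eq_one_iff] at hs
  exact ⟨x, hx.1, hx.2, hs⟩

theorem exists_pos_left {f : ℝ → ℝ} {f' q σ y : ℝ} (h : HasDerivAt f f' q) (h0 : f q = 0)
    (hσ : σ * f' < 0) (hy : y < q) : ∃ x, y < x ∧ x < q ∧ 0 < σ * f x := by
  obtain ⟨x, hs, hx⟩ := (((eventually_sign_eq (σ := -σ) h h0 (by linarith)).filter_mono
    nhdsWithin_le_nhds).and (Ioo_mem_nhdsLT hy)).exists
  rw [sign_neg (sub_neg.2 hx.2), sign_eq_neg_one_iff] at hs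
  exact ⟨x, hx.1, hx.2, by linarith⟩

/-- The boundary slopes of a function with a maximal number of alternations determine the parity
of that number. -/
theorem sign_eq_of_alt_max {f : ℝ → ℝ} {p q σ fp fq ε : ℝ} {N : ℕ} (hN : N ≠ 0)
    (hp : HasDerivAt f fp p) (hq : HasDerivAt f fq q) (hp0 : f p = 0) (hq0 : f q = 0)
    (hfp : fp ≠ 0) (hε : ε ^ 2 = 1) (hfq : fq = ε * fp) (hA : Alt f q N p σ)
    (hmax : ∀ τ, ¬Alt f q (N + 1) p τ) : ε = (-1) ^ N := by
  obtain ⟨m, rfl⟩ := Nat.exists_eq_add_one_of_ne_zero hN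
  have hσ := hA.ne_zero
  have h1 : 0 < σ * fp := by
    by_contra hle
    have hlt := lt_of_le_of_ne (not_lt.1 hle) (mul_ne_zero hσ hfp)
    obtain ⟨y, hy1, hy2, hy3, hA'⟩ := id hA
    obtain ⟨x, hx1, hx2, hx3⟩ := exists_pos_right (σ := -σ) hp hp0 (by linarith) hy1
    exact hmax (-σ) ⟨x, hx1, hx2.trans hy2, hx3, y, hx2, hy2, by rwa [neg_neg],
      by rwa [neg_neg]⟩
  have hs : ((-1 : ℝ) ^ (m + 1)) ^ 2 = 1 := by rw [← pow_mul, mul_comm, pow_mul]; norm_num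
  have h2 : 0 ≤ (-1) ^ (m + 1) * σ * fq := by
    by_contra hlt
    exact hmax σ (hA.append hA.lt fun a' ha' => exists_pos_left hq hq0 (not_le.1 hlt) ha')
  have h3 : 0 ≤ (-1) ^ (m + 1) * ε := by
    rw [hfq] at h2
    refine nonneg_of_mul_nonneg_left (b := σ * fp) ?_ h1
    linarith
  have h4 : ((-1) ^ (m + 1) * ε) ^ 2 = 1 := by rw [mul_pow, hs, hε, one_mul]
  have h5 : (-1) ^ (m + 1) * ε = 1 := by nlinarith
  linear_combination (-1) ^ (m + 1) * h5 - ε * hs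

variable {Q : ℝ → ℝ} {κ : ℕ} {a b mu : ℝ} {ψ : Jet}

/-- Rescaling turns an eigenfunction with `N` alternations into one with `κ * N` of them. -/
theorem CantorExt.exists_eig_alt (h : CantorExt Q κ a b)
    (hQ : Weight Q (-(b / a / 2)) (1 + b / a / 2)) (hψ : Eig Q (-(b / a / 2)) (1 + b / a / 2) mu ψ)
    {N : ℕ} (hN : N ≠ 0) (halt : ∀ n, (∃ σ, Alt (ψ 0) (1 + b / a / 2) n (-(b / a / 2)) σ) ↔ n ≤ N) :
    ∃ φ : Jet, Eig Q (-(b / 2)) (1 + b / 2) (κ / a ^ 3 * mu) φ ∧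
      ∀ n, (∃ σ, Alt (φ 0) (1 + b / 2) n (-(b / 2)) σ) ↔ n ≤ κ * N := by
  have ha := h.ha
  have hb := h.hb
  have hd : 0 < b / a := div_pos hb ha
  obtain ⟨ε, hε, hanti⟩ := hψ.antiperiodic hd hQ h.symm h.left
  obtain ⟨φ, hφ, hcell⟩ := h.exists_extension hψ hanti
  obtain ⟨σ, hσ⟩ := (halt N).2 le_rfl
  have hεN : ε = (-1) ^ N := by
    refine sign_eq_of_alt_max hN (hψ.pre.d0 _) (hψ.pre.d0 _) hψ.pre.left hψ.pre.right
      (hψ.deriv_left_ne hQ) hε ?_ hσ fun τ hτ => absurd ((halt _).1 ⟨τ, hτ⟩) (by omega)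
    rw [hanti 1 (1 + b / a / 2) ⟨by linarith, by linarith⟩]
    congr 2
    ring
  let z : ℕ → ℝ := fun k => k * (a + b) - b / 2
  have hz : Monotone z := fun k l hkl => by
    have : (k : ℝ) ≤ l := by exact_mod_cast hkl
    simp only [z]
    nlinarith
  have z0 : z 0 = -(b / 2) := by simp [z]
  have zκ : z κ = 1 + b / 2 := by
    simp only [z]
    linarith [h.sum]
  have zsucc : ∀ k, z (k + 1) = k * (a + b) + a + b / 2 := fun k => by
    simp only [z]
    push_cast
    ring
  have hcell' : ∀ k < κ, ∀ x ∈ Icc (z k) (z (k + 1)),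
      φ 0 x = ε ^ k * ψ 0 ((x - k * (a + b)) / a) := fun k hk x hx => by
    rw [zsucc] at hx
    simp only [z, mem_Icc] at hx
    exact hcell k hk x ⟨Or.inr (by linarith), Or.inr (by linarith)⟩
  have hεk : ∀ k, ε ^ k * ε ^ k = 1 := fun k => by rw [← mul_pow, ← sq, hε, one_pow]
  have hεk0 : ∀ k, ε ^ k ≠ 0 := fun k => left_ne_zero_of_mul_eq_one (hεk k)
  have ep : ∀ k, (z k - k * (a + b)) / a = -(b / a / 2) := fun k => by
    simp only [z]
    field_simp
    ring
  have eq : ∀ k, (z (k + 1) - k * (a + b)) / a = 1 + b / a / 2 := fun k => by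
    rw [zsucc]
    field_simp
    ring
  refine ⟨φ, hφ, fun n => ⟨?_, fun hn => ?_⟩⟩
  · rintro ⟨τ, hτ⟩
    rw [← z0, ← zκ] at hτ
    refine Alt.le_of_cells hz (fun k hk => ?_) (fun k hk n τ hA => ?_) hτ
    · rw [hcell' k hk _ ⟨le_rfl, hz k.le_succ⟩, ep, hψ.pre.left, mul_zero]
    · have hg : StrictMono fun x => (x - k * (a + b)) / a := fun x y hxy => by
        simp only
        gcongr
      have h1 : Alt (fun x => ψ 0 ((x - k * (a + b)) / a)) (z (k + 1)) n (z k) (ε ^ k * τ) :=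
        hA.smul (hεk0 k) fun x hx hx' => by
          rw [hcell' k hk x ⟨hx.le, hx'.le⟩, ← mul_assoc, hεk, one_mul]
      have h2 := Alt.comp_strictMono (f := ψ 0) hg h1
      simp only [ep, eq] at h2
      exact (halt n).1 ⟨_, h2⟩
  · refine ⟨σ, Alt.of_le ?_ hn⟩
    rw [← z0, ← zκ]
    refine Alt.concat_cells hz fun k hk => ?_
    rw [← hεN]
    have hg : StrictMono fun t => k * (a + b) + a * t := fun x y hxy => by
      simp only
      gcongr
    have gp : k * (a + b) + a * -(b / a / 2) = z k := by
      simp only [z]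
      field_simp
      ring
    have gq : k * (a + b) + a * (1 + b / a / 2) = z (k + 1) := by
      rw [zsucc]
      field_simp
      ring
    have h1 : Alt (fun t => φ 0 (k * (a + b) + a * t)) (1 + b / a / 2) N (-(b / a / 2))
        (ε ^ k * σ) := hσ.smul (hεk0 k) fun t ht ht' => by
      rw [hcell' k hk]
      · congr 2
        field_simp
        ring
      · rw [← gp, ← gq]
        exact ⟨hg.monotone ht.le, hg.monotone ht'.le⟩
    have h2 := Alt.comp_strictMono (f := φ 0) hg h1
    simpa only [gp, gq] using h2

end

theorem stmt11 (P : ℝ → ℝ) (κ : ℕ) (a : ℝ) (hP : CantorSelfSimilar P κ a)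
    (Λ M : ℕ → ℝ)
    (hΛmono : StrictMono Λ)
    (hΛrange : Set.range Λ =
      {lam : ℝ | IsEigenvalue P (12 / (bb κ a) ^ 2) (6 / bb κ a) lam})
    (hMmono : StrictMono M)
    (hMrange : Set.range M =
      {lam : ℝ | IsEigenvalue P (12 * a ^ 2 / (bb κ a) ^ 2) (6 * a / bb κ a) lam}) :
    ∀ n : ℕ, Λ (κ * (n + 1) - 1) = (κ / a ^ 3) * M n := by
  intro n
  have h := hP.cantorExt
  obtain ⟨hc, hm, hP0, hP1, -⟩ := hP
  have h01 : P 0 < P 1 := by rw [hP0, hP1]; exact one_pos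
  generalize bb κ a = b at *
  have ha := h.ha
  have hb := h.hb
  have hd : 0 < b / a := div_pos hb ha
  have e1 : 12 * a ^ 2 / b ^ 2 = 12 / (b / a) ^ 2 := by field_simp
  have e2 : 6 * a / b = 6 / (b / a) := by field_simp
  simp only [e1, e2, isEigenvalue_iff hc hd] at hMrange
  simp only [isEigenvalue_iff hc hb] at hΛrange
  have hW := weight_clampExt hc hm h01 (half_pos hd).le
  have hW' := weight_clampExt hc hm h01 (half_pos hb).le
  obtain ⟨ψ, hψ⟩ : M n ∈ {lam | ∃ φ, Eig (clampExt P) (-(b / a / 2)) (1 + b / a / 2) lam φ} :=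
    hMrange ▸ mem_range_self n
  obtain ⟨φ, hφ, halt⟩ := h.exists_eig_alt hW hψ n.succ_ne_zero
    fun m => Eig.exists_alt_iff hW hMmono hMrange hψ
  obtain ⟨l, hl⟩ : κ / a ^ 3 * M n ∈ range Λ := hΛrange ▸ ⟨φ, hφ⟩
  rw [← hl] at hφ ⊢
  have hiff : ∀ m, m ≤ l + 1 ↔ m ≤ κ * (n + 1) := fun m =>
    (Eig.exists_alt_iff hW' hΛmono hΛrange hφ).symm.trans (halt m)
  congr 1
  have i1 := (hiff (l + 1)).1 le_rfl
  have i2 := (hiff (κ * (n + 1))).2 le_rfl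
  omega
end

section
/- Suppose that P satisfies the symmetry identity P(x) = 1 − P(1−x) for all x ∈ [0,1]. Let λ > 0 be a simple eigenvalue of the problem (α,β) (i.e. any two real eigenfunctions for λ are proportional), and let y be a real-valued eigenfunction for λ. Then y is either even or odd about the point 1/2: either y(1−x) = y(x) for all x ∈ [0,1], or y(1−x) = −y(x) for all x ∈ [0,1]. -/
open Set Filter

theorem one_sub_mem_Icc_zero_one {x : ℝ} (hx : x ∈ Icc (0 : ℝ) 1) : 1 - x ∈ Icc (0 : ℝ) 1 :=
  ⟨by linarith [hx.2], by linarith [hx.1]⟩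

open scoped Pointwise in
theorem one_vadd_neg_Icc_zero_one : (1 : ℝ) +ᵥ -Icc (0 : ℝ) 1 = Icc (0 : ℝ) 1 := by
  ext x
  simp only [Set.mem_vadd_set_iff_neg_vadd_mem, Set.mem_neg, vadd_eq_add, mem_Icc]
  constructor <;> rintro ⟨h, h'⟩ <;> constructor <;> linarith

theorem iteratedDerivWithin_reflect (f : ℝ → ℝ) (n : ℕ) (x : ℝ) :
    iteratedDerivWithin n (fun t => f (1 - t)) (Icc 0 1) x =
      (-1) ^ n * iteratedDerivWithin n f (Icc 0 1) (1 - x) := by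
  rw [iteratedDerivWithin_comp_const_sub, one_vadd_neg_Icc_zero_one]
  rfl

theorem Y1_reflect (y : ℝ → ℝ) (x : ℝ) : Y1 (fun t => y (1 - t)) x = -Y1 y (1 - x) := by
  simpa [Y1] using iteratedDerivWithin_reflect y 1 x

theorem Y2_reflect (y : ℝ → ℝ) (x : ℝ) :
    Y2 (fun t => y (1 - t)) x = Y2 y (1 - x) := by
  simpa [Y2] using iteratedDerivWithin_reflect y 2 x

theorem Y3_reflect (y : ℝ → ℝ) (x : ℝ) :
    Y3 (fun t => y (1 - t)) x = -Y3 y (1 - x) := by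
  have h := iteratedDerivWithin_reflect y 3 x
  norm_num at h
  exact h

theorem Nontrivial01.reflect {y : ℝ → ℝ} (hy : Nontrivial01 y) :
    Nontrivial01 (fun t => y (1 - t)) := by
  obtain ⟨x, hx, hne⟩ := hy
  exact ⟨1 - x, one_sub_mem_Icc_zero_one hx, by simpa using hne⟩

theorem SolutionOn.reflect {P : ℝ → ℝ} {lam : ℝ} {y : ℝ → ℝ}
    (hsymm : ∀ x ∈ Icc (0 : ℝ) 1, P x = 1 - P (1 - x)) (hy : SolutionOn P lam y) :
    SolutionOn P lam (fun t => y (1 - t)) := by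
  obtain ⟨hC, hD⟩ := hy
  have hmaps : MapsTo (fun t : ℝ => 1 - t) (Icc 0 1) (Icc 0 1) :=
    fun _ => one_sub_mem_Icc_zero_one
  refine ⟨hC.comp (contDiffOn_const.sub contDiffOn_id) hmaps, fun x hx => ?_⟩
  have hx' := one_sub_mem_Icc_zero_one hx
  have hsub : HasDerivWithinAt (fun t : ℝ => 1 - t) (-1) (Icc 0 1) x :=
    (hasDerivWithinAt_id x _).const_sub 1
  have hquasi := (hD (1 - x) hx').scomp x hsub hmaps
  have hy1 : HasDerivWithinAt y (Y1 y (1 - x)) (Icc 0 1) (1 - x) :=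
    ((hC.differentiableOn (by norm_num)) (1 - x) hx').hasDerivWithinAt
  have hrefl := (hy1.scomp x hsub hmaps).const_mul lam
  have heq : ∀ t ∈ Icc (0 : ℝ) 1, Y3 (fun t => y (1 - t)) t - lam * P t * y (1 - t) =
      -(Y3 y (1 - t) - lam * P (1 - t) * y (1 - t)) - lam * y (1 - t) := by
    intro t ht
    rw [Y3_reflect, hsymm t ht]
    ring
  refine ((hquasi.neg.sub hrefl).congr_deriv ?_).congr heq (heq x hx)
  simp only [smul_eq_mul]
  rw [Y1_reflect, hsymm x hx]
  ring

theorem BC.reflect {α β : ℝ} {y : ℝ → ℝ} (hy : BC α β y) : BC α β (fun t => y (1 - t)) := by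
  obtain ⟨h1, h2, h3, h4⟩ := hy
  simp only [BC, Y1_reflect, Y2_reflect, Y3_reflect, sub_zero, sub_self]
  refine ⟨?_, ?_, ?_, ?_⟩ <;> linarith

theorem Eigenfunction.reflect {P : ℝ → ℝ} {α β lam : ℝ} {y : ℝ → ℝ}
    (hsymm : ∀ x ∈ Icc (0 : ℝ) 1, P x = 1 - P (1 - x)) (hy : Eigenfunction P α β lam y) :
    Eigenfunction P α β lam (fun t => y (1 - t)) :=
  ⟨hy.1.reflect, hy.2.1.reflect hsymm, hy.2.2.reflect⟩

theorem Nontrivial01.even_or_odd_of_reflect_eq_mul {y : ℝ → ℝ} (hy : Nontrivial01 y) {c : ℝ}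
    (h : ∀ x ∈ Icc (0 : ℝ) 1, y (1 - x) = c * y x) :
    (∀ x ∈ Icc (0 : ℝ) 1, y (1 - x) = y x) ∨ (∀ x ∈ Icc (0 : ℝ) 1, y (1 - x) = -y x) := by
  obtain ⟨x, hx, hne⟩ := hy
  have hxx := h (1 - x) (one_sub_mem_Icc_zero_one hx)
  rw [sub_sub_cancel, h x hx] at hxx
  have hc : c * c = 1 := mul_right_cancel₀ hne (by linarith)
  rcases mul_self_eq_one_iff.mp hc with rfl | rfl
  · exact Or.inl fun t ht => by simpa using h t ht
  · exact Or.inr fun t ht => by simpa using h t ht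

theorem stmt12 (P : ℝ → ℝ) (hPc : ContinuousOn P (Set.Icc 0 1))
    (hsymm : ∀ x ∈ Set.Icc (0:ℝ) 1, P x = 1 - P (1 - x))
    (α β : ℝ) (hα : 0 ≤ α) (hβ : 0 < β)
    (lam : ℝ) (hlam : 0 < lam)
    (hsimple : ∀ z w : ℝ → ℝ, Eigenfunction P α β lam z →
      Eigenfunction P α β lam w →
      ∃ c : ℝ, (∀ x ∈ Set.Icc (0:ℝ) 1, w x = c * z x) ∨
        (∀ x ∈ Set.Icc (0:ℝ) 1, z x = c * w x))
    (y : ℝ → ℝ) (hy : Eigenfunction P α β lam y) :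
    (∀ x ∈ Set.Icc (0:ℝ) 1, y (1 - x) = y x) ∨
    (∀ x ∈ Set.Icc (0:ℝ) 1, y (1 - x) = -y x) := by
  obtain ⟨c, h | h⟩ := hsimple y _ hy (hy.reflect hsymm)
  · exact hy.1.even_or_odd_of_reflect_eq_mul h
  · refine hy.1.even_or_odd_of_reflect_eq_mul (c := c) fun x hx => ?_
    simpa using h (1 - x) (one_sub_mem_Icc_zero_one hx)
end

section
/- Let λ > 0 be an eigenvalue of the problem (α,β) and let y be a real-valued eigenfunction for λ. Then y(0)·y″(0) < 0, i.e. the values y(0) and y″(0) are nonzero and have opposite signs. -/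
open Set Filter

/-- A function with nonnegative one-sided derivative on `[0,t]` is bounded there by its value
at `t`. -/
theorem le_of_hasDerivWithinAt_nonneg {f f' : ℝ → ℝ} {t : ℝ} (ht : t ∈ Icc (0:ℝ) 1)
    (hf : ∀ x ∈ Icc (0:ℝ) 1, HasDerivWithinAt f (f' x) (Icc 0 1) x)
    (hf' : ∀ x ∈ Icc (0:ℝ) t, 0 ≤ f' x) {s : ℝ} (hs : s ∈ Icc (0:ℝ) t) : f s ≤ f t := by
  have hsub : Icc (0:ℝ) t ⊆ Icc 0 1 := Icc_subset_Icc_right ht.2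
  have hmono : MonotoneOn f (Icc 0 t) :=
    monotoneOn_of_hasDerivWithinAt_nonneg (convex_Icc 0 t)
      (fun x hx => ((hf x (hsub hx)).mono hsub).continuousWithinAt)
      (fun x hx => (hf x (hsub (interior_subset hx))).mono (interior_subset.trans hsub))
      (fun x hx => hf' x (interior_subset hx))
  exact hmono hs (right_mem_Icc.2 ht.1) hs.2

theorem hasDerivWithinAt_div_mul_exp {k : ℝ} (hk : k ≠ 0) (c : ℝ) (s : Set ℝ) (x : ℝ) :
    HasDerivWithinAt (fun t => c / k * Real.exp (k * t)) (c * Real.exp (k * x)) s x := by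
  have h := ((((hasDerivAt_id x).const_mul k).exp).const_mul (c / k)).hasDerivWithinAt (s := s)
  refine h.congr_deriv ?_
  simp only [id]
  field_simp

/-- A lower bound `c * exp (k * x)` with `c ≤ 0` for the derivative passes to the function. -/
theorem lower_bound_of_deriv {f f' : ℝ → ℝ} {k c : ℝ} (hk : 0 < k) (hc : c ≤ 0)
    (hf : ∀ x ∈ Icc (0:ℝ) 1, HasDerivWithinAt f (f' x) (Icc 0 1) x)
    (hf' : ∀ x ∈ Icc (0:ℝ) 1, c * Real.exp (k * x) ≤ f' x) (h0 : 0 ≤ f 0)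
    {t : ℝ} (ht : t ∈ Icc (0:ℝ) 1) : c / k * Real.exp (k * t) ≤ f t := by
  have key := le_of_hasDerivWithinAt_nonneg
    (f := fun s => f s - c / k * Real.exp (k * s))
    (f' := fun s => f' s - c * Real.exp (k * s)) ht
    (fun x hx => (hf x hx).sub (hasDerivWithinAt_div_mul_exp hk.ne' c _ x))
    (fun x hx => sub_nonneg.2 (hf' x ⟨hx.1, hx.2.trans ht.2⟩)) (s := 0) ⟨le_rfl, ht.1⟩
  have hneg : c / k ≤ 0 := div_nonpos_of_nonpos_of_nonneg hc hk.le
  simp only [mul_zero, Real.exp_zero] at key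
  linarith

section Positivity

variable {P y y₁ y₂ y₃ : ℝ → ℝ} {lam : ℝ}

/-- A bound `m * exp (k * x) ≤ y' x` with `m ≤ 0` yields a similar bound for the third
derivative, with a gain of `lam / k`. -/
theorem third_deriv_lower_bound
    (hmono : MonotoneOn P (Icc 0 1)) (hP0 : P 0 = 0) (hP1 : P 1 = 1) (hlam : 0 < lam)
    (h₁ : ∀ x ∈ Icc (0:ℝ) 1, HasDerivWithinAt y (y₁ x) (Icc 0 1) x)
    (h₄ : ∀ x ∈ Icc (0:ℝ) 1, HasDerivWithinAt (fun t => y₃ t - lam * P t * y t)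
      (-(lam * P x * y₁ x)) (Icc 0 1) x)
    {k m : ℝ} (hk : 0 < k) (hm : m ≤ 0)
    (hy₁ : ∀ x ∈ Icc (0:ℝ) 1, m * Real.exp (k * x) ≤ y₁ x)
    {t : ℝ} (ht : t ∈ Icc (0:ℝ) 1) :
    y₃ 0 + lam * P t * y 0 + lam * m / k * Real.exp (k * t) ≤ y₃ t := by
  have h0 : (0:ℝ) ∈ Icc (0:ℝ) 1 := ⟨le_rfl, zero_le_one⟩
  have h1 : (1:ℝ) ∈ Icc (0:ℝ) 1 := ⟨zero_le_one, le_rfl⟩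
  have key := le_of_hasDerivWithinAt_nonneg
    (f := fun s => y₃ s - lam * P s * y s + lam * P t * y s
      - lam * m / k * Real.exp (k * s))
    (f' := fun s => -(lam * P s * y₁ s) + lam * P t * y₁ s - lam * m * Real.exp (k * s)) ht
    (fun x hx => ((h₄ x hx).add ((h₁ x hx).const_mul (lam * P t))).sub
      (hasDerivWithinAt_div_mul_exp hk.ne' (lam * m) _ x))
    (fun x hx => by
      have hx1 : x ∈ Icc (0:ℝ) 1 := ⟨hx.1, hx.2.trans ht.2⟩
      have hd : 0 ≤ P t - P x := sub_nonneg.2 (hmono hx1 ht hx.2)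
      have hd1 : P t - P x ≤ 1 := by
        linarith [hmono h0 hx1 hx1.1, hmono ht h1 ht.2]
      have e1 := mul_le_mul_of_nonneg_left (hy₁ x hx1) hd
      have e2 : 0 ≤ (1 - (P t - P x)) * (-m * Real.exp (k * x)) :=
        mul_nonneg (by linarith) (mul_nonneg (by linarith) (Real.exp_pos _).le)
      have e3 : 0 ≤ lam * ((P t - P x) * y₁ x - m * Real.exp (k * x)) :=
        mul_nonneg hlam.le (by linarith)
      linarith)
    (s := 0) ⟨le_rfl, ht.1⟩
  have hneg : lam * m / k ≤ 0 :=
    div_nonpos_of_nonpos_of_nonneg (mul_nonpos_of_nonneg_of_nonpos hlam.le hm) hk.le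
  simp only [hP0, mul_zero, Real.exp_zero] at key
  linarith

/-- The first derivative of a solution with nonnegative initial data is nonnegative. -/
theorem first_deriv_nonneg
    (hmono : MonotoneOn P (Icc 0 1)) (hP0 : P 0 = 0) (hP1 : P 1 = 1) (hlam : 0 < lam)
    (h₁ : ∀ x ∈ Icc (0:ℝ) 1, HasDerivWithinAt y (y₁ x) (Icc 0 1) x)
    (h₂ : ∀ x ∈ Icc (0:ℝ) 1, HasDerivWithinAt y₁ (y₂ x) (Icc 0 1) x)
    (h₃ : ∀ x ∈ Icc (0:ℝ) 1, HasDerivWithinAt y₂ (y₃ x) (Icc 0 1) x)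
    (h₄ : ∀ x ∈ Icc (0:ℝ) 1, HasDerivWithinAt (fun t => y₃ t - lam * P t * y t)
      (-(lam * P x * y₁ x)) (Icc 0 1) x)
    (i₀ : 0 ≤ y 0) (i₁ : 0 ≤ y₁ 0) (i₂ : 0 ≤ y₂ 0) (i₃ : 0 ≤ y₃ 0) :
    ∀ x ∈ Icc (0:ℝ) 1, 0 ≤ y₁ x := by
  set k := lam + 1 with hkdef
  have hk : 0 < k := by linarith
  have hcont : ContinuousOn (fun x => y₁ x / Real.exp (k * x)) (Icc 0 1) :=
    ContinuousOn.div (fun x hx => (h₂ x hx).continuousWithinAt)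
      (by fun_prop) (fun x _ => (Real.exp_pos _).ne')
  obtain ⟨t, ht, hmin⟩ := isCompact_Icc.exists_isMinOn (nonempty_Icc.2 zero_le_one) hcont
  set m := y₁ t / Real.exp (k * t)
  have hlow : ∀ x ∈ Icc (0:ℝ) 1, m * Real.exp (k * x) ≤ y₁ x := fun x hx =>
    (le_div_iff₀ (Real.exp_pos _)).1 (hmin hx)
  rcases le_or_gt 0 m with hm | hm
  · exact fun x hx => (mul_nonneg hm (Real.exp_pos _).le).trans (hlow x hx)
  exfalso
  have c₁ : lam * m / k ≤ 0 :=
    div_nonpos_of_nonpos_of_nonneg (mul_nonpos_of_nonneg_of_nonpos hlam.le hm.le) hk.le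
  have c₂ : lam * m / k / k ≤ 0 := div_nonpos_of_nonpos_of_nonneg c₁ hk.le
  have b₃ : ∀ x ∈ Icc (0:ℝ) 1, lam * m / k * Real.exp (k * x) ≤ y₃ x := fun x hx => by
    have hb := third_deriv_lower_bound hmono hP0 hP1 hlam h₁ h₄ hk hm.le hlow hx
    have hPx : 0 ≤ P x := hP0 ▸ hmono ⟨le_rfl, zero_le_one⟩ hx hx.1
    have := mul_nonneg (mul_nonneg hlam.le hPx) i₀
    linarith
  have b₂ : ∀ x ∈ Icc (0:ℝ) 1, lam * m / k / k * Real.exp (k * x) ≤ y₂ x :=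
    fun x hx => lower_bound_of_deriv hk c₁ h₃ b₃ i₂ hx
  have b₁ := lower_bound_of_deriv hk c₂ h₂ b₂ i₁ ht
  have hm' : lam * m / k / k / k ≤ m := (le_div_iff₀ (Real.exp_pos _)).2 b₁
  have hlt : lam / k ^ 3 < 1 := by
    rw [div_lt_one (by positivity), hkdef]
    nlinarith [pow_pos hlam 3, pow_pos hlam 2]
  have heq : lam * m / k / k / k = lam / k ^ 3 * m := by field_simp
  nlinarith

/-- A solution satisfying the boundary conditions vanishes if `y` and `y''` are both
nonnegative at `0`. -/
theorem eq_zero_of_initial_data_nonneg {α β : ℝ} (hα : 0 ≤ α) (hβ : 0 < β)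
    (hmono : MonotoneOn P (Icc 0 1)) (hP0 : P 0 = 0) (hP1 : P 1 = 1) (hlam : 0 < lam)
    (h₁ : ∀ x ∈ Icc (0:ℝ) 1, HasDerivWithinAt y (y₁ x) (Icc 0 1) x)
    (h₂ : ∀ x ∈ Icc (0:ℝ) 1, HasDerivWithinAt y₁ (y₂ x) (Icc 0 1) x)
    (h₃ : ∀ x ∈ Icc (0:ℝ) 1, HasDerivWithinAt y₂ (y₃ x) (Icc 0 1) x)
    (h₄ : ∀ x ∈ Icc (0:ℝ) 1, HasDerivWithinAt (fun t => y₃ t - lam * P t * y t)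
      (-(lam * P x * y₁ x)) (Icc 0 1) x)
    (bc₁ : y₂ 0 + α * y 0 - β * y₁ 0 = 0) (bc₂ : -β * y₃ 0 + α * y₂ 0 = 0)
    (bc₃ : y₂ 1 + α * y 1 + β * y₁ 1 = 0) (bc₄ : -β * y₃ 1 - α * y₂ 1 = 0)
    (i₀ : 0 ≤ y 0) (i₂ : 0 ≤ y₂ 0) :
    ∀ x ∈ Icc (0:ℝ) 1, y x = 0 := by
  have hmem : (1:ℝ) ∈ Icc (0:ℝ) 1 := ⟨zero_le_one, le_rfl⟩
  have i₁ : 0 ≤ y₁ 0 := by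
    refine le_of_mul_le_mul_left ?_ hβ
    linarith [mul_nonneg hα i₀]
  have i₃ : 0 ≤ y₃ 0 := by
    refine le_of_mul_le_mul_left ?_ hβ
    linarith [mul_nonneg hα i₂]
  have n₁ := first_deriv_nonneg hmono hP0 hP1 hlam h₁ h₂ h₃ h₄ i₀ i₁ i₂ i₃
  have l₃ : ∀ x ∈ Icc (0:ℝ) 1, y₃ 0 + lam * P x * y 0 ≤ y₃ x := fun x hx => by
    have := third_deriv_lower_bound hmono hP0 hP1 hlam h₁ h₄ (k := 1) one_pos le_rfl
      (fun x hx => by simpa using n₁ x hx) hx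
    simpa using this
  have n₃ : ∀ x ∈ Icc (0:ℝ) 1, 0 ≤ y₃ x := fun x hx => by
    have hPx : 0 ≤ P x := hP0 ▸ hmono ⟨le_rfl, zero_le_one⟩ hx hx.1
    linarith [l₃ x hx, mul_nonneg (mul_nonneg hlam.le hPx) i₀]
  have sub : ∀ {t x : ℝ}, t ∈ Icc (0:ℝ) 1 → x ∈ Icc (0:ℝ) t → x ∈ Icc (0:ℝ) 1 :=
    fun ht hx => ⟨hx.1, hx.2.trans ht.2⟩
  have n₂ : ∀ x ∈ Icc (0:ℝ) 1, 0 ≤ y₂ x := fun x hx =>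
    i₂.trans (le_of_hasDerivWithinAt_nonneg hx h₃ (fun s hs => n₃ s (sub hx hs)) ⟨le_rfl, hx.1⟩)
  have n₀ : ∀ x ∈ Icc (0:ℝ) 1, 0 ≤ y x := fun x hx =>
    i₀.trans (le_of_hasDerivWithinAt_nonneg hx h₁ (fun s hs => n₁ s (sub hx hs)) ⟨le_rfl, hx.1⟩)
  have p₀ := mul_nonneg hα (n₀ 1 hmem)
  have p₁ := mul_nonneg hβ.le (n₁ 1 hmem)
  have p₂ := n₂ 1 hmem
  have e₂ : y₂ 1 = 0 := by linarith
  have e₁ : y₁ 1 = 0 := (mul_eq_zero_iff_left hβ.ne').1 (by linarith)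
  have e₃ : y₃ 1 = 0 := (mul_eq_zero_iff_left hβ.ne').1 (by rw [e₂] at bc₄; linarith)
  have z₁ : ∀ x ∈ Icc (0:ℝ) 1, y₁ x = 0 := fun x hx =>
    le_antisymm (e₁ ▸ le_of_hasDerivWithinAt_nonneg hmem h₂ n₂ hx) (n₁ x hx)
  have hy0 : y 0 = 0 := by
    have h := l₃ 1 hmem
    rw [e₃, hP1, mul_one] at h
    refine le_antisymm (le_of_mul_le_mul_left ?_ hlam) i₀
    linarith
  intro x hx
  have h := le_of_hasDerivWithinAt_nonneg hx (fun s hs => (h₁ s hs).neg)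
    (fun s hs => by simp [z₁ s (sub hx hs)]) ⟨le_rfl, hx.1⟩
  simp only [Pi.neg_apply, hy0] at h
  linarith [n₀ x hx]

end Positivity

theorem stmt13 (P : ℝ → ℝ) (κ : ℕ) (a : ℝ) (hP : CantorSelfSimilar P κ a)
    (α β : ℝ) (hα : 0 ≤ α) (hβ : 0 < β)
    (lam : ℝ) (hlam : 0 < lam) (y : ℝ → ℝ) (hy : Eigenfunction P α β lam y) :
    y 0 * Y2 y 0 < 0 := by
  obtain ⟨-, hmono, hP0, hP1, -⟩ := hP
  obtain ⟨⟨x, hx, hyx⟩, ⟨hC, h₄⟩, bc₁, bc₂, bc₃, bc₄⟩ := hy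
  have hu : UniqueDiffOn ℝ (Icc (0:ℝ) 1) := uniqueDiffOn_Icc zero_lt_one
  have hD : ∀ n : ℕ, n < 3 → ∀ x ∈ Icc (0:ℝ) 1,
      HasDerivWithinAt (iteratedDerivWithin n y (Icc 0 1))
        (iteratedDerivWithin (n + 1) y (Icc 0 1) x) (Icc 0 1) x := fun n hn x hx => by
    rw [iteratedDerivWithin_succ]
    exact (hC.differentiableOn_iteratedDerivWithin (by exact_mod_cast hn) hu x hx).hasDerivWithinAt
  have h₁ : ∀ x ∈ Icc (0:ℝ) 1, HasDerivWithinAt y (Y1 y x) (Icc 0 1) x := fun x hx =>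
    (hC.differentiableOn (by norm_num) x hx).hasDerivWithinAt
  have h₂ : ∀ x ∈ Icc (0:ℝ) 1, HasDerivWithinAt (Y1 y) (Y2 y x) (Icc 0 1) x := by
    have h := hD 1 (by norm_num)
    rwa [show iteratedDerivWithin 1 y (Icc 0 1) = Y1 y from iteratedDerivWithin_one] at h
  have h₃ : ∀ x ∈ Icc (0:ℝ) 1, HasDerivWithinAt (Y2 y) (Y3 y x) (Icc 0 1) x :=
    hD 2 (by norm_num)
  by_contra! hcon
  rcases mul_nonneg_iff.1 hcon with ⟨i₀, i₂⟩ | ⟨i₀, i₂⟩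
  · exact hyx (eq_zero_of_initial_data_nonneg hα hβ hmono hP0 hP1 hlam h₁ h₂ h₃ h₄
      bc₁ bc₂ bc₃ bc₄ i₀ i₂ x hx)
  · refine hyx (neg_eq_zero.1 (eq_zero_of_initial_data_nonneg (P := P) (y := fun t => -y t)
      (y₁ := fun t => -Y1 y t) (y₂ := fun t => -Y2 y t) (y₃ := fun t => -Y3 y t)
      hα hβ hmono hP0 hP1 hlam (fun x hx => (h₁ x hx).neg) (fun x hx => (h₂ x hx).neg)
      (fun x hx => (h₃ x hx).neg) (fun x hx => ?_) (by linarith) (by linarith) (by linarith)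
      (by linarith) (neg_nonneg.2 i₀) (neg_nonneg.2 i₂) x hx))
    refine ((h₄ x hx).neg.congr_deriv (by ring)).congr_of_mem (fun t _ => ?_) hx
    simp only [Pi.neg_apply]
    ring
end
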